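/- Let Ω be a bounded strictly pseudoconvex domain in ℂⁿ with C³ boundary, and let f : Ω̄ → [0,∞) be a nonnegative function such that f^{1/n} ∈ C^{1,1}(Ω̄). Then there is a unique plurisubharmonic function v ∈ C^{1,1}(Ω̄) satisfying det H(v)(z) = f(z) almost everywhere in Ω and v = 0 on ∂Ω. -/

import Mathlib

open Complex Metric

noncomputable section

/-- The Wirtinger derivative `∂f/∂z_j` of `f : ℂⁿ → ℂ` at `z`. -/
def wDz (n : ℕ) (j : Fin n) (f : EuclideanSpace ℂ (Fin n) → ℂ)
    (z : EuclideanSpace ℂ (Fin n)) : ℂ :=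
  (fderiv ℝ f z (EuclideanSpace.single j 1)
    - Complex.I * fderiv ℝ f z (EuclideanSpace.single j Complex.I)) / 2

/-- The Wirtinger derivative `∂f/∂z̄_j` of `f : ℂⁿ → ℂ` at `z`. -/
def wDzBar (n : ℕ) (j : Fin n) (f : EuclideanSpace ℂ (Fin n) → ℂ)
    (z : EuclideanSpace ℂ (Fin n)) : ℂ :=
  (fderiv ℝ f z (EuclideanSpace.single j 1)
    + Complex.I * fderiv ℝ f z (EuclideanSpace.single j Complex.I)) / 2

/-- The complex Hessian matrix `H(u)(z) = [∂²u/∂z_i∂z̄_j(z)]` of a real-valued `u`. -/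
def cHess (n : ℕ) (u : EuclideanSpace ℂ (Fin n) → ℝ)
    (z : EuclideanSpace ℂ (Fin n)) : Matrix (Fin n) (Fin n) ℂ :=
  Matrix.of fun i j => wDz n i (fun w => wDzBar n j (fun v => ((u v : ℝ) : ℂ)) w) z

/-- The Hermitian form `Σ_{i,j} H(u)(z)_{ij} w_i w̄_j`. -/
def cHessForm (n : ℕ) (u : EuclideanSpace ℂ (Fin n) → ℝ)
    (z : EuclideanSpace ℂ (Fin n)) (w : Fin n → ℂ) : ℂ :=
  ∑ i, ∑ j, cHess n u z i j * w i * (starRingEnd ℂ) (w j)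

/-- The pairing `Σ_j (∂u/∂z_j)(z) w_j` of the complex gradient with a vector. -/
def cGradPair (n : ℕ) (u : EuclideanSpace ℂ (Fin n) → ℝ)
    (z : EuclideanSpace ℂ (Fin n)) (w : Fin n → ℂ) : ℂ :=
  ∑ j, wDz n j (fun v => ((u v : ℝ) : ℂ)) z * w j

/-- `ρ` is a `C^k` defining function for `Ω`, defined on the open neighborhood `U` of `Ω̄`. -/
def IsDefiningFn (n : ℕ) (k : ℕ∞) (Ω U : Set (EuclideanSpace ℂ (Fin n)))
    (ρ : EuclideanSpace ℂ (Fin n) → ℝ) : Prop :=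
  IsOpen U ∧ closure Ω ⊆ U ∧ ContDiffOn ℝ k ρ U ∧
    Ω = {z ∈ U | ρ z < 0} ∧ ∀ z ∈ frontier Ω, fderiv ℝ ρ z ≠ 0

/-- `Ω` is a bounded strictly pseudoconvex domain with `C^k` boundary. -/
def IsStrictlyPseudoconvexDomain (n : ℕ) (k : ℕ∞)
    (Ω : Set (EuclideanSpace ℂ (Fin n))) : Prop :=
  IsOpen Ω ∧ Bornology.IsBounded Ω ∧
    ∃ U ρ, IsDefiningFn n k Ω U ρ ∧
      ∀ z ∈ frontier Ω, ∀ w : Fin n → ℂ, w ≠ 0 →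
        cGradPair n ρ z w = 0 → 0 < (cHessForm n ρ z w).re

/-- The complex Jacobian matrix `φ'(z) = [∂φ_i/∂z_j(z)]` of `φ : ℂⁿ → ℂⁿ`. -/
def jacobian (n : ℕ) (φ : EuclideanSpace ℂ (Fin n) → EuclideanSpace ℂ (Fin n))
    (z : EuclideanSpace ℂ (Fin n)) : Matrix (Fin n) (Fin n) ℂ :=
  Matrix.of fun i j => wDz n j (fun w => φ w i) z

/-- `φ` is a proper map from `Ω₁` to `Ω₂`. -/
def IsProperMapOn (n : ℕ) (φ : EuclideanSpace ℂ (Fin n) → EuclideanSpace ℂ (Fin n))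
    (Ω₁ Ω₂ : Set (EuclideanSpace ℂ (Fin n))) : Prop :=
  Set.MapsTo φ Ω₁ Ω₂ ∧ ∀ K ⊆ Ω₂, IsCompact K → IsCompact {z ∈ Ω₁ | φ z ∈ K}


/-- Borel measurable structure on `ℂⁿ`. -/
noncomputable instance (n : ℕ) : MeasurableSpace (EuclideanSpace ℂ (Fin n)) := borel _

instance (n : ℕ) : BorelSpace (EuclideanSpace ℂ (Fin n)) := ⟨rfl⟩

/-- Lebesgue (Haar) measure on `ℂⁿ`. -/
noncomputable instance (n : ℕ) : MeasureTheory.MeasureSpace (EuclideanSpace ℂ (Fin n)) :=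
  ⟨MeasureTheory.Measure.addHaar⟩

/-- `g ∈ C^{1,1}(Ω̄)`: `g` is `C¹` on `Ω` and its gradient is (uniformly) Lipschitz on `Ω`. -/
def C11On (n : ℕ) (Ω : Set (EuclideanSpace ℂ (Fin n)))
    (g : EuclideanSpace ℂ (Fin n) → ℝ) : Prop :=
  ContDiffOn ℝ 1 g Ω ∧
    ∃ C : ℝ, ∀ z ∈ Ω, ∀ w ∈ Ω, ‖fderiv ℝ g z - fderiv ℝ g w‖ ≤ C * ‖z - w‖

section P1sec
open scoped ComplexOrder

abbrev EE (n : ℕ) := EuclideanSpace ℂ (Fin n)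
abbrev BF (n : ℕ) := EE n →L[ℝ] EE n →L[ℝ] ℝ

/-- Levi form of a real bilinear form. -/
def lv {n : ℕ} (Q : BF n) (w : EE n) : ℝ := (Q w w + Q (I • w) (I • w)) / 4

def eMat {n : ℕ} (e : Fin n → EE n) : Matrix (Fin n) (Fin n) ℂ := Matrix.of fun i k => e k i

/-- `det^{1/n}` of the Levi form is at least `γ` (for `γ ≥ 0`), linear formulation. -/
def SubM {n : ℕ} (Q : BF n) (γ : ℝ) : Prop :=
  ∀ e : Fin n → EE n, ‖(eMat e).det‖ = 1 → n * γ ≤ ∑ k, lv Q (e k)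

lemma amgm_real {n : ℕ} (hn : 0 < n) (x : Fin n → ℝ) (hx : ∀ i, 0 ≤ x i) {γ : ℝ}
    (h : γ ^ n ≤ ∏ i, x i) : n * γ ≤ ∑ i, x i := by
  have hn' : (0 : ℝ) < n := by exact_mod_cast hn
  have h1 := Real.geom_mean_le_arith_mean Finset.univ (fun _ => (1:ℝ)) x (by simp)
    (by simpa using hn) (fun i _ => hx i)
  simp only [Real.rpow_one, Finset.sum_const, Finset.card_univ, Fintype.card_fin, nsmul_eq_mul,
    mul_one, one_mul] at h1
  rcases le_or_gt γ 0 with hγ | hγ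
  · have : 0 ≤ ∑ i, x i := Finset.sum_nonneg fun i _ => hx i
    nlinarith
  have h2 : γ ≤ (∏ i, x i) ^ (n:ℝ)⁻¹ := by
    calc γ = (γ ^ n) ^ (n:ℝ)⁻¹ := (Real.pow_rpow_inv_natCast hγ.le hn.ne').symm
      _ ≤ _ := Real.rpow_le_rpow (by positivity) h (by positivity)
  have h3 := h2.trans h1
  rw [le_div_iff₀ hn'] at h3
  linarith

lemma psd_amgm {n : ℕ} (hn : 0 < n) {N : Matrix (Fin n) (Fin n) ℂ} (hN : N.PosSemidef) {γ : ℝ}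
    (h : γ ^ n ≤ N.det.re) : n * γ ≤ N.trace.re := by
  have hd := hN.isHermitian.det_eq_prod_eigenvalues
  have ht := hN.isHermitian.trace_eq_sum_eigenvalues
  have h1 : N.det.re = ∏ i, hN.isHermitian.eigenvalues i := by
    rw [hd]; norm_cast
  have h2 : N.trace.re = ∑ i, hN.isHermitian.eigenvalues i := by
    rw [ht]; norm_cast
  rw [h2]
  exact amgm_real hn _ hN.eigenvalues_nonneg (h1 ▸ h)

lemma psd_amgm_conj {n : ℕ} (hn : 0 < n) {N P : Matrix (Fin n) (Fin n) ℂ} (hN : N.PosSemidef)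
    (hP : ‖P.det‖ = 1) {γ : ℝ}
    (h : γ ^ n ≤ N.det.re) : n * γ ≤ (P.conjTranspose * N * P).trace.re := by
  refine psd_amgm hn (hN.conjTranspose_mul_mul_same P) ?_
  have : (P.conjTranspose * N * P).det = N.det := by
    rw [Matrix.det_mul, Matrix.det_mul, Matrix.det_conjTranspose]
    have : star P.det * P.det = 1 := by
      have := Complex.normSq_eq_conj_mul_self (z := P.det)
      rw [Complex.normSq_eq_norm_sq, hP] at this
      simpa using this.symm
    linear_combination N.det * this
  rwa [this]

/-- The Hermitian matrix of the Levi form. -/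
def hm {n : ℕ} (Q : BF n) : Matrix (Fin n) (Fin n) ℂ := Matrix.of fun i j =>
  (1/4 : ℂ) * (((Q (EuclideanSpace.single j 1) (EuclideanSpace.single i 1)
      + Q (EuclideanSpace.single j I) (EuclideanSpace.single i I) : ℝ) : ℂ)
    + I * ((Q (EuclideanSpace.single j 1) (EuclideanSpace.single i I)
      - Q (EuclideanSpace.single j I) (EuclideanSpace.single i 1) : ℝ) : ℂ))

lemma ee_expand {n : ℕ} (w : EE n) : w = ∑ i, ((w i).re • EuclideanSpace.single i (1:ℂ)
    + (w i).im • EuclideanSpace.single i I) := by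
  ext j
  simp only [WithLp.ofLp_sum, Finset.sum_apply, PiLp.add_apply, PiLp.smul_apply,
    PiLp.single_apply, EuclideanSpace.single]
  rw [Finset.sum_eq_single j]
  · simp [Complex.re_add_im]
  · intro b _ hb; simp [hb.symm]
  · simp

lemma bf_expand {n : ℕ} (Q : BF n) (w : EE n) : Q w w = ∑ i, ∑ j,
    ((w j).re * (w i).re * Q (EuclideanSpace.single j 1) (EuclideanSpace.single i 1)
    + (w j).re * (w i).im * Q (EuclideanSpace.single j 1) (EuclideanSpace.single i I)
    + (w j).im * (w i).re * Q (EuclideanSpace.single j I) (EuclideanSpace.single i 1)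
    + (w j).im * (w i).im * Q (EuclideanSpace.single j I) (EuclideanSpace.single i I)) := by
  conv_lhs => rw [ee_expand w]
  simp only [map_sum, map_add, map_smul, add_apply, smul_eq_mul,
    sum_apply, smul_apply]
  refine Finset.sum_congr rfl fun i _ => ?_
  rw [Finset.mul_sum, Finset.mul_sum, ← Finset.sum_add_distrib]
  refine Finset.sum_congr rfl fun j _ => ?_
  ring

lemma hm_form {n : ℕ} (Q : BF n) (w : EE n) :
    (∑ i, ∑ j, (starRingEnd ℂ) (w i) * hm Q i j * w j).re = lv Q w := by
  unfold lv
  rw [bf_expand, bf_expand, ← Finset.sum_add_distrib, Finset.sum_div, Complex.re_sum]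
  refine Finset.sum_congr rfl fun i _ => ?_
  rw [← Finset.sum_add_distrib, Finset.sum_div, Complex.re_sum]
  refine Finset.sum_congr rfl fun j _ => ?_
  simp [hm, Complex.add_re, Complex.mul_re, Complex.add_im, Complex.mul_im]
  ring

lemma hm_herm {n : ℕ} {Q : BF n} (hQ : ∀ x y, Q x y = Q y x) : (hm Q).IsHermitian := by
  ext i j
  simp only [Matrix.conjTranspose_apply, hm, Matrix.of_apply]
  rw [hQ (EuclideanSpace.single i 1) (EuclideanSpace.single j 1),
    hQ (EuclideanSpace.single i I) (EuclideanSpace.single j I),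
    hQ (EuclideanSpace.single i 1) (EuclideanSpace.single j I),
    hQ (EuclideanSpace.single i I) (EuclideanSpace.single j 1)]
  simp
  apply Complex.ext <;> simp

lemma trace_form {n : ℕ} (N : Matrix (Fin n) (Fin n) ℂ) (e : Fin n → EE n) :
    ((eMat e).conjTranspose * N * eMat e).trace
      = ∑ k, ∑ i, ∑ j, (starRingEnd ℂ) (e k i) * N i j * e k j := by
  simp only [Matrix.trace, Matrix.diag, Matrix.mul_apply, Matrix.conjTranspose_apply, eMat,
    Matrix.of_apply]
  refine Finset.sum_congr rfl fun k _ => ?_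
  rw [Finset.sum_comm]
  refine Finset.sum_congr rfl fun i _ => ?_
  rw [Finset.sum_mul]
  rfl

lemma sum_lv_eq {n : ℕ} (Q : BF n) (e : Fin n → EE n) :
    ∑ k, lv Q (e k) = ((eMat e).conjTranspose * hm Q * eMat e).trace.re := by
  rw [trace_form, Complex.re_sum]
  exact Finset.sum_congr rfl fun k _ => (hm_form Q (e k)).symm

lemma subM_of_det {n : ℕ} (hn : 0 < n) {Q : BF n} (hN : (hm Q).PosSemidef) {γ : ℝ}
    (h : γ ^ n ≤ (hm Q).det.re) : SubM Q γ := by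
  intro e he
  rw [sum_lv_eq]
  exact psd_amgm_conj hn hN he h

lemma real_dual {n : ℕ} (hn : 0 < n) (l : Fin n → ℝ) {γ : ℝ} (hγ : 0 ≤ γ)
    (h : ∀ t : Fin n → ℝ, (∀ i, 0 < t i) → ∏ i, t i = 1 → n * γ ≤ ∑ i, l i * t i) :
    (∀ i, 0 ≤ l i) ∧ γ ^ n ≤ ∏ i, l i := by
  have hn' : (0 : ℝ) < n := by exact_mod_cast hn
  have hl : ∀ i, 0 ≤ l i := by
    intro j
    by_contra hj
    push Not at hj
    set s := ∑ i ∈ Finset.univ.erase j, l i with hs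
    have key : ∀ T : ℝ, 0 < T → 0 ≤ l j * T ^ n + s := by
      intro T hT
      have := h (fun i => if i = j then T ^ (n-1) else T⁻¹) (by
        intro i; split_ifs <;> positivity) (by
        rw [← Finset.mul_prod_erase _ _ (Finset.mem_univ j)]
        rw [Finset.prod_congr rfl (g := fun _ => T⁻¹)
          (fun i hi => by simp [(Finset.mem_erase.1 hi).1])]
        simp [← mul_pow, hT.ne'])
      rw [← Finset.add_sum_erase _ _ (Finset.mem_univ j)] at this
      rw [Finset.sum_congr rfl (g := fun i => l i * T⁻¹)
          (fun i hi => by simp [(Finset.mem_erase.1 hi).1]), ← Finset.sum_mul, ← hs] at this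
      simp only [if_true] at this
      have h0 : 0 ≤ l j * T ^ (n-1) + s * T⁻¹ := le_trans (by positivity) this
      have := mul_nonneg h0 hT.le
      have e1 : (l j * T ^ (n-1) + s * T⁻¹) * T = l j * T ^ n + s := by
        obtain ⟨m, rfl⟩ : ∃ m, n = m + 1 := ⟨n - 1, by omega⟩
        field_simp
        simp; ring
      rwa [e1] at this
    have hT : (1:ℝ) ≤ 1 + |s| / |l j| := by
      have : 0 ≤ |s| / |l j| := by positivity
      linarith
    have h1 := key (1 + |s| / |l j|) (by linarith)
    have h2 : (1 + |s| / |l j|) ≤ (1 + |s| / |l j|) ^ n := le_self_pow₀ hT hn.ne'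
    have h3 : l j * (1 + |s| / |l j|) ^ n ≤ l j * (1 + |s| / |l j|) :=
      mul_le_mul_of_nonpos_left h2 hj.le
    have h4 : l j * (1 + |s| / |l j|) = l j - |s| := by
      have hj' : l j ≠ 0 := hj.ne
      rw [abs_of_neg hj]; field_simp; ring
    have := le_abs_self s
    linarith
  refine ⟨hl, ?_⟩
  have key : ∀ ε : ℝ, 0 < ε → γ ^ n ≤ ∏ i, (l i + ε) := by
    intro ε hε
    have hp : ∀ i, 0 < l i + ε := fun i => by linarith [hl i]
    have hpp : 0 < ∏ i, (l i + ε) := Finset.prod_pos fun i _ => hp i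
    set c := (∏ i, (l i + ε)) ^ (n:ℝ)⁻¹ with hc
    have hc0 : 0 < c := Real.rpow_pos_of_pos hpp _
    have hcn : c ^ n = ∏ i, (l i + ε) := Real.rpow_inv_natCast_pow hpp.le hn.ne'
    have := h (fun i => c / (l i + ε)) (fun i => div_pos hc0 (hp i)) (by
      rw [Finset.prod_div_distrib]; simp [hcn, hpp.ne'])
    have h2 : ∑ i, l i * (c / (l i + ε)) ≤ ∑ i : Fin n, c := by
      refine Finset.sum_le_sum fun i _ => ?_
      rw [mul_div_assoc', div_le_iff₀ (hp i)]
      nlinarith [hl i]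
    simp at h2
    have h3 : γ ≤ c := by
      have := this.trans h2
      exact le_of_mul_le_mul_left this hn'
    rw [← hcn]
    exact pow_le_pow_left₀ hγ h3 n
  have hcont : Filter.Tendsto (fun ε : ℝ => ∏ i, (l i + ε)) (nhdsWithin 0 (Set.Ioi 0))
      (nhds (∏ i, (l i + 0))) := by
    refine Filter.Tendsto.mono_left ?_ nhdsWithin_le_nhds
    exact (continuous_finsetProd _ fun i _ => by fun_prop).tendsto 0
  have := ge_of_tendsto hcont (Filter.eventually_of_mem self_mem_nhdsWithin fun ε hε => key ε hε)
  simpa using this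

lemma det_of_subM {n : ℕ} (hn : 0 < n) {Q : BF n} (hQ : ∀ x y, Q x y = Q y x) {γ : ℝ}
    (hγ : 0 ≤ γ) (h : SubM Q γ) : (hm Q).PosSemidef ∧ γ ^ n ≤ (hm Q).det.re := by
  have hH := hm_herm hQ
  have key := real_dual hn hH.eigenvalues hγ (by
    intro t ht htp
    have hU : star (hH.eigenvectorUnitary : Matrix (Fin n) (Fin n) ℂ) * hm Q
        * (hH.eigenvectorUnitary : Matrix (Fin n) (Fin n) ℂ)
        = Matrix.diagonal (fun i => (hH.eigenvalues i : ℂ)) := by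
      have := hH.conjStarAlgAut_star_eigenvectorUnitary
      simpa [Unitary.conjStarAlgAut_apply] using! this
    set U : Matrix (Fin n) (Fin n) ℂ := hH.eigenvectorUnitary.1 with hUdef
    set D : Matrix (Fin n) (Fin n) ℂ := Matrix.diagonal (fun i => ((Real.sqrt (t i) : ℝ) : ℂ)) with hD
    let e : Fin n → EE n := fun k => WithLp.toLp 2 (fun i => (U * D) i k)
    have he : eMat e = U * D := by ext i k; simp [eMat, e]
    have hdet : ‖(eMat e).det‖ = 1 := by
      rw [he, Matrix.det_mul, norm_mul]
      have h1 : ‖U.det‖ = 1 := by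
        have hu := (Matrix.mem_unitaryGroup_iff.1 hH.eigenvectorUnitary.2)
        have := congrArg Matrix.det hu
        rw [Matrix.det_mul, Matrix.star_eq_conjTranspose, Matrix.det_conjTranspose] at this
        have h2 := congrArg norm this
        simp at h2
        nlinarith [norm_nonneg U.det]
      have h2 : ‖D.det‖ = 1 := by
        rw [hD, Matrix.det_diagonal, norm_prod]
        simp only [Complex.norm_real, Real.norm_eq_abs]
        rw [Finset.prod_congr rfl (fun i _ => abs_of_nonneg (Real.sqrt_nonneg _)),
          ← Real.sqrt_prod _ (fun i _ => (ht i).le), htp, Real.sqrt_one]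
      rw [h1, h2, one_mul]
    have := h e hdet
    rw [sum_lv_eq, he] at this
    have e2 : (U * D).conjTranspose * hm Q * (U * D)
        = D.conjTranspose * (Matrix.diagonal (fun i => (hH.eigenvalues i : ℂ))) * D := by
      rw [← hU, Matrix.conjTranspose_mul, Matrix.star_eq_conjTranspose]
      simp only [Matrix.mul_assoc]
    rw [e2, hD, Matrix.diagonal_conjTranspose, Matrix.diagonal_mul_diagonal,
      Matrix.diagonal_mul_diagonal, Matrix.trace_diagonal, Complex.re_sum] at this
    refine this.trans (le_of_eq (Finset.sum_congr rfl fun i _ => ?_))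
    simp
    rw [mul_assoc, mul_comm, mul_assoc, Real.mul_self_sqrt (ht i).le])
  refine ⟨hH.posSemidef_iff_eigenvalues_nonneg.2 key.1, ?_⟩
  have h1 : (hm Q).det.re = ∏ i, hH.eigenvalues i := by
    rw [hH.det_eq_prod_eigenvalues]; norm_cast
  rw [h1]; exact key.2

end P1sec

section P1bsec
open scoped ComplexOrder

lemma sum_norm_sq_eq {n : ℕ} (e : Fin n → EE n) :
    ∑ k, ‖e k‖ ^ 2 = ((eMat e).conjTranspose * 1 * eMat e).trace.re := by
  rw [trace_form, Complex.re_sum]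
  refine Finset.sum_congr rfl fun k _ => ?_
  rw [EuclideanSpace.norm_sq_eq, Complex.re_sum]
  refine Finset.sum_congr rfl fun i _ => ?_
  rw [Finset.sum_eq_single i]
  · rw [Matrix.one_apply_eq, mul_one, ← Complex.normSq_eq_conj_mul_self, Complex.ofReal_re,
      Complex.normSq_eq_norm_sq]
  · intro j _ hj; rw [Matrix.one_apply_ne hj.symm]; simp
  · simp

lemma sum_norm_sq_ge {n : ℕ} (hn : 0 < n) (e : Fin n → EE n) (he : ‖(eMat e).det‖ = 1) :
    (n:ℝ) ≤ ∑ k, ‖e k‖ ^ 2 := by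
  rw [sum_norm_sq_eq]
  have := psd_amgm_conj hn (Matrix.PosSemidef.one (n := Fin n) (R := ℂ)) he (γ := 1) (by simp)
  simpa using this

lemma subM_of_lv {n : ℕ} (hn : 0 < n) {Q : BF n} {c : ℝ} (hc : 0 ≤ c)
    (h : ∀ w, c * ‖w‖ ^ 2 ≤ lv Q w) : SubM Q c := by
  intro e he
  calc (n:ℝ) * c ≤ (∑ k, ‖e k‖ ^ 2) * c :=
        mul_le_mul_of_nonneg_right (sum_norm_sq_ge hn e he) hc
    _ = ∑ k, c * ‖e k‖ ^ 2 := by rw [Finset.sum_mul]; simp_rw [mul_comm]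
    _ ≤ _ := Finset.sum_le_sum fun k _ => h _

lemma lv_add {n : ℕ} (Q Q' : BF n) (w : EE n) : lv (Q + Q') w = lv Q w + lv Q' w := by
  simp [lv]; ring

lemma lv_smul {n : ℕ} (t : ℝ) (Q : BF n) (w : EE n) : lv (t • Q) w = t * lv Q w := by
  simp [lv]; ring

lemma lv_smul_right {n : ℕ} (t : ℝ) (Q : BF n) (w : EE n) : lv Q (t • w) = t ^ 2 * lv Q w := by
  simp [lv, smul_comm I t w]; ring

lemma SubM.mono {n : ℕ} {Q Q' : BF n} {γ γ' : ℝ} (h : SubM Q γ) (hγ : γ' ≤ γ)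
    (hQ : ∀ w, lv Q w ≤ lv Q' w) : SubM Q' γ' := fun e he =>
  (mul_le_mul_of_nonneg_left hγ (Nat.cast_nonneg n)).trans
    ((h e he).trans (Finset.sum_le_sum fun k _ => hQ _))

lemma SubM.add {n : ℕ} {Q Q' : BF n} {γ γ' : ℝ} (h : SubM Q γ) (h' : SubM Q' γ') :
    SubM (Q + Q') (γ + γ') := fun e he => by
  simp only [lv_add, Finset.sum_add_distrib, mul_add]
  exact add_le_add (h e he) (h' e he)

lemma SubM.smul {n : ℕ} {Q : BF n} {γ : ℝ} (h : SubM Q γ) {t : ℝ} (ht : 0 ≤ t) :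
    SubM (t • Q) (t * γ) := fun e he => by
  simp only [lv_smul, ← Finset.mul_sum]
  have := mul_le_mul_of_nonneg_left (h e he) ht
  linarith

lemma SubM.scaled {n : ℕ} (hn : 0 < n) {Q : BF n} {γ : ℝ} (h : SubM Q γ) (hγ : 0 ≤ γ)
    {κ : ℝ} (hκ : 0 ≤ κ) (e : Fin n → EE n) (he0 : 0 < ‖(eMat e).det‖)
    (he : κ ^ n ≤ ‖(eMat e).det‖) :
    n * (κ ^ 2 * γ) ≤ ∑ k, lv Q (e k) := by
  set d := ‖(eMat e).det‖ with hd
  set c := d ^ (n:ℝ)⁻¹ with hc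
  have hc0 : 0 < c := Real.rpow_pos_of_pos he0 _
  have hcn : c ^ n = d := Real.rpow_inv_natCast_pow he0.le hn.ne'
  have hκc : κ ≤ c := by
    rw [← hcn] at he
    exact le_of_pow_le_pow_left₀ hn.ne' hc0.le he
  have h1 := h (fun k => c⁻¹ • e k) (by
    have : eMat (fun k => c⁻¹ • e k) = ((c⁻¹ : ℝ) : ℂ) • eMat e := by
      ext i k; simp [eMat]
    rw [this, Matrix.det_smul, norm_mul, ← hd, ← hcn]
    simp [abs_of_pos hc0, ← mul_pow, hc0.ne'])
  simp only [lv_smul_right, ← Finset.mul_sum] at h1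
  have h2 : c ^ 2 * (n * γ) ≤ ∑ k, lv Q (e k) := by
    have := mul_le_mul_of_nonneg_left h1 (sq_nonneg c)
    have e1 : c ^ 2 * (c⁻¹ ^ 2 * ∑ k, lv Q (e k)) = ∑ k, lv Q (e k) := by
      field_simp
    rwa [e1] at this
  refine le_trans ?_ h2
  have h3 : κ ^ 2 ≤ c ^ 2 := pow_le_pow_left₀ hκ hκc 2
  have h4 : 0 ≤ (n:ℝ) * γ := by positivity
  nlinarith

/-- `x ↦ x + ⟪b,x⟫ N` -/
def rk1 {n : ℕ} (b N' : EE n) : EE n →L[ℂ] EE n :=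
  ContinuousLinearMap.id ℂ (EE n) + (innerSL ℂ b).smulRight N'

lemma rk1_apply {n : ℕ} (b N' x : EE n) : rk1 b N' x = x + (inner ℂ b x) • N' := by
  simp [rk1]

lemma det_rk1 {n : ℕ} (b N' : EE n) (e : Fin n → EE n) :
    (eMat (fun k => rk1 b N' (e k))).det = (1 + inner ℂ b N') * (eMat e).det := by
  have : eMat (fun k => rk1 b N' (e k)) = (1 + Matrix.replicateCol Unit (N'.ofLp) *
      Matrix.replicateRow Unit (fun i => (starRingEnd ℂ) (b i))) * eMat e := by
    ext i k
    rw [Matrix.add_mul, Matrix.one_mul, Matrix.mul_assoc]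
    simp [eMat, rk1_apply, Matrix.mul_apply, PiLp.inner_apply]
    rw [mul_comm]
    congr 1
    exact Finset.sum_congr rfl fun j _ => mul_comm _ _
  rw [this, Matrix.det_mul, Matrix.det_one_add_replicateCol_mul_replicateRow]
  congr 2
  simp [dotProduct, PiLp.inner_apply]
  exact Finset.sum_congr rfl fun j _ => mul_comm _ _

/-- pull back of a bilinear form under a complex-linear map -/
def pullB {n : ℕ} (Q : BF n) (A : EE n →L[ℂ] EE n) : BF n :=
  Q.bilinearComp (A.restrictScalars ℝ) (A.restrictScalars ℝ)

lemma pullB_apply {n : ℕ} (Q : BF n) (A : EE n →L[ℂ] EE n) (x y : EE n) :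
    pullB Q A x y = Q (A x) (A y) := rfl

lemma lv_pullB {n : ℕ} (Q : BF n) (A : EE n →L[ℂ] EE n) (w : EE n) :
    lv (pullB Q A) w = lv Q (A w) := by
  simp [lv, pullB_apply]

lemma SubM.pull_rk1 {n : ℕ} (hn : 0 < n) {Q : BF n} {γ : ℝ} (h : SubM Q γ) (hγ : 0 ≤ γ)
    {κ : ℝ} (hκ : 0 < κ) (b N' : EE n) (hb : κ ^ n ≤ ‖1 + inner ℂ b N'‖) :
    SubM (pullB Q (rk1 b N')) (κ ^ 2 * γ) := by
  intro e he
  simp only [lv_pullB]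
  have : ‖(eMat (fun k => rk1 b N' (e k))).det‖ = ‖1 + inner ℂ b N'‖ := by
    rw [det_rk1, norm_mul, he, mul_one]
  exact SubM.scaled hn h hγ hκ.le (fun k => rk1 b N' (e k))
    (by rw [this]; exact lt_of_lt_of_le (pow_pos hκ n) hb) (by rwa [this])

/-- real inner product as a bilinear form -/
def ip (n : ℕ) : BF n := innerSL ℝ

lemma ip_self {n : ℕ} (w : EE n) : ip n w w = ‖w‖ ^ 2 := by
  show inner ℝ w w = _
  exact real_inner_self_eq_norm_sq w

lemma lv_ip {n : ℕ} (w : EE n) : lv (ip n) w = ‖w‖ ^ 2 / 2 := by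
  unfold lv
  rw [ip_self, ip_self, norm_smul]; simp; ring

/-- gradient vector -/
def gradV {n : ℕ} (l : EE n →L[ℝ] ℝ) : EE n :=
  WithLp.toLp 2 fun i => ((l (EuclideanSpace.single i 1) : ℝ) : ℂ)
    + I * ((l (EuclideanSpace.single i I) : ℝ) : ℂ)

lemma gradV_inner {n : ℕ} (l : EE n →L[ℝ] ℝ) (w : EE n) :
    inner ℂ (gradV l) w = ((l w : ℝ) : ℂ) - I * ((l (I • w) : ℝ) : ℂ) := by
  conv_rhs => rw [ee_expand w]
  simp only [map_sum, map_add, map_smul, PiLp.inner_apply, Finset.smul_sum, smul_add,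
    Complex.ofReal_sum, Finset.mul_sum, ← Finset.sum_sub_distrib]
  refine Finset.sum_congr rfl fun i _ => ?_
  have h1 : l (I • (w i).re • EuclideanSpace.single i (1:ℂ)) = (w i).re * l (EuclideanSpace.single i I) := by
    rw [smul_comm, map_smul, smul_eq_mul]; congr 2; ext j; simp [PiLp.single_apply]
  have h2 : l (I • (w i).im • EuclideanSpace.single i I) = - ((w i).im * l (EuclideanSpace.single i 1)) := by
    rw [smul_comm, map_smul, smul_eq_mul, ← mul_neg, ← map_neg]; congr 2; ext j; simp [PiLp.single_apply]; split_ifs <;> simp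
  rw [h1, h2]
  apply Complex.ext <;> simp [gradV] <;> ring

lemma gradV_sub {n : ℕ} (l l' : EE n →L[ℝ] ℝ) : gradV (l - l') = gradV l - gradV l' := by
  ext i; simp [gradV]; ring

lemma gradV_re {n : ℕ} (l : EE n →L[ℝ] ℝ) (w : EE n) : (inner ℂ (gradV l) w).re = l w := by
  rw [gradV_inner]; simp

lemma gradV_self {n : ℕ} (l : EE n →L[ℝ] ℝ) : l (gradV l) = ‖gradV l‖ ^ 2 := by
  rw [← gradV_re, inner_self_eq_norm_sq_to_K]; norm_cast

lemma gradV_normSq {n : ℕ} (l : EE n →L[ℝ] ℝ) (w : EE n) :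
    ‖inner ℂ (gradV l) w‖ ^ 2 = l w ^ 2 + l (I • w) ^ 2 := by
  rw [gradV_inner, ← Complex.normSq_eq_norm_sq, Complex.normSq_apply]; simp; ring

lemma gradV_norm {n : ℕ} (l : EE n →L[ℝ] ℝ) : ‖gradV l‖ = ‖l‖ := by
  apply le_antisymm
  · rcases eq_or_lt_of_le (norm_nonneg (gradV l)) with h | h
    · rw [← h]; positivity
    · have := l.le_opNorm (gradV l)
      rw [gradV_self, Real.norm_eq_abs, abs_of_nonneg (by positivity), sq] at this
      exact le_of_mul_le_mul_right this h
  · refine l.opNorm_le_bound (norm_nonneg _) fun w => ?_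
    rw [← gradV_re]
    exact (Complex.abs_re_le_norm _).trans (norm_inner_le_norm _ _)

/-- For the barrier construction. -/
lemma barrier_lin {n : ℕ} (hn : 0 < n) {c1 c C G : ℝ} (hc1 : 0 < c1) (hc : 0 < c) (hG : 0 ≤ G) :
    ∃ M0 : ℝ, 0 ≤ M0 ∧ ∀ M, M0 ≤ M → ∀ (Q : BF n) (l : EE n →L[ℝ] ℝ), c ≤ ‖l‖ → ‖l‖ ≤ C →
      (∀ w, c1 * ‖w‖ ^ 2 + M * (l w ^ 2 + l (I • w) ^ 2) ≤ lv Q w) → SubM Q G := by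
  set κ := G / c1 + 1 with hκ
  have hκ1 : 1 ≤ κ := by have : 0 ≤ G / c1 := by positivity
                         linarith
  set s := κ ^ n / c ^ 2 with hs
  have hs0 : 0 ≤ s := by positivity
  refine ⟨c1 * (2 * s + s ^ 2 * C ^ 2), by positivity, ?_⟩
  intro M hM Q l hl hlC hQ
  have h0 : SubM ((2 * c1) • ip n) c1 := subM_of_lv hn hc1.le (fun w => by
    rw [lv_smul, lv_ip]; apply le_of_eq; ring)
  have hν := gradV_norm l
  have key : SubM (pullB ((2 * c1) • ip n) (rk1 ((s:ℂ) • gradV l) (gradV l))) (κ ^ 2 * c1) := by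
    refine h0.pull_rk1 hn hc1.le (by linarith) _ _ ?_
    rw [inner_smul_left, inner_self_eq_norm_sq_to_K, hν]
    have : (1 + (starRingEnd ℂ) (s:ℂ) * ((‖l‖ : ℝ) : ℂ) ^ 2) = ((1 + s * ‖l‖ ^ 2 : ℝ) : ℂ) := by
      simp
    erw [this]
    rw [Complex.norm_real, Real.norm_eq_abs, abs_of_nonneg (by positivity)]
    have h5 : s * c ^ 2 = κ ^ n := by rw [hs]; field_simp
    have h6 : s * c ^ 2 ≤ s * ‖l‖ ^ 2 :=
      mul_le_mul_of_nonneg_left (pow_le_pow_left₀ hc.le hl 2) hs0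
    linarith
  refine key.mono ?_ ?_
  · have : κ * c1 = G + c1 := by rw [hκ]; field_simp
    have : κ * c1 ≤ κ ^ 2 * c1 := by nlinarith
    linarith
  · intro w
    refine le_trans ?_ (hQ w)
    rw [lv_pullB, lv_smul, lv_ip, rk1_apply, ← gradV_normSq]
    have : ‖w + inner ℂ ((s:ℂ) • gradV l) w • gradV l‖ ^ 2
        = ‖w‖ ^ 2 + (2 * s + s ^ 2 * ‖l‖ ^ 2) * ‖inner ℂ (gradV l) w‖ ^ 2 := by
      rw [norm_add_sq (𝕜 := ℂ), inner_smul_right, norm_smul, hν, inner_smul_left, norm_mul,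
        mul_assoc _ (inner ℂ (gradV l) w)]
      have e1 : inner ℂ (gradV l) w * inner ℂ w (gradV l) = ((‖inner ℂ (gradV l) w‖ ^ 2 : ℝ) : ℂ) := by
        rw [← inner_conj_symm w, mul_comm, ← Complex.normSq_eq_conj_mul_self, Complex.normSq_eq_norm_sq]
      rw [e1]
      simp [abs_of_nonneg hs0]
      ring_nf
      norm_cast
    rw [this]
    have h7 : ‖l‖ ^ 2 ≤ C ^ 2 := pow_le_pow_left₀ (norm_nonneg _) hlC 2
    have h8 : c1 * (2 * s + s ^ 2 * ‖l‖ ^ 2) ≤ M := le_trans (by gcongr) hM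
    have h9 := mul_le_mul_of_nonneg_right h8 (sq_nonneg ‖inner ℂ (gradV l) w‖)
    linarith

lemma SubM.lv_nonneg {n : ℕ} (hn : 0 < n) {Q : BF n} {γ : ℝ} (h : SubM Q γ) (hγ : 0 ≤ γ)
    (w : EE n) : 0 ≤ lv Q w := by
  set Q' : BF n := (1/2 : ℝ) • (Q + Q.flip) with hQ'
  have hlv : ∀ w, lv Q' w = lv Q w := by
    intro w; simp [hQ', lv]; ring
  have h1 : SubM Q' γ := h.mono le_rfl fun w => (hlv w).ge
  have h2 := (det_of_subM hn (Q := Q') (fun x y => by simp [hQ']; ring) hγ h1).1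
  rw [← hlv, ← hm_form]
  have := h2.dotProduct_mulVec_nonneg w.ofLp
  have h3 := (Complex.le_def.1 this).1
  refine h3.trans (le_of_eq ?_)
  congr 1
  simp [dotProduct, Matrix.mulVec, Finset.mul_sum, mul_assoc]

end P1bsec

section P2sec
open Filter Topology Asymptotics

def LS {n : ℕ} (u : EE n → ℝ) (z0 : EE n) (l : EE n →L[ℝ] ℝ) (Q : BF n) : Prop :=
  ∀ ε : ℝ, 0 < ε → ∀ᶠ z in 𝓝 z0,
    u z0 + l (z - z0) + Q (z - z0) (z - z0) / 2 - ε * ‖z - z0‖ ^ 2 ≤ u z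

def IsSubAt {n : ℕ} (u : EE n → ℝ) (z : EE n) (γ : ℝ) : Prop :=
  ∃ l Q, LS u z l Q ∧ SubM Q γ

def Ex2 {n : ℕ} (φ : EE n → ℝ) (z0 : EE n) (l : EE n →L[ℝ] ℝ) (Q : BF n) : Prop :=
  (fun z => φ z - φ z0 - l (z - z0) - Q (z - z0) (z - z0) / 2) =o[𝓝 z0] fun z => ‖z - z0‖ ^ 2

variable {n : ℕ}

lemma Ex2.ls {φ : EE n → ℝ} {z0 l} {Q : BF n} (h : Ex2 φ z0 l Q) : LS φ z0 l Q := by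
  intro ε hε
  filter_upwards [h.def hε] with z hz
  rw [Real.norm_eq_abs, Real.norm_eq_abs, abs_of_nonneg (sq_nonneg ‖z - z0‖)] at hz
  have := (abs_le.1 hz).1
  linarith

lemma Ex2.neg {φ : EE n → ℝ} {z0 l} {Q : BF n} (h : Ex2 φ z0 l Q) :
    Ex2 (fun z => - φ z) z0 (-l) (-Q) := by
  have := h.neg_left
  refine this.congr_left fun z => ?_
  simp; ring

lemma Ex2.add {φ ψ : EE n → ℝ} {z0 l l'} {Q Q' : BF n} (h : Ex2 φ z0 l Q) (h' : Ex2 ψ z0 l' Q') :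
    Ex2 (fun z => φ z + ψ z) z0 (l + l') (Q + Q') := by
  have := IsLittleO.add h h'
  refine this.congr_left fun z => ?_
  simp; ring

lemma Ex2.const_mul {φ : EE n → ℝ} {z0 l} {Q : BF n} (h : Ex2 φ z0 l Q) (t : ℝ) :
    Ex2 (fun z => t * φ z) z0 (t • l) (t • Q) := by
  have := h.const_mul_left t
  refine this.congr_left fun z => ?_
  simp; ring

lemma Ex2.add_const {φ : EE n → ℝ} {z0 l} {Q : BF n} (h : Ex2 φ z0 l Q) (t : ℝ) :
    Ex2 (fun z => φ z + t) z0 l Q := by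
  refine IsLittleO.congr_left h fun z => ?_
  ring

lemma Ex2.congr {φ ψ : EE n → ℝ} {z0 l} {Q : BF n} (h : Ex2 φ z0 l Q) (he : φ =ᶠ[𝓝 z0] ψ) :
    Ex2 ψ z0 l Q := by
  refine IsLittleO.congr' h ?_ EventuallyEq.rfl
  filter_upwards [he] with z hz
  rw [hz, he.self_of_nhds]

lemma Ex2.normsq (a z0 : EE n) :
    Ex2 (fun z => ‖z - a‖ ^ 2) z0 ((2:ℝ) • ip n (z0 - a)) ((2:ℝ) • ip n) := by
  have : (fun z => ‖z - a‖ ^ 2 - ‖z0 - a‖ ^ 2 - ((2:ℝ) • ip n (z0 - a)) (z - z0)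
      - ((2:ℝ) • ip n) (z - z0) (z - z0) / 2) = fun _ => (0:ℝ) := by
    funext z
    have h1 : ‖z - a‖ ^ 2 = ‖(z0 - a) + (z - z0)‖ ^ 2 := by congr 2; abel
    rw [h1, norm_add_sq_real, ← ip_self (z - z0)]
    have : ip n (z0 - a) (z - z0) = inner ℝ (z0 - a) (z - z0) := rfl
    simp only [smul_apply, this, smul_eq_mul]; ring
  unfold Ex2
  rw [this]
  exact isLittleO_zero _ _

lemma Ex2.lin (l : EE n →L[ℝ] ℝ) (z0 : EE n) : Ex2 (fun z => l z) z0 l 0 := by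
  have : (fun z => l z - l z0 - l (z - z0) - (0 : BF n) (z - z0) (z - z0) / 2) = fun _ => (0:ℝ) := by
    funext z; simp
  unfold Ex2
  rw [this]
  exact isLittleO_zero _ _

lemma Ex2.quad (Q : BF n) (z0 : EE n) : Ex2 (fun z => Q (z - z0) (z - z0) / 2) z0 0 Q := by
  have : (fun z => Q (z - z0) (z - z0) / 2 - Q (z0 - z0) (z0 - z0) / 2 - (0 : EE n →L[ℝ] ℝ) (z - z0)
      - Q (z - z0) (z - z0) / 2) = fun _ => (0:ℝ) := by
    funext z; simp
  unfold Ex2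
  rw [this]
  exact isLittleO_zero _ _

/-- square of a linear form -/
def sqf (l : EE n →L[ℝ] ℝ) : BF n := l.smulRight l

lemma sqf_apply (l : EE n →L[ℝ] ℝ) (x y : EE n) : sqf l x y = l x * l y := by simp [sqf]

lemma lv_sqf (l : EE n →L[ℝ] ℝ) (w : EE n) : lv (sqf l) w = (l w ^ 2 + l (I • w) ^ 2) / 4 := by
  simp [lv, sqf_apply]; ring

lemma norm_sq_isBigO_self (z0 : EE n) :
    (fun z => ‖z - z0‖ ^ 2) =o[𝓝 z0] fun z => ‖z - z0‖ := by
  have h2 : (fun z : EE n => ‖z - z0‖) =o[𝓝 z0] fun _ => (1:ℝ) := by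
    rw [isLittleO_one_iff]
    have : Tendsto (fun z : EE n => ‖z - z0‖) (𝓝 z0) (𝓝 ‖z0 - z0‖) :=
      (Continuous.tendsto (by fun_prop) z0)
    simpa using this
  have := (isBigO_refl (fun z : EE n => ‖z - z0‖) (𝓝 z0)).mul_isLittleO h2
  simpa [sq] using this

lemma Ex2.lin_err {φ : EE n → ℝ} {z0 l} {Q : BF n} (h : Ex2 φ z0 l Q) :
    (fun z => φ z - φ z0 - l (z - z0)) =O[𝓝 z0] fun z => ‖z - z0‖ ^ 2 := by
  have h1 : (fun z => Q (z - z0) (z - z0) / 2) =O[𝓝 z0] fun z => ‖z - z0‖ ^ 2 := by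
    refine IsBigO.of_bound ‖Q‖ (Eventually.of_forall fun z => ?_)
    have := Q.le_opNorm₂ (z - z0) (z - z0)
    rw [norm_div, Real.norm_of_nonneg (sq_nonneg ‖z - z0‖)]
    have h3 : ‖(2:ℝ)‖ = 2 := by simp
    rw [h3]
    have := norm_nonneg (Q (z-z0) (z-z0))
    nlinarith
  have := (IsLittleO.isBigO h).add h1
  refine this.congr_left fun z => ?_
  ring

lemma Ex2.sq {φ : EE n → ℝ} {z0 l} {Q : BF n} (h : Ex2 φ z0 l Q) :
    Ex2 (fun z => φ z ^ 2) z0 ((2 * φ z0) • l) ((2 * φ z0) • Q + (2:ℝ) • sqf l) := by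
  have h1 := h.lin_err
  have h2 : (fun z => l (z - z0)) =O[𝓝 z0] fun z => ‖z - z0‖ :=
    IsBigO.of_bound ‖l‖ (Eventually.of_forall fun z => by simpa using l.le_opNorm (z - z0))
  have h3 : (fun z => φ z - φ z0 + l (z - z0)) =O[𝓝 z0] fun z => ‖z - z0‖ := by
    have := (h1.trans_isLittleO (norm_sq_isBigO_self z0)).isBigO.add (h2.const_mul_left 2)
    refine this.congr_left fun z => ?_
    ring
  have h4 : (fun z => (φ z - φ z0 - l (z - z0)) * (φ z - φ z0 + l (z - z0)))
      =o[𝓝 z0] fun z => ‖z - z0‖ ^ 2 := by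
    have a := (h1.trans_isLittleO (norm_sq_isBigO_self z0)).mul_isBigO h3
    simpa [_root_.sq] using a
  have h5 := (IsLittleO.const_mul_left h (2 * φ z0)).add h4
  refine h5.congr_left fun z => ?_
  simp [sqf_apply]; ring

/-- Taylor -/
lemma Ex2.taylor {φ : EE n → ℝ} {φ' : EE n → EE n →L[ℝ] ℝ} {z0 : EE n} {B : BF n}
    (h : ∀ᶠ z in 𝓝 z0, HasFDerivAt φ (φ' z) z) (hB : HasFDerivAt φ' B z0) :
    Ex2 φ z0 (φ' z0) B := by
  unfold Ex2
  rw [isLittleO_iff]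
  intro ε hε
  have h1 := (hasFDerivAt_iff_isLittleO.1 hB).def hε
  obtain ⟨δ, hδ, hb⟩ := Metric.eventually_nhds_iff_ball.1 (h.and h1)
  filter_upwards [Metric.ball_mem_nhds z0 hδ] with z hz
  set x := z - z0 with hx
  have hin : ∀ t ∈ Set.Icc (0:ℝ) 1, z0 + t • x ∈ ball z0 δ := by
    intro t ht
    rw [mem_ball_iff_norm, add_sub_cancel_left, norm_smul, Real.norm_of_nonneg ht.1]
    rw [mem_ball_iff_norm] at hz
    nlinarith [norm_nonneg x, ht.2]
  have hder : ∀ t ∈ Set.Icc (0:ℝ) 1, HasDerivWithinAt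
      (fun t : ℝ => φ (z0 + t • x) - t * φ' z0 x - t ^ 2 / 2 * B x x)
      (φ' (z0 + t • x) x - φ' z0 x - t * B x x) (Set.Icc 0 1) t := by
    intro t ht
    have a1 : HasDerivAt (fun t : ℝ => z0 + t • x) x t := by
      simpa using ((hasDerivAt_id t).smul_const x).const_add z0
    have a2 : HasDerivAt (fun t : ℝ => φ (z0 + t • x)) (φ' (z0 + t • x) x) t :=
      (hb _ (hin t ht)).1.comp_hasDerivAt t a1
    have a3 : HasDerivAt (fun t : ℝ => t * φ' z0 x) (φ' z0 x) t := by
      simpa using (hasDerivAt_id t).mul_const (φ' z0 x)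
    have a4 : HasDerivAt (fun t : ℝ => t ^ 2 / 2 * B x x) (t * B x x) t := by
      have := ((hasDerivAt_pow 2 t).div_const 2).mul_const (B x x)
      refine this.congr_deriv ?_
      norm_num
    exact ((a2.sub a3).sub a4).hasDerivWithinAt
  have hbd : ∀ t ∈ Set.Icc (0:ℝ) 1, ‖φ' (z0 + t • x) x - φ' z0 x - t * B x x‖ ≤ ε * ‖x‖ ^ 2 := by
    intro t ht
    have := (hb _ (hin t ht)).2
    rw [add_sub_cancel_left] at this
    have e : φ' (z0 + t • x) x - φ' z0 x - t * B x x = (φ' (z0 + t • x) - φ' z0 - B (t • x)) x := by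
      simp
    rw [e]
    refine ((ContinuousLinearMap.le_opNorm _ _).trans
      (mul_le_mul_of_nonneg_right this (norm_nonneg _))).trans ?_
    rw [norm_smul, Real.norm_of_nonneg ht.1]
    have : t * ‖x‖ ≤ ‖x‖ := by nlinarith [norm_nonneg x, ht.2]
    have h0 := mul_nonneg hε.le (norm_nonneg x)
    nlinarith
  have := (convex_Icc (0:ℝ) 1).norm_image_sub_le_of_norm_hasDerivWithin_le hder hbd
    (Set.left_mem_Icc.2 zero_le_one) (Set.right_mem_Icc.2 zero_le_one)
  simp only [one_smul, zero_smul, add_zero, one_mul, one_pow, sub_zero, norm_one, mul_one] at this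
  have hz' : z0 + x = z := by rw [hx]; abel
  rw [hz'] at this
  rw [Real.norm_of_nonneg (sq_nonneg ‖x‖)]
  refine le_trans (le_of_eq ?_) this
  congr 1
  simp
  ring

lemma LS.add {u v : EE n → ℝ} {z0 l l'} {Q Q' : BF n} (h : LS u z0 l Q) (h' : LS v z0 l' Q') :
    LS (fun z => u z + v z) z0 (l + l') (Q + Q') := by
  intro ε hε
  filter_upwards [h (ε/2) (by positivity), h' (ε/2) (by positivity)] with z h1 h2
  simp only [add_apply]
  linarith

lemma LS.const_mul {u : EE n → ℝ} {z0 l} {Q : BF n} (h : LS u z0 l Q) {t : ℝ} (ht : 0 ≤ t) :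
    LS (fun z => t * u z) z0 (t • l) (t • Q) := by
  intro ε hε
  filter_upwards [h (ε/(t+1)) (by positivity)] with z h1
  have h2 := mul_le_mul_of_nonneg_left h1 ht
  have h3 : t * (ε / (t+1) * ‖z - z0‖ ^ 2) ≤ ε * ‖z - z0‖ ^ 2 := by
    rw [← mul_assoc]
    refine mul_le_mul_of_nonneg_right ?_ (sq_nonneg _)
    rw [mul_div_assoc', div_le_iff₀ (by linarith)]
    nlinarith
  simp only [smul_apply, smul_eq_mul]
  linarith

lemma LS.mono {u v : EE n → ℝ} {z0 l} {Q : BF n} (h : LS u z0 l Q) (h0 : u z0 = v z0)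
    (hle : ∀ᶠ z in 𝓝 z0, u z ≤ v z) : LS v z0 l Q := by
  intro ε hε
  filter_upwards [h ε hε, hle] with z h1 h2
  linarith

lemma LS.comp {u : EE n → ℝ} {x y : EE n} {l} {Q : BF n} (A : EE n →L[ℂ] EE n) (h : LS u y l Q) :
    LS (fun z => u (y + A (z - x))) x (l.comp (A.restrictScalars ℝ)) (pullB Q A) := by
  intro ε hε
  have ht : Tendsto (fun z => y + A (z - x)) (𝓝 x) (𝓝 y) := by
    have : Tendsto (fun z => y + A (z - x)) (𝓝 x) (𝓝 (y + A (x - x))) :=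
      Continuous.tendsto (by fun_prop) x
    simpa using this
  filter_upwards [ht.eventually (h (ε/(‖A‖^2+1)) (by positivity))] with z hz
  simp only [add_sub_cancel_left] at hz
  simp only [sub_self, map_zero, add_zero, pullB_apply, ContinuousLinearMap.comp_apply,
    ContinuousLinearMap.coe_restrictScalars']
  refine le_trans ?_ hz
  have h3 : ε/(‖A‖^2+1) * ‖A (z - x)‖ ^ 2 ≤ ε * ‖z - x‖ ^ 2 := by
    have := A.le_opNorm (z - x)
    have h4 : ‖A (z - x)‖ ^ 2 ≤ (‖A‖ * ‖z - x‖) ^ 2 := pow_le_pow_left₀ (norm_nonneg _) this 2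
    rw [div_mul_eq_mul_div, div_le_iff₀ (by positivity), mul_assoc]
    refine mul_le_mul_of_nonneg_left ?_ hε.le
    nlinarith [sq_nonneg ‖z - x‖]
  linarith

lemma IsSubAt.add {u v : EE n → ℝ} {z γ γ'} (h : IsSubAt u z γ) (h' : IsSubAt v z γ') :
    IsSubAt (fun z => u z + v z) z (γ + γ') := by
  obtain ⟨l, Q, h1, h2⟩ := h
  obtain ⟨l', Q', h1', h2'⟩ := h'
  exact ⟨_, _, h1.add h1', h2.add h2'⟩

lemma IsSubAt.const_mul {u : EE n → ℝ} {z γ} (h : IsSubAt u z γ) {t : ℝ} (ht : 0 ≤ t) :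
    IsSubAt (fun z => t * u z) z (t * γ) := by
  obtain ⟨l, Q, h1, h2⟩ := h
  exact ⟨_, _, h1.const_mul ht, h2.smul ht⟩

lemma IsSubAt.mono {u v : EE n → ℝ} {z γ γ'} (h : IsSubAt u z γ) (h0 : u z = v z)
    (hle : ∀ᶠ y in 𝓝 z, u y ≤ v y) (hγ : γ' ≤ γ) : IsSubAt v z γ' := by
  obtain ⟨l, Q, h1, h2⟩ := h
  exact ⟨_, _, h1.mono h0 hle, h2.mono hγ fun _ => le_rfl⟩

lemma IsSubAt.mono' {u : EE n → ℝ} {z γ γ'} (h : IsSubAt u z γ) (hγ : γ' ≤ γ) : IsSubAt u z γ' :=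
  h.mono rfl (Eventually.of_forall fun _ => le_rfl) hγ

lemma IsSubAt.add_const {u : EE n → ℝ} {z γ} (h : IsSubAt u z γ) (c : ℝ) :
    IsSubAt (fun z => u z + c) z γ := by
  obtain ⟨l, Q, h1, h2⟩ := h
  refine ⟨l, Q, fun ε hε => ?_, h2⟩
  filter_upwards [h1 ε hε] with y hy
  linarith

lemma IsSubAt.max {u v : EE n → ℝ} {z γ} (h : IsSubAt u z γ) (h' : IsSubAt v z γ) :
    IsSubAt (fun z => max (u z) (v z)) z γ := by
  rcases le_total (u z) (v z) with h1 | h1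
  · exact h'.mono (max_eq_right h1).symm (Eventually.of_forall fun _ => le_max_right _ _) le_rfl
  · exact h.mono (max_eq_left h1).symm (Eventually.of_forall fun _ => le_max_left _ _) le_rfl

lemma isSubAt_normsq (hn : 0 < n) {c : ℝ} (hc : 0 ≤ c) (a z : EE n) :
    IsSubAt (fun z => c * ‖z - a‖ ^ 2) z c := by
  have h := (Ex2.normsq a z).ls.const_mul hc
  refine ⟨_, _, h, subM_of_lv hn hc fun w => ?_⟩
  rw [lv_smul, lv_smul, lv_ip]
  apply le_of_eq; ring

lemma IsSubAt.comp_rk1 (hn : 0 < n) {u : EE n → ℝ} {y γ} (h : IsSubAt u y γ) (hγ : 0 ≤ γ)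
    {κ : ℝ} (hκ : 0 < κ) (b N' x : EE n) (hb : κ ^ n ≤ ‖1 + inner ℂ b N'‖) :
    IsSubAt (fun z => u (y + rk1 b N' (z - x))) x (κ ^ 2 * γ) := by
  obtain ⟨l, Q, h1, h2⟩ := h
  exact ⟨_, _, h1.comp _, h2.pull_rk1 hn hγ hκ b N' hb⟩

lemma IsSubAt.translate {u : EE n → ℝ} {x τ γ} (h : IsSubAt u (x + τ) γ) :
    IsSubAt (fun z => u (z + τ)) x γ := by
  obtain ⟨l, Q, h1, h2⟩ := h
  have h3 := h1.comp (x := x) (ContinuousLinearMap.id ℂ (EE n))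
  refine ⟨_, _, h3.mono ?_ (Eventually.of_forall fun z => ?_), h2.mono le_rfl fun w => ?_⟩
  · simp
  · apply le_of_eq; congr 1; simp; abel
  · rw [lv_pullB]; simp

lemma touching {u ψ : EE n → ℝ} {z0 : EE n} {γ : ℝ} (h : IsSubAt u z0 γ) {l'} {Q' : BF n}
    (hψ : Ex2 ψ z0 l' Q') (hmax : ∀ᶠ z in 𝓝 z0, u z - ψ z ≤ u z0 - ψ z0) : SubM Q' γ := by
  obtain ⟨l, Q, h1, h2⟩ := h
  have h3 := h1.add hψ.neg.ls
  have key : ∀ x, Q x x ≤ Q' x x := by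
    intro x
    have : ∀ ε : ℝ, 0 < ε → (Q + -Q') x x ≤ 2 * ε * ‖x‖ ^ 2 := by
      intro ε hε
      have ev := (h3 ε hε).and hmax
      have t1 : Tendsto (fun t : ℝ => z0 + t • x) (𝓝[>] 0) (𝓝 z0) := by
        have : Tendsto (fun t : ℝ => z0 + t • x) (𝓝 0) (𝓝 (z0 + (0:ℝ) • x)) :=
          Continuous.tendsto (by fun_prop) 0
        simpa using this.mono_left nhdsWithin_le_nhds
      have t2 : Tendsto (fun t : ℝ => z0 - t • x) (𝓝[>] 0) (𝓝 z0) := by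
        have : Tendsto (fun t : ℝ => z0 - t • x) (𝓝 0) (𝓝 (z0 - (0:ℝ) • x)) :=
          Continuous.tendsto (by fun_prop) 0
        simpa using this.mono_left nhdsWithin_le_nhds
      obtain ⟨t, ⟨ht1, ht2⟩, ht⟩ := ((t1.eventually ev).and (t2.eventually ev)).and
        self_mem_nhdsWithin |>.exists
      have ht : 0 < t := ht
      have s2 : z0 - t • x - z0 = -(t • x) := by abel
      rw [add_sub_cancel_left] at ht1
      rw [s2] at ht2
      simp only [map_neg, map_smul, neg_neg, norm_neg, norm_smul, smul_apply, smul_eq_mul,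
        neg_apply, Real.norm_of_nonneg ht.le] at ht1 ht2
      have hsum : t ^ 2 * (Q + -Q') x x ≤ t ^ 2 * (2 * ε * ‖x‖ ^ 2) := by
        have a1 := ht1.1; have a2 := ht1.2; have a3 := ht2.1; have a4 := ht2.2
        nlinarith
      exact le_of_mul_le_mul_left hsum (by positivity)
    have h5 : (Q + -Q') x x ≤ 0 := by
      refine le_of_forall_pos_le_add fun ε hε => ?_
      have := this (ε / (2 * (‖x‖ ^ 2 + 1))) (by positivity)
      refine this.trans ?_
      rw [zero_add]
      have e : 2 * (ε / (2 * (‖x‖ ^ 2 + 1))) * ‖x‖ ^ 2 = ε * (‖x‖ ^ 2 / (‖x‖ ^ 2 + 1)) := by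
        field_simp
      rw [e]
      have : ‖x‖ ^ 2 / (‖x‖ ^ 2 + 1) ≤ 1 := by
        rw [div_le_one (by positivity)]; linarith
      nlinarith
    simp at h5; linarith
  refine h2.mono le_rfl fun w => ?_
  unfold lv
  linarith [key w, key (I • w)]

end P2sec

section P3sec
open Filter Topology

variable {n : ℕ}

def SS (Ω : Set (EE n)) (g : EE n → ℝ) : Set (EE n → ℝ) :=
  {u | ContinuousOn u (closure Ω) ∧ (∀ z ∈ Ω, IsSubAt u z (g z)) ∧ ∀ z ∈ frontier Ω, u z ≤ 0}

def PV (Ω : Set (EE n)) (g : EE n → ℝ) (z : EE n) : ℝ := sSup ((fun u => u z) '' SS Ω g)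

/-- standing assumptions -/
structure Perr (Ω : Set (EE n)) (g : EE n → ℝ) : Prop where
  hn : 0 < n
  op : IsOpen Ω
  bd : Bornology.IsBounded Ω
  g0 : ∀ z ∈ Ω, 0 ≤ g z
  ne : (SS Ω g).Nonempty

lemma exists_ne_ee (hn : 0 < n) : ∃ w : EE n, ‖w‖ = 1 :=
  ⟨EuclideanSpace.single ⟨0, hn⟩ 1, by simp⟩

lemma isCompact_closure_of_bd {Ω : Set (EE n)} (h : Bornology.IsBounded Ω) :
    IsCompact (closure Ω) := h.isCompact_closure

/-- interior maximum exists when frontier values are smaller -/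
lemma exists_int_max {D : Set (EE n)} (hD : IsOpen D) (hb : Bornology.IsBounded D) {φ : EE n → ℝ}
    (hφ : ContinuousOn φ (closure D)) {z0 : EE n} (hz0 : z0 ∈ D)
    (hf : ∀ z ∈ frontier D, φ z < φ z0) :
    ∃ z1 ∈ D, ∀ᶠ z in 𝓝 z1, φ z ≤ φ z1 := by
  obtain ⟨z1, hz1, hm⟩ := (isCompact_closure_of_bd hb).exists_isMaxOn ⟨z0, subset_closure hz0⟩ hφ
  have h1 : z1 ∈ D := by
    by_contra h
    have : z1 ∈ frontier D := by rw [hD.frontier_eq]; exact ⟨hz1, h⟩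
    have h2 := hf z1 this
    have h3 : φ z0 ≤ φ z1 := hm (subset_closure hz0)
    linarith
  refine ⟨z1, h1, ?_⟩
  filter_upwards [hD.mem_nhds h1] with z hz
  exact hm (subset_closure hz)

lemma max_principle (hn : 0 < n) {D : Set (EE n)} (hD : IsOpen D) (hb : Bornology.IsBounded D)
    {u : EE n → ℝ} (hu : ContinuousOn u (closure D)) (hs : ∀ z ∈ D, IsSubAt u z 0)
    (hf : ∀ z ∈ frontier D, u z ≤ 0) : ∀ z ∈ closure D, u z ≤ 0 := by
  obtain ⟨R, hR0, hR⟩ := hb.subset_ball_lt 0 0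
  intro z hz
  by_cases hzD : z ∈ D
  swap
  · exact hf z (by rw [hD.frontier_eq]; exact ⟨hz, hzD⟩)
  by_contra hpos
  push Not at hpos
  set ε := u z / (2 * R ^ 2) with hε
  have hε0 : 0 < ε := by positivity
  have hcl : ∀ y ∈ closure D, ‖y‖ ^ 2 ≤ R ^ 2 := by
    intro y hy
    have : y ∈ closedBall (0 : EE n) R := closure_minimal (hR.trans ball_subset_closedBall)
      isClosed_closedBall hy
    rw [mem_closedBall_zero_iff] at this
    exact pow_le_pow_left₀ (norm_nonneg _) this 2
  obtain ⟨z1, hz1, hm⟩ := exists_int_max hD hb (φ := fun y => u y - (-ε) * ‖y - 0‖ ^ 2)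
    (hu.sub (by fun_prop)) hzD (by
      intro y hy
      have h1 := hf y hy
      have h2 := hcl y (frontier_subset_closure hy)
      simp only [sub_zero]
      have h3 : ε * ‖y‖ ^ 2 ≤ u z / 2 := by
        calc ε * ‖y‖ ^ 2 ≤ ε * R ^ 2 := by gcongr
          _ = u z / 2 := by rw [hε]; field_simp
      have h4 : 0 ≤ ε * ‖z‖ ^ 2 := by positivity
      linarith)
  have h5 := touching (hs z1 hz1) ((Ex2.normsq 0 z1).const_mul (-ε)) hm
  obtain ⟨w, hw⟩ := exists_ne_ee hn
  have h6 := h5.lv_nonneg hn le_rfl w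
  rw [lv_smul, lv_smul, lv_ip, hw] at h6
  norm_num at h6
  linarith

variable {Ω : Set (EE n)} {g : EE n → ℝ}

lemma Perr.nonpos (P : Perr Ω g) {u : EE n → ℝ} (hu : u ∈ SS Ω g) :
    ∀ z ∈ closure Ω, u z ≤ 0 :=
  max_principle P.hn P.op P.bd hu.1 (fun z hz => (hu.2.1 z hz).mono' (P.g0 z hz)) hu.2.2

lemma Perr.bddAbove (P : Perr Ω g) {z : EE n} (hz : z ∈ closure Ω) :
    BddAbove ((fun u => u z) '' SS Ω g) :=
  ⟨0, by rintro _ ⟨u, hu, rfl⟩; exact P.nonpos hu z hz⟩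

lemma Perr.le (P : Perr Ω g) {u : EE n → ℝ} (hu : u ∈ SS Ω g) {z : EE n} (hz : z ∈ closure Ω) :
    u z ≤ PV Ω g z := le_csSup (P.bddAbove hz) ⟨u, hu, rfl⟩

lemma Perr.le_of (P : Perr Ω g) {z : EE n} {c : ℝ}
    (h : ∀ u ∈ SS Ω g, u z ≤ c) : PV Ω g z ≤ c :=
  csSup_le (P.ne.image _) (by rintro _ ⟨u, hu, rfl⟩; exact h u hu)

lemma Perr.pv_nonpos (P : Perr Ω g) {z : EE n} (hz : z ∈ closure Ω) : PV Ω g z ≤ 0 :=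
  P.le_of fun _ hu => P.nonpos hu z hz

lemma Perr.exists_lt (P : Perr Ω g) {z : EE n} {c : ℝ} (h : c < PV Ω g z) :
    ∃ u ∈ SS Ω g, c < u z := by
  obtain ⟨_, ⟨u, hu, rfl⟩, h2⟩ := exists_lt_of_lt_csSup (P.ne.image _) h
  exact ⟨u, hu, h2⟩

lemma SS.sup {u v : EE n → ℝ} (hu : u ∈ SS Ω g) (hv : v ∈ SS Ω g) :
    (fun z => max (u z) (v z)) ∈ SS Ω g :=
  ⟨hu.1.sup hv.1, fun z hz => (hu.2.1 z hz).max (hv.2.1 z hz),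
    fun z hz => max_le (hu.2.2 z hz) (hv.2.2 z hz)⟩

open Classical in
lemma SS.glue (hΩ : IsOpen Ω) {u w : EE n → ℝ} (hu : u ∈ SS Ω g) {D : Set (EE n)} (hD : IsOpen D)
    (hDΩ : D ⊆ Ω) (hw : ContinuousOn w (closure D)) (hs : ∀ z ∈ D, IsSubAt w z (g z))
    (hf : ∀ z ∈ frontier D, w z ≤ u z) :
    D.piecewise (fun z => max (u z) (w z)) u ∈ SS Ω g := by
  refine ⟨?_, ?_, ?_⟩
  · refine ContinuousOn.piecewise (fun a ha => max_eq_left (hf a ha.2)) ?_ ?_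
    · exact (hu.1.mono Set.inter_subset_left).sup (hw.mono Set.inter_subset_right)
    · exact hu.1.mono Set.inter_subset_left
  · intro z hz
    by_cases h : z ∈ D
    · refine ((hu.2.1 z hz).max (hs z h)).mono ?_ ?_ le_rfl
      · rw [Set.piecewise_eq_of_mem _ _ _ h]
      · filter_upwards [hD.mem_nhds h] with y hy
        rw [Set.piecewise_eq_of_mem _ _ _ hy]
    · refine (hu.2.1 z hz).mono ?_ ?_ le_rfl
      · rw [Set.piecewise_eq_of_notMem _ _ _ h]
      · refine Eventually.of_forall fun y => ?_
        by_cases hy : y ∈ D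
        · rw [Set.piecewise_eq_of_mem _ _ _ hy]; exact le_max_left _ _
        · rw [Set.piecewise_eq_of_notMem _ _ _ hy]
  · intro z hz
    rw [hΩ.frontier_eq] at hz
    rw [Set.piecewise_eq_of_notMem _ _ _ fun h => hz.2 (hDΩ h)]
    exact hu.2.2 z (by rw [hΩ.frontier_eq]; exact hz)

lemma Perr.glue_le (P : Perr Ω g) {u w : EE n → ℝ} (hu : u ∈ SS Ω g) {D : Set (EE n)} (hD : IsOpen D)
    (hDΩ : D ⊆ Ω) (hw : ContinuousOn w (closure D)) (hs : ∀ z ∈ D, IsSubAt w z (g z))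
    (hf : ∀ z ∈ frontier D, w z ≤ u z) : ∀ z ∈ D, w z ≤ PV Ω g z := by
  classical
  intro z hz
  have := P.le (SS.glue P.op hu hD hDΩ hw hs hf) (subset_closure (hDΩ hz))
  rw [Set.piecewise_eq_of_mem _ _ _ hz] at this
  exact (le_max_right _ _).trans this

lemma Perr.approx (P : Perr Ω g) (hv : ContinuousOn (PV Ω g) (closure Ω)) {ε : ℝ} (hε : 0 < ε) :
    ∃ u ∈ SS Ω g, ∀ z ∈ closure Ω, PV Ω g z - ε < u z := by
  refine (isCompact_closure_of_bd P.bd).induction_on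
    (p := fun s => ∃ u ∈ SS Ω g, ∀ z ∈ s ∩ closure Ω, PV Ω g z - ε < u z) ?_ ?_ ?_ ?_ |>.imp
      fun u h => ⟨h.1, fun z hz => h.2 z ⟨hz, hz⟩⟩
  · obtain ⟨u, hu⟩ := P.ne
    exact ⟨u, hu, by simp⟩
  · rintro s t hst ⟨u, hu, h⟩
    exact ⟨u, hu, fun z hz => h z ⟨hst hz.1, hz.2⟩⟩
  · rintro s t ⟨u, hu, h⟩ ⟨u', hu', h'⟩
    refine ⟨_, SS.sup hu hu', ?_⟩
    rintro z ⟨hz | hz, hz2⟩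
    · exact (h z ⟨hz, hz2⟩).trans_le (le_max_left _ _)
    · exact (h' z ⟨hz, hz2⟩).trans_le (le_max_right _ _)
  · intro x hx
    obtain ⟨u, hu, h⟩ := P.exists_lt (show PV Ω g x - ε < PV Ω g x by linarith)
    have hc : ContinuousWithinAt (fun z => u z - PV Ω g z) (closure Ω) x := (hu.1 x hx).sub (hv x hx)
    have := hc.eventually (lt_mem_nhds (show -ε < u x - PV Ω g x by linarith))
    refine ⟨_, Filter.inter_mem this self_mem_nhdsWithin, u, hu, ?_⟩
    rintro z ⟨⟨hz, -⟩, -⟩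
    have : -ε < u z - PV Ω g z := hz
    linarith

lemma Perr.comparison (P : Perr Ω g) (hv : ContinuousOn (PV Ω g) (closure Ω)) {w : EE n → ℝ}
    {D : Set (EE n)} (hD : IsOpen D)
    (hDΩ : D ⊆ Ω) (hw : ContinuousOn w (closure D)) (hs : ∀ z ∈ D, IsSubAt w z (g z))
    (hf : ∀ z ∈ frontier D, w z ≤ PV Ω g z) : ∀ z ∈ D, w z ≤ PV Ω g z := by
  intro z hz
  refine le_of_forall_pos_le_add fun ε hε => ?_
  obtain ⟨u, hu, h⟩ := P.approx hv hε
  have := P.glue_le hu hD hDΩ (w := fun z => w z + (-ε)) (hw.add continuousOn_const)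
    (fun z hz => (hs z hz).add_const _) (fun z hz => by
      have h1 := hf z hz
      have h2 := h z (closure_mono hDΩ (frontier_subset_closure hz))
      linarith) z hz
  linarith

lemma Perr.touch_v (P : Perr Ω g) (hv : ContinuousOn (PV Ω g) (closure Ω)) {ψ : EE n → ℝ}
    {D : Set (EE n)} (hD : IsOpen D)
    (hDΩ : D ⊆ Ω) (hψ : ContinuousOn ψ (closure D)) {z0 : EE n} (hz0 : z0 ∈ D) {m : ℝ}
    (hm : m < PV Ω g z0 - ψ z0)
    (hf : ∀ z ∈ frontier D, PV Ω g z - ψ z ≤ m) :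
    ∃ z1 ∈ D, ∀ l Q, Ex2 ψ z1 l Q → SubM Q (g z1) := by
  obtain ⟨u, hu, h⟩ := P.approx hv (show 0 < PV Ω g z0 - ψ z0 - m by linarith)
  obtain ⟨z1, hz1, hmax⟩ := exists_int_max hD (P.bd.subset hDΩ) (φ := fun z => u z - ψ z)
    ((hu.1.mono (closure_mono hDΩ)).sub hψ) hz0 (fun z hz => by
      have h1 := hf z hz
      have h2 := P.le hu (closure_mono hDΩ (frontier_subset_closure hz))
      have h3 := h z0 (subset_closure (hDΩ hz0))
      linarith)
  exact ⟨z1, hz1, fun l Q hE => touching (hu.2.1 z1 (hDΩ hz1)) hE hmax⟩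

lemma IsSubAt.mv (hn : 0 < n) {u : EE n → ℝ} {z : EE n} {γ : ℝ} (h : IsSubAt u z γ) (hγ : 0 ≤ γ)
    (τ : EE n) {ε : ℝ} (hε : 0 < ε) : ∀ᶠ t : ℝ in 𝓝 0, 4 * u z - ε * t ^ 2 ≤
      u (z + t • τ) + u (z - t • τ) + u (z + t • (I • τ)) + u (z - t • (I • τ)) := by
  obtain ⟨l, Q, h1, h2⟩ := h
  have h3 := h2.lv_nonneg hn hγ τ
  set e := ε / (4 * (‖τ‖ ^ 2 + 1)) with he
  have ev := h1 e (by positivity)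
  have tt : ∀ x : EE n, Tendsto (fun t : ℝ => z + t • x) (𝓝 0) (𝓝 z) := by
    intro x
    have : Tendsto (fun t : ℝ => z + t • x) (𝓝 0) (𝓝 (z + (0:ℝ) • x)) :=
      Continuous.tendsto (by fun_prop) 0
    simpa using this
  have t2 : ∀ x : EE n, Tendsto (fun t : ℝ => z - t • x) (𝓝 0) (𝓝 z) := by
    intro x
    have : Tendsto (fun t : ℝ => z - t • x) (𝓝 0) (𝓝 (z - (0:ℝ) • x)) :=
      Continuous.tendsto (by fun_prop) 0
    simpa using this
  filter_upwards [(tt τ).eventually ev, (t2 τ).eventually ev, (tt (I • τ)).eventually ev,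
    (t2 (I • τ)).eventually ev] with t a1 a2 a3 a4
  have s1 : ∀ x : EE n, z - t • x - z = -(t • x) := fun x => by abel
  have nI : ‖I • τ‖ = ‖τ‖ := by rw [norm_smul]; simp
  simp only [s1, add_sub_cancel_left, map_neg, map_smul, norm_neg, norm_smul, smul_apply,
    smul_eq_mul, neg_apply, nI, Real.norm_eq_abs, mul_pow, sq_abs] at a1 a2 a3 a4
  have hl : 0 ≤ t ^ 2 * (Q τ τ + Q (I • τ) (I • τ)) := by
    unfold lv at h3
    have : 0 ≤ Q τ τ + Q (I • τ) (I • τ) := by linarith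
    positivity
  have h5 : 4 * (e * (t ^ 2 * ‖τ‖ ^ 2)) ≤ ε * t ^ 2 := by
    have : 4 * e * (‖τ‖ ^ 2 + 1) = ε := by rw [he]; field_simp
    have h0 : 0 ≤ e * t ^ 2 := by positivity
    nlinarith
  nlinarith

end P3sec

section P4sec
open Filter Topology

variable {n : ℕ}

lemma fderiv_ofReal_comp {u : EE n → ℝ} {z : EE n} (h : DifferentiableAt ℝ u z) (x : EE n) :
    fderiv ℝ (fun v => ((u v : ℝ) : ℂ)) z x = ((fderiv ℝ u z x : ℝ) : ℂ) := by
  have h1 : HasFDerivAt (fun v => ((u v : ℝ) : ℂ)) (Complex.ofRealCLM.comp (fderiv ℝ u z)) z :=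
    Complex.ofRealCLM.hasFDerivAt.comp z h.hasFDerivAt
  rw [h1.fderiv]; rfl

lemma cHess_eq {u : EE n → ℝ} {z : EE n} (h : ∀ᶠ y in 𝓝 z, DifferentiableAt ℝ u y)
    (h2 : DifferentiableAt ℝ (fderiv ℝ u) z) :
    cHess n u z = (hm (fderiv ℝ (fderiv ℝ u) z)).transpose := by
  ext i j
  set B : BF n := fderiv ℝ (fderiv ℝ u) z with hB
  have hBd : HasFDerivAt (fderiv ℝ u) B z := h2.hasFDerivAt
  have key : HasFDerivAt (fun w => wDzBar n j (fun v => ((u v : ℝ) : ℂ)) w)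
      ((1/2 : ℂ) • (Complex.ofRealCLM.comp (B.flip (EuclideanSpace.single j 1)))
        + (1/2 * I : ℂ) • (Complex.ofRealCLM.comp (B.flip (EuclideanSpace.single j I)))) z := by
    have a : ∀ x : EE n, HasFDerivAt (fun w => fderiv ℝ u w x) (B.flip x) z := fun x => by
      have := hBd.clm_apply (hasFDerivAt_const x z)
      refine this.congr_fderiv ?_
      ext y; simp
    have b : ∀ x : EE n, HasFDerivAt (fun w => ((fderiv ℝ u w x : ℝ) : ℂ))
        (Complex.ofRealCLM.comp (B.flip x)) z := fun x =>
      Complex.ofRealCLM.hasFDerivAt.comp z (a x)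
    have c := ((b (EuclideanSpace.single j 1)).const_smul (1/2 : ℂ)).add
      ((b (EuclideanSpace.single j I)).const_smul (1/2 * I : ℂ))
    refine c.congr_of_eventuallyEq ?_
    filter_upwards [h] with w hw
    simp only [wDzBar, fderiv_ofReal_comp hw, Pi.add_apply, Pi.smul_apply, smul_eq_mul]
    ring
  simp only [cHess, Matrix.of_apply, Matrix.transpose_apply]
  rw [wDz, key.fderiv]
  simp [hm]
  ring_nf
  simp
  ring

lemma cHessForm_re {u : EE n → ℝ} {z : EE n} (h : ∀ᶠ y in 𝓝 z, DifferentiableAt ℝ u y)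
    (h2 : DifferentiableAt ℝ (fderiv ℝ u) z) (w : EE n) :
    (cHessForm n u z w.ofLp).re = lv (fderiv ℝ (fderiv ℝ u) z) w := by
  rw [← hm_form, cHessForm, cHess_eq h h2, Finset.sum_comm]
  congr 1
  refine Finset.sum_congr rfl fun i _ => Finset.sum_congr rfl fun j _ => ?_
  simp; ring

lemma cGradPair_eq {u : EE n → ℝ} {z : EE n} (h : DifferentiableAt ℝ u z) (w : EE n) :
    cGradPair n u z w.ofLp = inner ℂ (gradV (fderiv ℝ u z)) w / 2 := by
  simp only [cGradPair, wDz, fderiv_ofReal_comp h, PiLp.inner_apply, Finset.sum_div]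
  refine Finset.sum_congr rfl fun i _ => ?_
  simp [gradV]; ring

/-- Uniform geometry near the boundary -/
structure Geo (Ω : Set (EE n)) (r : EE n → ℝ) (dr : EE n → EE n →L[ℝ] ℝ) (ddr : EE n → BF n)
    (δ c C : ℝ) : Prop where
  hn : 0 < n
  op : IsOpen Ω
  bd : Bornology.IsBounded Ω
  hδ : 0 < δ
  hδ1 : δ ≤ 1
  hc : 0 < c
  hc1 : c ≤ 1
  hC : 1 ≤ C
  d1 : ∀ p ∈ frontier Ω, ∀ z ∈ ball p δ, HasFDerivAt r (dr z) z
  d2 : ∀ p ∈ frontier Ω, ∀ z ∈ ball p δ, HasFDerivAt dr (ddr z) z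
  levi : ∀ p ∈ frontier Ω, ∀ z ∈ ball p δ, ∀ w, c * ‖w‖ ^ 2 ≤ lv (ddr z) w
  drc : ∀ p ∈ frontier Ω, ∀ z ∈ ball p δ, c ≤ ‖dr z‖
  drC : ∀ p ∈ frontier Ω, ∀ z ∈ ball p δ, ‖dr z‖ ≤ C
  ddrC : ∀ p ∈ frontier Ω, ∀ z ∈ ball p δ, ‖ddr z‖ ≤ C
  ddrL : ∀ p ∈ frontier Ω, ∀ z ∈ ball p δ, ∀ y ∈ ball p δ, ‖ddr z - ddr y‖ ≤ C * ‖z - y‖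
  mem : ∀ p ∈ frontier Ω, ∀ z ∈ ball p δ, (z ∈ Ω ↔ r z < 0)
  zero : ∀ p ∈ frontier Ω, r p = 0

lemma levi_compact {K : Set (EE n)} (hK : IsCompact K) {d : EE n → EE n →L[ℝ] ℝ} {B : EE n → BF n}
    (hd : ContinuousOn d K) (hB : ContinuousOn B K)
    (h : ∀ z ∈ K, ∀ w : EE n, w ≠ 0 → d z w = 0 → d z (I • w) = 0 → 0 < lv (B z) w) :
    ∃ lam : ℝ, 0 ≤ lam ∧ ∃ c : ℝ, 0 < c ∧ ∀ z ∈ K, ∀ w : EE n,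
      c * ‖w‖ ^ 2 ≤ lv (B z) w + lam * (d z w ^ 2 + d z (I • w) ^ 2) := by
  set S := K ×ˢ sphere (0 : EE n) 1 with hS
  have hSc : IsCompact S := hK.prod (isCompact_sphere 0 1)
  have hd' : ContinuousOn (fun p : EE n × EE n => d p.1) S :=
    hd.comp continuousOn_fst fun p hp => hp.1
  have hB' : ContinuousOn (fun p : EE n × EE n => B p.1) S :=
    hB.comp continuousOn_fst fun p hp => hp.1
  have ha : ContinuousOn (fun p : EE n × EE n => lv (B p.1) p.2) S := by
    unfold lv
    refine ContinuousOn.div_const (ContinuousOn.add ?_ ?_) _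
    · exact (hB'.clm_apply continuousOn_snd).clm_apply continuousOn_snd
    · have : ContinuousOn (fun p : EE n × EE n => I • p.2) S := by fun_prop
      exact (hB'.clm_apply this).clm_apply this
  have hb : ContinuousOn (fun p : EE n × EE n => d p.1 p.2 ^ 2 + d p.1 (I • p.2) ^ 2) S := by
    have : ContinuousOn (fun p : EE n × EE n => I • p.2) S := by fun_prop
    exact ((hd'.clm_apply continuousOn_snd).pow 2).add ((hd'.clm_apply this).pow 2)
  -- find lam with positivity on S
  have h1 : ∃ lam : ℝ, 0 ≤ lam ∧ ∀ p ∈ S,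
      0 < lv (B p.1) p.2 + lam * (d p.1 p.2 ^ 2 + d p.1 (I • p.2) ^ 2) := by
    set T := S ∩ {p | lv (B p.1) p.2 ≤ 0} with hT
    have hTc : IsCompact T := by
      have : T = S ∩ (fun p : EE n × EE n => lv (B p.1) p.2) ⁻¹' Set.Iic 0 := rfl
      rw [this]
      exact hSc.of_isClosed_subset (ha.preimage_isClosed_of_isClosed hSc.isClosed isClosed_Iic)
        Set.inter_subset_left
    rcases T.eq_empty_or_nonempty with hE | hne
    · refine ⟨0, le_rfl, fun p hp => ?_⟩
      by_contra hcon
      have : p ∈ T := ⟨hp, by simpa using hcon⟩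
      rw [hE] at this; exact this
    · obtain ⟨p0, hp0, hmin⟩ := hTc.exists_isMinOn hne (hb.mono Set.inter_subset_left)
      obtain ⟨A, hA⟩ := hSc.exists_bound_of_continuousOn ha
      set m := d p0.1 p0.2 ^ 2 + d p0.1 (I • p0.2) ^ 2 with hm
      have hm0 : 0 < m := by
        by_contra hcon
        have e1 : d p0.1 p0.2 = 0 := by nlinarith [sq_nonneg (d p0.1 p0.2), sq_nonneg (d p0.1 (I • p0.2))]
        have e2 : d p0.1 (I • p0.2) = 0 := by nlinarith [sq_nonneg (d p0.1 p0.2), sq_nonneg (d p0.1 (I • p0.2))]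
        have := h p0.1 hp0.1.1 p0.2 (ne_zero_of_mem_unit_sphere ⟨p0.2, hp0.1.2⟩) e1 e2
        have h3 : lv (B p0.1) p0.2 ≤ 0 := hp0.2
        linarith
      have hA0 : 0 ≤ A := (norm_nonneg _).trans (hA p0 hp0.1)
      refine ⟨(A + 1) / m, by positivity, fun p hp => ?_⟩
      by_cases hpT : lv (B p.1) p.2 ≤ 0
      · have h4 : m ≤ d p.1 p.2 ^ 2 + d p.1 (I • p.2) ^ 2 := hmin ⟨hp, hpT⟩
        have h5 := (abs_le.1 (hA p hp)).1
        have h6 : A + 1 ≤ (A + 1) / m * (d p.1 p.2 ^ 2 + d p.1 (I • p.2) ^ 2) := by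
          rw [div_mul_eq_mul_div, le_div_iff₀ hm0]
          gcongr
        linarith
      · push Not at hpT
        have : 0 ≤ (A + 1) / m * (d p.1 p.2 ^ 2 + d p.1 (I • p.2) ^ 2) := by positivity
        linarith
  obtain ⟨lam, hl0, hl⟩ := h1
  refine ⟨lam, hl0, ?_⟩
  have hcont : ContinuousOn (fun p : EE n × EE n => lv (B p.1) p.2
      + lam * (d p.1 p.2 ^ 2 + d p.1 (I • p.2) ^ 2)) S := ha.add (continuousOn_const.mul hb)
  have hc : ∃ c : ℝ, 0 < c ∧ ∀ p ∈ S, c ≤ lv (B p.1) p.2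
      + lam * (d p.1 p.2 ^ 2 + d p.1 (I • p.2) ^ 2) := by
    rcases S.eq_empty_or_nonempty with hE | hne
    · exact ⟨1, one_pos, by simp [hE]⟩
    · obtain ⟨p0, hp0, hmin⟩ := hSc.exists_isMinOn hne hcont
      exact ⟨_, hl p0 hp0, fun p hp => hmin hp⟩
  obtain ⟨c, hc0, hc⟩ := hc
  refine ⟨c, hc0, fun z hz w => ?_⟩
  rcases eq_or_ne w 0 with rfl | hw
  · simp [lv]
  have hw' : 0 < ‖w‖ := norm_pos_iff.2 hw
  have := hc (z, (‖w‖⁻¹ : ℝ) • w) ⟨hz, by simp [norm_smul, hw'.ne']⟩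
  simp only [lv_smul_right, smul_comm I, map_smul, smul_eq_mul] at this
  have h8 := mul_le_mul_of_nonneg_left this (sq_nonneg ‖w‖)
  have e : ‖w‖ ^ 2 * (‖w‖⁻¹ ^ 2 * lv (B z) w + lam * ((‖w‖⁻¹ * d z w) ^ 2 + (‖w‖⁻¹ * d z (I • w)) ^ 2))
    = lv (B z) w + lam * (d z w ^ 2 + d z (I • w) ^ 2) := by
    field_simp
  rw [e] at h8
  linarith

end P4sec

section P4bsec
set_option synthInstance.maxHeartbeats 200000
set_option maxSynthPendingDepth 3
open Filter Topology

variable {n : ℕ}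

lemma c3_facts {U : Set (EE n)} (hU : IsOpen U) {r : EE n → ℝ} (hr : ContDiffOn ℝ 3 r U) :
    (∀ z ∈ U, HasFDerivAt r (fderiv ℝ r z) z) ∧
    (∀ z ∈ U, HasFDerivAt (fderiv ℝ r) (fderiv ℝ (fderiv ℝ r) z) z) ∧
    (∀ z ∈ U, HasFDerivAt (fderiv ℝ (fderiv ℝ r)) (fderiv ℝ (fderiv ℝ (fderiv ℝ r)) z) z) ∧
    ContinuousOn (fderiv ℝ r) U ∧ ContinuousOn (fderiv ℝ (fderiv ℝ r)) U ∧
    ContinuousOn (fderiv ℝ (fderiv ℝ (fderiv ℝ r))) U := by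
  have h2 : ContDiffOn ℝ 2 (fderiv ℝ r) U := hr.fderiv_of_isOpen hU (by norm_num)
  have h1 : ContDiffOn ℝ 1 (fderiv ℝ (fderiv ℝ r)) U := h2.fderiv_of_isOpen hU (by norm_num)
  have h0 : ContDiffOn ℝ 0 (fderiv ℝ (fderiv ℝ (fderiv ℝ r))) U :=
    h1.fderiv_of_isOpen hU (by norm_num)
  refine ⟨fun z hz => ?_, fun z hz => ?_, fun z hz => ?_, h2.continuousOn, h1.continuousOn,
    h0.continuousOn⟩
  · exact ((hr.differentiableOn (by norm_num)).differentiableAt (hU.mem_nhds hz)).hasFDerivAt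
  · exact ((h2.differentiableOn (by norm_num)).differentiableAt (hU.mem_nhds hz)).hasFDerivAt
  · exact ((h1.differentiableOn (by norm_num)).differentiableAt (hU.mem_nhds hz)).hasFDerivAt

lemma exists_geo (hn : 0 < n) {Ω : Set (EE n)} (hΩ : IsStrictlyPseudoconvexDomain n 3 Ω) :
    ∃ r dr ddr δ c C, Geo Ω r dr ddr δ c C := by
  obtain ⟨op, bd, U, ρ, ⟨hU, hcl, hρ, hΩeq, hdne⟩, hpsc⟩ := hΩ
  have hρ : ContDiffOn ℝ 3 ρ U := hρ
  set K := frontier Ω with hKdef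
  have hKc : IsCompact K := bd.isCompact_closure.of_isClosed_subset isClosed_frontier
    frontier_subset_closure
  have hKU : K ⊆ U := frontier_subset_closure.trans hcl
  obtain ⟨p1, p2, p3, q1, q2, q3⟩ := c3_facts hU hρ
  have hρ0 : ∀ p ∈ K, ρ p = 0 := by
    intro p hp
    have hpΩ : p ∉ Ω := by rw [hKdef, op.frontier_eq] at hp; exact hp.2
    apply le_antisymm
    · have hc : ContinuousWithinAt ρ Ω p := (p1 p (hKU hp)).continuousAt.continuousWithinAt
      have : (𝓝[Ω] p).NeBot := mem_closure_iff_nhdsWithin_neBot.1 (frontier_subset_closure hp)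
      refine le_of_tendsto hc (eventually_nhdsWithin_of_forall fun z hz => ?_)
      rw [hΩeq] at hz; exact hz.2.le
    · by_contra hcon
      push Not at hcon
      exact hpΩ (by rw [hΩeq]; exact ⟨hKU hp, hcon⟩)
  obtain ⟨lam, hlam, c1, hc1, hlev⟩ := levi_compact hKc (q1.mono hKU) (q2.mono hKU) (by
    intro z hz w hw h1 h2
    have hd : ∀ᶠ y in 𝓝 z, DifferentiableAt ℝ ρ y := by
      filter_upwards [hU.mem_nhds (hKU hz)] with y hy
      exact (p1 y hy).differentiableAt
    have := hpsc z hz w.ofLp (by simpa using hw) (by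
      rw [cGradPair_eq hd.self_of_nhds, gradV_inner, h1, h2]; simp)
    rwa [cHessForm_re hd (p2 z (hKU hz)).differentiableAt] at this)
  set L := 2 * lam with hL
  set r : EE n → ℝ := fun z => ρ z + L * ρ z ^ 2 with hr
  have hrC : ContDiffOn ℝ 3 r U := hρ.add (contDiffOn_const.mul (hρ.pow 2))
  obtain ⟨s1, s2, s3, t1, t2, t3⟩ := c3_facts hU hrC
  have hdr : ∀ z ∈ U, fderiv ℝ r z = (1 + 2 * L * ρ z) • fderiv ℝ ρ z := by
    intro z hz
    have a := (p1 z hz).add (((p1 z hz).pow 2).const_mul L)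
    refine HasFDerivAt.fderiv (a.congr_fderiv ?_)
    ext x; simp; try ring
  have hddr : ∀ p ∈ K, fderiv ℝ (fderiv ℝ r) p
      = fderiv ℝ (fderiv ℝ ρ) p + (2 * L) • sqf (fderiv ℝ ρ p) := by
    intro p hp
    have hz := hKU hp
    have a : HasFDerivAt (fun z => 1 + 2 * L * ρ z) ((2 * L) • fderiv ℝ ρ p) p := by
      have := ((p1 p hz).const_mul (2 * L)).const_add 1
      exact this
    have b := a.smul (p2 p hz)
    have e : (fun z => (1 + 2 * L * ρ z) • fderiv ℝ ρ z) =ᶠ[𝓝 p] fderiv ℝ r := by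
      filter_upwards [hU.mem_nhds hz] with z hz
      exact (hdr z hz).symm
    refine HasFDerivAt.fderiv ((b.congr_of_eventuallyEq e.symm).congr_fderiv ?_)
    ext x y
    simp [hρ0 p hp, sqf_apply]; ring
  -- uniform lower bounds on K
  have hc2 : ∃ c2 : ℝ, 0 < c2 ∧ ∀ p ∈ K, c2 ≤ ‖fderiv ℝ r p‖ := by
    rcases K.eq_empty_or_nonempty with hE | hne
    · exact ⟨1, one_pos, by simp [hE]⟩
    · obtain ⟨p0, hp0, hmin⟩ := hKc.exists_isMinOn hne (t1.mono hKU).norm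
      refine ⟨_, ?_, fun p hp => hmin hp⟩
      rw [norm_pos_iff, hdr p0 (hKU hp0), hρ0 p0 hp0]
      simpa using hdne p0 hp0
  obtain ⟨c2, hc2, hdrK⟩ := hc2
  have hlevK : ∀ p ∈ K, ∀ w, c1 * ‖w‖ ^ 2 ≤ lv (fderiv ℝ (fderiv ℝ r) p) w := by
    intro p hp w
    refine (hlev p hp w).trans (le_of_eq ?_)
    rw [hddr p hp, lv_add, lv_smul, lv_sqf, hL]; ring
  have hU'o : IsOpen (U ∩ (fun z => 1 + L * ρ z) ⁻¹' Set.Ioi 0) :=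
    ContinuousOn.isOpen_inter_preimage (continuousOn_const.add (continuousOn_const.mul hρ.continuousOn))
      hU isOpen_Ioi
  obtain ⟨δ1, hδ1, hth⟩ := hKc.exists_cthickening_subset_open hU'o (fun p hp => ⟨hKU hp, by
    simp [hρ0 p hp]⟩)
  have hcthc : IsCompact (cthickening δ1 K) := hKc.cthickening
  have hthU : cthickening δ1 K ⊆ U := hth.trans Set.inter_subset_left
  obtain ⟨C1, hC1⟩ := hcthc.exists_bound_of_continuousOn (t1.mono hthU)
  obtain ⟨C2, hC2⟩ := hcthc.exists_bound_of_continuousOn (t2.mono hthU)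
  obtain ⟨C3, hC3⟩ := hcthc.exists_bound_of_continuousOn (t3.mono hthU)
  set C := max (max (max C1 C2) C3) 1 with hC
  have hCC1 : C1 ≤ C := by simp [hC]
  have hCC2 : C2 ≤ C := by simp [hC]
  have hCC3 : C3 ≤ C := by simp [hC]
  have hCone : 1 ≤ C := le_max_right _ _
  set c := min (min (c1 / 2) (c2 / 2)) 1 with hc
  have hc0 : 0 < c := by positivity
  have hcc1 : c ≤ c1 / 2 := (min_le_left _ _).trans (min_le_left _ _)
  have hcc2 : c ≤ c2 / 2 := (min_le_left _ _).trans (min_le_right _ _)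
  set δ := min (min δ1 1) (c / C) with hδ
  have hδ0 : 0 < δ := by positivity
  have hδδ1 : δ ≤ δ1 := (min_le_left _ _).trans (min_le_left _ _)
  have hCδ : C * δ ≤ c := by
    have : δ ≤ c / C := min_le_right _ _
    rw [le_div_iff₀ (by linarith)] at this; linarith
  have hb : ∀ p ∈ K, ball p δ ⊆ cthickening δ1 K := fun p hp z hz =>
    mem_cthickening_of_dist_le z p δ1 K hp ((mem_ball.1 hz).le.trans hδδ1)
  have hddrL : ∀ p ∈ K, ∀ z ∈ ball p δ, ∀ y ∈ ball p δ,
      ‖fderiv ℝ (fderiv ℝ r) z - fderiv ℝ (fderiv ℝ r) y‖ ≤ C * ‖z - y‖ := by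
    intro p hp z hz y hy
    exact (convex_ball p δ).norm_image_sub_le_of_norm_hasFDerivWithin_le
      (fun x hx => (s3 x (hthU (hb p hp hx))).hasFDerivWithinAt)
      (fun x hx => (hC3 x (hb p hp hx)).trans hCC3) hy hz
  have hdrL : ∀ p ∈ K, ∀ z ∈ ball p δ, ∀ y ∈ ball p δ,
      ‖fderiv ℝ r z - fderiv ℝ r y‖ ≤ C * ‖z - y‖ := by
    intro p hp z hz y hy
    exact (convex_ball p δ).norm_image_sub_le_of_norm_hasFDerivWithin_le
      (fun x hx => (s2 x (hthU (hb p hp hx))).hasFDerivWithinAt)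
      (fun x hx => (hC2 x (hb p hp hx)).trans hCC2) hy hz
  have hsm : ∀ p : EE n, ∀ z ∈ ball p δ, C * ‖z - p‖ ≤ c := by
    intro p z hz
    rw [mem_ball_iff_norm] at hz
    nlinarith
  refine ⟨r, fderiv ℝ r, fderiv ℝ (fderiv ℝ r), δ, c, C, hn, op, bd, hδ0,
    (min_le_left _ _).trans (min_le_right _ _), hc0, min_le_right _ _, hCone, ?_, ?_, ?_, ?_, ?_, ?_,
    hddrL, ?_, ?_⟩
  · exact fun p hp z hz => s1 z (hthU (hb p hp hz))
  · exact fun p hp z hz => s2 z (hthU (hb p hp hz))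
  · intro p hp z hz w
    have h1 := hddrL p hp z hz p (mem_ball_self hδ0)
    have h2 := hlevK p hp w
    have h3 : ∀ x : EE n, ‖x‖ = ‖w‖ → fderiv ℝ (fderiv ℝ r) p x x - fderiv ℝ (fderiv ℝ r) z x x
        ≤ c * ‖w‖ ^ 2 := by
      intro x hx
      have := (fderiv ℝ (fderiv ℝ r) z - fderiv ℝ (fderiv ℝ r) p).le_opNorm₂ x x
      rw [hx] at this
      have h4 := h1.trans (hsm p z hz)
      have h5 : ‖fderiv ℝ (fderiv ℝ r) z - fderiv ℝ (fderiv ℝ r) p‖ * ‖w‖ * ‖w‖ ≤ c * ‖w‖ * ‖w‖ := by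
        gcongr
      have h6 := neg_abs_le ((fderiv ℝ (fderiv ℝ r) z - fderiv ℝ (fderiv ℝ r) p) x x)
      rw [← Real.norm_eq_abs] at h6
      simp only [sub_apply] at h6 this
      nlinarith
    have h4 := h3 w rfl
    have h5 := h3 (I • w) (by rw [norm_smul]; simp)
    unfold lv at h2 ⊢
    have : c * ‖w‖ ^ 2 ≤ c1 / 2 * ‖w‖ ^ 2 := by gcongr
    nlinarith [sq_nonneg ‖w‖]
  · intro p hp z hz
    have h1 := (hdrL p hp z hz p (mem_ball_self hδ0)).trans (hsm p z hz)
    have h2 := hdrK p hp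
    have h3 := norm_sub_norm_le (fderiv ℝ r p) (fderiv ℝ r z)
    rw [norm_sub_rev] at h3
    linarith
  · exact fun p hp z hz => (hC1 z (hb p hp hz)).trans hCC1
  · exact fun p hp z hz => (hC2 z (hb p hp hz)).trans hCC2
  · intro p hp z hz
    have hzU := hth (hb p hp hz)
    have h1 : 0 < 1 + L * ρ z := hzU.2
    have h2 : r z = ρ z * (1 + L * ρ z) := by simp only [hr]; ring
    rw [h2, hΩeq]
    constructor
    · rintro ⟨-, h⟩; exact mul_neg_of_neg_of_pos h h1
    · intro h
      refine ⟨hzU.1, ?_⟩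
      by_contra hcon
      push Not at hcon
      nlinarith [mul_nonneg hcon h1.le]
  · intro p hp
    simp [hr, hρ0 p hp]

end P4bsec

section P5sec
open Filter Topology

variable {n : ℕ}

lemma seg_lip {Y : Type*} [NormedAddCommGroup Y] {F : EE n → Y} {M : ℝ} {x y : EE n}
    (h : ∀ t ∈ Set.Icc (0:ℝ) 1, ∀ᶠ w in 𝓝 (x + t • (y - x)),
      ‖F w - F (x + t • (y - x))‖ ≤ M * ‖w - (x + t • (y - x))‖) :
    ‖F y - F x‖ ≤ M * ‖y - x‖ := by
  have hloc : ∀ t ∈ Set.Icc (0:ℝ) 1, ∀ᶠ s in 𝓝 t,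
      ‖F (x + s • (y - x)) - F (x + t • (y - x))‖ ≤ M * ‖y - x‖ * |s - t| := by
    intro t ht
    have tt : Tendsto (fun s : ℝ => x + s • (y - x)) (𝓝 t) (𝓝 (x + t • (y - x))) :=
      Continuous.tendsto (by fun_prop) t
    filter_upwards [tt.eventually (h t ht)] with s hs
    have e : x + s • (y - x) - (x + t • (y - x)) = (s - t) • (y - x) := by
      rw [sub_smul]; abel
    rw [e, norm_smul, Real.norm_eq_abs] at hs
    linarith
  have hcont : ContinuousOn (fun s : ℝ => F (x + s • (y - x))) (Set.Icc 0 1) := by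
    intro t ht
    refine ContinuousAt.continuousWithinAt ?_
    rw [ContinuousAt, tendsto_iff_norm_sub_tendsto_zero]
    refine squeeze_zero' (Eventually.of_forall fun _ => norm_nonneg _) (hloc t ht) ?_
    have : Tendsto (fun s : ℝ => M * ‖y - x‖ * |s - t|) (𝓝 t) (𝓝 (M * ‖y - x‖ * |t - t|)) :=
      Continuous.tendsto (by fun_prop) t
    simpa using this
  have key := image_le_of_liminf_slope_right_le_deriv_boundary
    (f := fun s : ℝ => ‖F (x + s • (y - x)) - F x‖) (a := 0) (b := 1)
    (B := fun s => M * ‖y - x‖ * s) (B' := fun _ => M * ‖y - x‖)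
    (hcont.sub continuousOn_const).norm (by simp) (by fun_prop)
    (fun s _ => by simpa using ((hasDerivAt_id s).const_mul (M * ‖y - x‖)).hasDerivWithinAt)
    (by
      intro t ht r hr
      refine Eventually.frequently ?_
      filter_upwards [nhdsWithin_le_nhds (hloc t ⟨ht.1, ht.2.le⟩), self_mem_nhdsWithin] with s hs hst
      have hst : t < s := hst
      refine lt_of_le_of_lt ?_ hr
      rw [slope_def_field, div_le_iff₀ (by linarith)]
      rw [abs_of_pos (by linarith)] at hs
      refine le_trans ?_ hs
      have := norm_sub_norm_le (F (x + s • (y - x)) - F x) (F (x + t • (y - x)) - F x)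
      rwa [sub_sub_sub_cancel_right] at this)
  have := key (Set.right_mem_Icc.2 zero_le_one)
  simpa using this

variable {Ω : Set (EE n)} {r : EE n → ℝ} {dr : EE n → EE n →L[ℝ] ℝ} {ddr : EE n → BF n} {δ c C : ℝ}

namespace Geo

lemma drL (G : Geo Ω r dr ddr δ c C) {p z y : EE n} (hp : p ∈ frontier Ω) (hz : z ∈ ball p δ)
    (hy : y ∈ ball p δ) : ‖dr z - dr y‖ ≤ C * ‖z - y‖ :=
  (convex_ball p δ).norm_image_sub_le_of_norm_hasFDerivWithin_le
      (fun x hx => (G.d2 p hp x hx).hasFDerivWithinAt) (fun x hx => G.ddrC p hp x hx) hy hz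

lemma rL (G : Geo Ω r dr ddr δ c C) {p z y : EE n} (hp : p ∈ frontier Ω) (hz : z ∈ ball p δ)
    (hy : y ∈ ball p δ) : |r z - r y| ≤ C * ‖z - y‖ :=
  (convex_ball p δ).norm_image_sub_le_of_norm_hasFDerivWithin_le
      (fun x hx => (G.d1 p hp x hx).hasFDerivWithinAt) (fun x hx => G.drC p hp x hx) hy hz

lemma r_le (G : Geo Ω r dr ddr δ c C) {p z : EE n} (hp : p ∈ frontier Ω) (hz : z ∈ ball p δ) :
    |r z| ≤ C * ‖z - p‖ := by
  have := G.rL hp hz (mem_ball_self G.hδ)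
  rwa [G.zero p hp, sub_zero] at this

lemma taylor1 (G : Geo Ω r dr ddr δ c C) {p z y : EE n} (hp : p ∈ frontier Ω) (hz : z ∈ ball p δ)
    (hy : y ∈ ball p δ) : |r y - r z - dr z (y - z)| ≤ C * ‖y - z‖ ^ 2 := by
  have hseg : segment ℝ z y ⊆ ball p δ := (convex_ball p δ).segment_subset hz hy
  have := (convex_segment z y).norm_image_sub_le_of_norm_hasFDerivWithin_le
    (f := fun w => r w - dr z w) (f' := fun w => dr w - dr z) (C := C * ‖y - z‖)
    (fun x hx => ((G.d1 p hp x (hseg hx)).sub (dr z).hasFDerivAt).hasFDerivWithinAt)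
    (fun x hx => by
      refine (G.drL hp (hseg hx) hz).trans ?_
      have : ‖x - z‖ ≤ ‖y - z‖ := by
        obtain ⟨a, b, ha, hb, hab, rfl⟩ := hx
        have : a • z + b • y - z = b • (y - z) := by
          rw [show a = 1 - b by linarith]; module
        rw [this, norm_smul, Real.norm_of_nonneg hb]
        nlinarith [norm_nonneg (y - z)]
      have hC := G.hC
      gcongr) (left_mem_segment ℝ z y) (right_mem_segment ℝ z y)
  rw [Real.norm_eq_abs] at this
  refine le_trans (le_of_eq ?_) (this.trans (le_of_eq (by ring)))
  congr 1
  simp; ring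

lemma ex2 (G : Geo Ω r dr ddr δ c C) {p z : EE n} (hp : p ∈ frontier Ω) (hz : z ∈ ball p δ) :
    Ex2 r z (dr z) (ddr z) := by
  refine Ex2.taylor ?_ (G.d2 p hp z hz)
  filter_upwards [isOpen_ball.mem_nhds hz] with y hy
  exact G.d1 p hp y hy

lemma ne_univ (G : Geo Ω r dr ddr δ c C) : Ω ≠ Set.univ := by
  rintro h
  have : Nontrivial (EE n) := by
    obtain ⟨w, hw⟩ := exists_ne_ee G.hn
    exact ⟨w, 0, by rintro rfl; simp at hw⟩
  have hb := G.bd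
  rw [h] at hb
  exact NormedSpace.unbounded_univ ℝ (EE n) hb

lemma nearest (G : Geo Ω r dr ddr δ c C) {z : EE n} (hz : z ∈ Ω) :
    ∃ p ∈ frontier Ω, infDist z Ωᶜ = ‖z - p‖ := by
  obtain ⟨p, hp, h⟩ := exists_mem_frontier_infDist_compl_eq_dist hz G.ne_univ
  exact ⟨p, hp, by rw [h, dist_eq_norm]⟩

lemma mem_of_infDist (G : Geo Ω r dr ddr δ c C) {z w : EE n}
    (h : ‖w - z‖ < infDist z Ωᶜ) : w ∈ Ω := by
  by_contra hw
  have := infDist_le_dist_of_mem (x := z) (show w ∈ Ωᶜ from hw)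
  rw [dist_comm, dist_eq_norm] at this
  linarith

/-- inward motion stays inside -/
lemma inward (G : Geo Ω r dr ddr δ c C) {p x e : EE n} (hp : p ∈ frontier Ω) (hx : x ∈ ball p δ)
    (he : ‖e‖ = 1) (hpe : dr p e ≤ -c) {u : ℝ} (hu : 0 ≤ u) (hxu : x + u • e ∈ ball p δ)
    (hsm : C * (‖x - p‖ + u) ≤ c / 2) : r (x + u • e) ≤ r x - u * (c / 2) := by
  have h1 := (abs_le.1 (G.taylor1 hp hx hxu)).2
  rw [add_sub_cancel_left, norm_smul, he, Real.norm_of_nonneg hu, map_smul, smul_eq_mul] at h1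
  have h2 := G.drL hp hx (mem_ball_self G.hδ)
  have h3 := (dr x - dr p).le_opNorm e
  rw [he, mul_one] at h3
  have h4 := (le_abs_self _).trans (h3.trans h2)
  simp only [sub_apply] at h4
  have h5 : u * dr x e ≤ u * (-c + C * ‖x - p‖) := by gcongr; linarith
  have h6 : u * (C * (‖x - p‖ + u)) ≤ u * (c/2) := by gcongr
  nlinarith

lemma exists_inward (G : Geo Ω r dr ddr δ c C) {p z : EE n} (hp : p ∈ frontier Ω) (hz : z ∈ ball p δ) :
    ∃ e : EE n, ‖e‖ = 1 ∧ dr z e = -‖dr z‖ := by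
  have h1 := G.drc p hp z hz
  have hc := G.hc
  have h2 : 0 < ‖gradV (dr z)‖ := by rw [gradV_norm]; linarith
  refine ⟨(-‖gradV (dr z)‖⁻¹ : ℝ) • gradV (dr z), ?_, ?_⟩
  · rw [norm_smul, norm_neg, norm_inv, norm_norm, inv_mul_cancel₀ h2.ne']
  · rw [map_smul, gradV_self, smul_eq_mul, ← gradV_norm]; field_simp

lemma quasi (G : Geo Ω r dr ddr δ c C) {Y : Type*} [NormedAddCommGroup Y] {F : EE n → Y} {M : ℝ}
    (hM : 0 ≤ M)
    (hF : ∀ z ∈ Ω, ∀ᶠ w in 𝓝 z, ‖F w - F z‖ ≤ M * ‖w - z‖) {x y : EE n} (hx : x ∈ Ω) (hy : y ∈ Ω)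
    (hxy : ‖x - y‖ < δ * c ^ 2 / (12 * C ^ 2)) :
    ‖F x - F y‖ ≤ (1 + 8 * C / c) * M * ‖x - y‖ := by
  have hc := G.hc; have hC := G.hC; have hc1 := G.hc1; have hδ := G.hδ; have hδ1 := G.hδ1
  have hCpos : 0 < C := by linarith
  set t := ‖x - y‖ with ht
  have ht0 : 0 ≤ t := norm_nonneg _
  have segm : ∀ a b : EE n, (∀ s ∈ Set.Icc (0:ℝ) 1, a + s • (b - a) ∈ Ω) →
      ‖F b - F a‖ ≤ M * ‖b - a‖ := fun a b h =>
    seg_lip fun s hs => hF _ (h s hs)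
  by_cases hd : t < infDist x Ωᶜ
  · have h1 := segm x y (fun s hs => G.mem_of_infDist (z := x) (by
      rw [add_sub_cancel_left, norm_smul, Real.norm_of_nonneg hs.1, norm_sub_rev y x, ← ht]
      nlinarith [hs.2]))
    rw [norm_sub_rev, norm_sub_rev y x, ← ht] at h1
    refine h1.trans ?_
    have : 0 ≤ 8 * C / c := by positivity
    have h3 : 0 ≤ M * t := by positivity
    nlinarith
  · push Not at hd
    obtain ⟨p, hp, hpd⟩ := G.nearest hx
    rw [hpd] at hd
    obtain ⟨e, he, hpe⟩ := G.exists_inward hp (mem_ball_self hδ)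
    have hpe' : dr p e ≤ -c := by rw [hpe]; linarith [G.drc p hp p (mem_ball_self hδ)]
    set s := 4 * C / c * t with hs
    have hs0 : 0 ≤ s := by positivity
    have h12 : t * (12 * C ^ 2) < δ * c ^ 2 := by
      rwa [lt_div_iff₀ (by positivity)] at hxy
    have hsc : s * c = 4 * C * t := by rw [hs]; field_simp
    have hsmall : C * (2 * t + s) ≤ c / 2 := by
      have e2 : C * (2 * t + s) * c ≤ 6 * C ^ 2 * t := by
        have e1 : C * t * c ≤ C * t * C := mul_le_mul_of_nonneg_left (by linarith) (by positivity)
        have e3 : C * (2 * t + s) * c = 2 * (C * t * c) + C * (s * c) := by ring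
        rw [e3, hsc]; nlinarith
      have e3 : c ^ 2 * δ ≤ c ^ 2 := by nlinarith
      by_contra hcon
      push Not at hcon
      nlinarith
    have hsδ : 2 * t + s < δ := by
      have : (2 * t + s) * c ≤ 6 * C * t := by nlinarith
      by_contra hcon
      push Not at hcon
      have e1 : δ * c ≤ (2 * t + s) * c := by gcongr
      have e2 : 6 * C * t ≤ 6 * C ^ 2 * t := by
        have : C ≤ C ^ 2 := by nlinarith
        gcongr
      have e3 : c ^ 2 * δ ≤ c * δ := by
        have : c ^ 2 ≤ c := by nlinarith
        gcongr
      have e4 : 0 < δ * c := by positivity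
      nlinarith
    have hyp : ‖y - p‖ ≤ 2 * t := by
      have : y - p = -(x - y) + (x - p) := by abel
      rw [this]
      refine (norm_add_le _ _).trans ?_
      rw [norm_neg]; linarith
    have inball : ∀ m : EE n, ‖m - p‖ ≤ 2 * t → ∀ u ∈ Set.Icc (0:ℝ) 1, m + (u * s) • e ∈ ball p δ := by
      intro m hm u hu
      rw [mem_ball_iff_norm]
      have : m + (u * s) • e - p = (m - p) + (u * s) • e := by abel
      rw [this]
      refine lt_of_le_of_lt (norm_add_le _ _) ?_
      rw [norm_smul, he, mul_one, Real.norm_of_nonneg (mul_nonneg hu.1 hs0)]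
      nlinarith [hu.2]
    have inb0 : ∀ m : EE n, ‖m - p‖ ≤ 2 * t → m ∈ ball p δ := by
      intro m hm
      have := inball m hm 0 (by simp)
      simpa using this
    have rr : ∀ m : EE n, ‖m - p‖ ≤ 2 * t → ∀ u ∈ Set.Icc (0:ℝ) 1,
        r (m + (u * s) • e) ≤ r m - u * s * (c / 2) := by
      intro m hm u hu
      refine G.inward hp (inb0 m hm) he hpe' (mul_nonneg hu.1 hs0) (inball m hm u hu) ?_
      refine le_trans ?_ hsmall
      have : u * s ≤ s := by nlinarith [hu.2]
      gcongr
    have vert : ∀ m ∈ Ω, ‖m - p‖ ≤ 2 * t → ∀ u ∈ Set.Icc (0:ℝ) 1, m + (u * s) • e ∈ Ω := by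
      intro m hm hmp u hu
      rw [G.mem p hp _ (inball m hmp u hu)]
      have h1 := rr m hmp u hu
      have h2 := (G.mem p hp m (inb0 m hmp)).1 hm
      have : 0 ≤ u * s * (c/2) := by have := hu.1; positivity
      linarith
    have vl : ∀ m ∈ Ω, ‖m - p‖ ≤ 2 * t → ‖F (m + s • e) - F m‖ ≤ M * s := by
      intro m hm hmp
      have := segm m (m + s • e) (fun u hu => by
        have := vert m hm hmp u hu
        rwa [add_sub_cancel_left, smul_smul])
      rwa [add_sub_cancel_left, norm_smul, he, mul_one, Real.norm_of_nonneg hs0] at this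
    have hor : ‖F (y + s • e) - F (x + s • e)‖ ≤ M * t := by
      have := segm (x + s • e) (y + s • e) (fun u hu => by
        have e1 : x + s • e + u • (y + s • e - (x + s • e)) = (x + u • (y - x)) + ((1:ℝ) * s) • e := by
          rw [one_mul]; module
        rw [e1]
        have hm : ‖x + u • (y - x) - x‖ ≤ t := by
          rw [add_sub_cancel_left, norm_smul, Real.norm_of_nonneg hu.1, norm_sub_rev y x]
          nlinarith [hu.2]
        have hmp : ‖x + u • (y - x) - p‖ ≤ 2 * t := by
          have : x + u • (y - x) - p = (x + u • (y - x) - x) + (x - p) := by abel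
          rw [this]
          exact (norm_add_le _ _).trans (by linarith)
        rw [G.mem p hp _ (inball _ hmp 1 (by simp))]
        have h1 := rr _ hmp 1 (by simp)
        have h2 := (G.mem p hp x (inb0 x (by linarith))).1 hx
        have h3 := (abs_le.1 (G.rL hp (inb0 _ hmp) (inb0 x (by linarith)))).2
        have h4 : C * ‖x + u • (y - x) - x‖ ≤ C * t := by gcongr
        nlinarith)
      have e2 : y + s • e - (x + s • e) = y - x := by abel
      rwa [e2, norm_sub_rev y x] at this
    have v1 := vl x hx (by linarith)
    have v2 := vl y hy hyp
    have : F x - F y = -(F (x + s • e) - F x) - (F (y + s • e) - F (x + s • e)) + (F (y + s • e) - F y) := by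
      abel
    rw [this]
    refine (norm_add_le _ _).trans ?_
    have h9 := norm_sub_le (-(F (x + s • e) - F x)) (F (y + s • e) - F (x + s • e))
    rw [norm_neg] at h9
    have e5 : (1 + 8 * C / c) * M * t = M * s + M * t + M * s := by rw [hs]; ring
    rw [e5]
    linarith

/-- uniform quasi-convexity constant -/
lemma quasi_lip (G : Geo Ω r dr ddr δ c C) {Y : Type*} [NormedAddCommGroup Y] {F : EE n → Y} {M : ℝ}
    (hM : 0 ≤ M) (hF : ∀ z ∈ Ω, ∀ᶠ w in 𝓝 z, ‖F w - F z‖ ≤ M * ‖w - z‖) :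
    (∃ A, 0 ≤ A ∧ ∀ z ∈ Ω, ‖F z‖ ≤ A) ∧
      ∃ A, 0 ≤ A ∧ ∀ x ∈ Ω, ∀ y ∈ Ω, ‖F x - F y‖ ≤ A * ‖x - y‖ := by
  have hc := G.hc; have hC := G.hC; have hc1 := G.hc1; have hδ := G.hδ; have hδ1 := G.hδ1
  have hCpos : 0 < C := by linarith
  set d0 := δ * c ^ 2 / (12 * C ^ 2) with hd0
  have hd0' : 0 < d0 := by positivity
  have q := fun {x y} hx hy hxy => G.quasi hM hF (x := x) (y := y) hx hy hxy
  set K := (1 + 8 * C / c) * M with hK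
  have hK0 : 0 ≤ K := by positivity
  have hbdd : ∃ A, 0 ≤ A ∧ ∀ z ∈ Ω, ‖F z‖ ≤ A := by
    obtain ⟨A, hA⟩ : ∃ A, ∀ z ∈ closure Ω ∩ Ω, ‖F z‖ ≤ A := by
      refine (isCompact_closure_of_bd G.bd).induction_on
        (p := fun s => ∃ A, ∀ z ∈ s ∩ Ω, ‖F z‖ ≤ A) ⟨0, by simp⟩ ?_ ?_ ?_
      · rintro s t hst ⟨A, hA⟩
        exact ⟨A, fun z hz => hA z ⟨hst hz.1, hz.2⟩⟩
      · rintro s t ⟨A, hA⟩ ⟨B, hB⟩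
        refine ⟨max A B, ?_⟩
        rintro z ⟨hz | hz, hz2⟩
        · exact (hA z ⟨hz, hz2⟩).trans (le_max_left _ _)
        · exact (hB z ⟨hz, hz2⟩).trans (le_max_right _ _)
      · intro x hx
        refine ⟨ball x (d0/2), mem_nhdsWithin_of_mem_nhds (ball_mem_nhds x (by positivity)), ?_⟩
        obtain ⟨y, hy, hxy⟩ := Metric.mem_closure_iff.1 hx (d0/2) (by positivity)
        refine ⟨‖F y‖ + K * d0, ?_⟩
        rintro z ⟨hz, hz2⟩
        have h1 : ‖z - y‖ < d0 := by
          rw [← dist_eq_norm]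
          have := dist_triangle z x y
          rw [mem_ball] at hz
          linarith
        have h2 := q hz2 hy h1
        have h3 := norm_sub_norm_le (F z) (F y)
        have h4 : K * ‖z - y‖ ≤ K * d0 := by gcongr
        linarith
    exact ⟨max A 0, le_max_right _ _, fun z hz => (hA z ⟨subset_closure hz, hz⟩).trans (le_max_left _ _)⟩
  refine ⟨hbdd, ?_⟩
  obtain ⟨A, hA0, hA⟩ := hbdd
  refine ⟨K + 2 * A / d0, by positivity, fun x hx y hy => ?_⟩
  have h0 := norm_nonneg (x - y)
  by_cases h : ‖x - y‖ < d0
  · refine (q hx hy h).trans ?_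
    have : 0 ≤ 2 * A / d0 := by positivity
    nlinarith
  · push Not at h
    have h1 : ‖F x - F y‖ ≤ 2 * A := (norm_sub_le _ _).trans (by linarith [hA x hx, hA y hy])
    have h2 : 2 * A ≤ 2 * A / d0 * ‖x - y‖ := by
      rw [div_mul_eq_mul_div, le_div_iff₀ hd0']
      gcongr
    nlinarith

end Geo
end P5sec

section P5bsec
open Filter Topology

variable {n : ℕ} {Ω : Set (EE n)} {r : EE n → ℝ} {dr : EE n → EE n →L[ℝ] ℝ} {ddr : EE n → BF n} {δ c C : ℝ}

namespace Geo

lemma d1pos (G : Geo Ω r dr ddr δ c C) : 0 < c * δ / (6 * C) := by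
  have hc := G.hc; have hC := G.hC; have hδ := G.hδ
  positivity

lemma d1lt (G : Geo Ω r dr ddr δ c C) : c * δ / (6 * C) ≤ δ / 6 := by
  have hc := G.hc; have hC := G.hC; have hδ := G.hδ; have := G.hc1
  rw [div_le_div_iff₀ (by positivity) (by positivity)]
  have : c * δ ≤ C * δ := by gcongr; linarith
  nlinarith

lemma infDist_le (_G : Geo Ω r dr ddr δ c C) {p z : EE n} (hp : p ∈ frontier Ω) :
    infDist z Ωᶜ ≤ ‖z - p‖ := by
  rw [← dist_eq_norm]
  refine infDist_le_dist_of_mem ?_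
  have := _G.op.frontier_eq ▸ hp
  exact this.2

lemma infDist_zero (_G : Geo Ω r dr ddr δ c C) {z : EE n} (hz : z ∉ Ω) :
    infDist z Ωᶜ = 0 := infDist_zero_of_mem hz

lemma mem_of_pos (G : Geo Ω r dr ddr δ c C) {z : EE n} (hz : 0 < infDist z Ωᶜ) : z ∈ Ω := by
  by_contra h
  have := G.infDist_zero h
  linarith

lemma pos_of_mem (G : Geo Ω r dr ddr δ c C) {z : EE n} (hz : z ∈ Ω) : 0 < infDist z Ωᶜ := by
  have : (Ωᶜ).Nonempty := by
    rw [Set.nonempty_compl]; exact G.ne_univ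
  exact (G.op.isClosed_compl.notMem_iff_infDist_pos this).1 (by simpa using hz)

lemma r_lower (G : Geo Ω r dr ddr δ c C) {z : EE n} (hz : z ∈ Ω)
    (hd : infDist z Ωᶜ < c * δ / (6 * C)) : c / 2 * infDist z Ωᶜ ≤ - r z := by
  have hc := G.hc; have hC := G.hC; have hδ := G.hδ; have hc1 := G.hc1; have hδ1 := G.hδ1
  obtain ⟨p, hp, hpd⟩ := G.nearest hz
  set d := infDist z Ωᶜ with hdd
  have hd6 := hd.trans_le G.d1lt
  obtain ⟨e, he, hpe⟩ := G.exists_inward hp (mem_ball_self hδ)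
  have hpe' : dr p e ≤ -c := by rw [hpe]; linarith [G.drc p hp p (mem_ball_self hδ)]
  have hzb : z ∈ ball p δ := by rw [mem_ball_iff_norm, ← hpd]; linarith
  have key : ∀ s ∈ Set.Ico 0 d, c / 2 * s ≤ - r z := by
    intro s hs
    set y := z - s • e with hy
    have hyp : ‖y - p‖ ≤ 2 * d := by
      have : y - p = (z - p) - s • e := by rw [hy]; abel
      rw [this]
      refine (norm_sub_le _ _).trans ?_
      rw [norm_smul, he, Real.norm_of_nonneg hs.1, ← hpd]; linarith [hs.2]
    have hyb : y ∈ ball p δ := by rw [mem_ball_iff_norm]; linarith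
    have hyz : y + s • e = z := by rw [hy]; abel
    have h1 := G.inward hp hyb he hpe' hs.1 (by rw [hyz]; exact hzb) (by
      rw [lt_div_iff₀ (by positivity)] at hd
      have : C * (‖y - p‖ + s) ≤ C * (3 * d) := by gcongr; linarith [hs.2]
      nlinarith)
    rw [hyz] at h1
    have hyΩ : y ∈ Ω := G.mem_of_infDist (z := z) (by
      rw [hy, sub_sub_cancel_left, norm_neg, norm_smul, he, Real.norm_of_nonneg hs.1, mul_one]
      exact hs.2)
    have := (G.mem p hp y hyb).1 hyΩ
    nlinarith
  have hd0 := G.pos_of_mem hz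
  refine le_of_forall_lt_imp_le_of_dense (fun a ha => ?_)
  by_cases ha0 : 0 ≤ a
  · have := key (a / (c/2)) ⟨by positivity, by rw [div_lt_iff₀ (by positivity)]; linarith⟩
    rwa [mul_div_cancel₀ _ (by positivity)] at this
  · have := key 0 ⟨le_rfl, hd0⟩
    linarith

lemma r_upper (G : Geo Ω r dr ddr δ c C) {z : EE n} (hz : z ∈ Ω)
    (hd : infDist z Ωᶜ < δ) : |r z| ≤ C * infDist z Ωᶜ := by
  obtain ⟨p, hp, hpd⟩ := G.nearest hz
  rw [hpd]
  exact G.r_le hp (by rw [mem_ball_iff_norm, ← hpd]; exact hd)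

lemma exists_u0 (G : Geo Ω r dr ddr δ c C) {g : EE n → ℝ} {L : ℝ} (hL : 0 ≤ L)
    (hg : ∀ z ∈ Ω, g z ≤ L) :
    ∃ u0 ∈ SS Ω g, ∃ A0, 0 < A0 ∧ ∀ z ∈ Ω, -A0 * infDist z Ωᶜ ≤ u0 z := by
  have hc := G.hc; have hC := G.hC; have hδ := G.hδ; have hc1 := G.hc1; have hδ1 := G.hδ1
  obtain ⟨R, hR0, hR⟩ := G.bd.subset_ball_lt 0 0
  have hcl : ∀ y ∈ closure Ω, ‖y‖ ≤ R := by
    intro y hy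
    have : y ∈ closedBall (0 : EE n) R := closure_minimal (hR.trans ball_subset_closedBall)
      isClosed_closedBall hy
    rwa [mem_closedBall_zero_iff] at this
  set e1 := c * δ / (6 * C) with he1
  have he0 : 0 < e1 := G.d1pos
  have he6 : e1 ≤ δ / 6 := G.d1lt
  set q : EE n → ℝ := fun z => L * ‖z - 0‖ ^ 2 + (-(L * R ^ 2 + 1)) with hq
  have hqs : ∀ z, IsSubAt q z L := fun z => (isSubAt_normsq G.hn hL 0 z).add_const _
  have hqc : Continuous q := by fun_prop
  have hq1 : ∀ z ∈ closure Ω, q z ≤ -1 := by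
    intro z hz
    have : ‖z - 0‖ ^ 2 ≤ R ^ 2 := by rw [sub_zero]; have := hcl z hz; gcongr
    have := mul_le_mul_of_nonneg_left this hL
    simp only [hq]; linarith
  have hq2 : ∀ z, -(L * R ^ 2 + 1) ≤ q z := by
    intro z
    have : 0 ≤ L * ‖z - 0‖ ^ 2 := by positivity
    simp only [hq]; linarith
  set A := 4 * (L * R ^ 2 + 1) / (c * e1) + L / c + 1 with hA
  have hA0 : 0 < A := by positivity
  have hA1 : L * R ^ 2 + 1 ≤ A * (c / 2 * (e1 / 2)) := by
    have : 4 * (L * R ^ 2 + 1) / (c * e1) ≤ A := by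
      have : 0 ≤ L / c := by positivity
      rw [hA]; linarith
    rw [div_le_iff₀ (by positivity)] at this
    nlinarith
  have hA2 : L ≤ A * c := by
    have : L / c ≤ A := by
      have : 0 ≤ 4 * (L * R ^ 2 + 1) / (c * e1) := by positivity
      rw [hA]; linarith
    rwa [div_le_iff₀ hc] at this
  classical
  set u0 : EE n → ℝ := fun z => if infDist z Ωᶜ < e1 then max (A * r z) (q z) else q z with hu0
  have hcd : Continuous fun z => infDist z Ωᶜ := continuous_infDist_pt _
  have hu1 : ∀ z, infDist z Ωᶜ < e1 → u0 =ᶠ[𝓝 z] fun z => max (A * r z) (q z) := by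
    intro z hz
    filter_upwards [hcd.continuousAt.eventually_lt_const hz] with y hy
    simp only [hu0]
    rw [if_pos hy]
  have hu2 : ∀ z, e1/2 < infDist z Ωᶜ → u0 =ᶠ[𝓝 z] q := by
    intro z hz
    filter_upwards [hcd.continuousAt.eventually_const_lt hz] with y hy
    simp only [hu0]
    split_ifs with h
    · have hyΩ : y ∈ Ω := G.mem_of_pos (by linarith)
      have h1 := G.r_lower hyΩ h
      refine max_eq_right ?_
      have : c / 2 * (e1/2) ≤ c / 2 * infDist y Ωᶜ := by gcongr
      have h3 : A * (c / 2 * (e1 / 2)) ≤ A * (- r y) := by gcongr; linarith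
      linarith [hq2 y]
    · rfl
  have near : ∀ z ∈ closure Ω, infDist z Ωᶜ < e1 → ∃ p ∈ frontier Ω, z ∈ ball p δ := by
    intro z hz hz1
    by_cases h : z ∈ Ω
    · obtain ⟨p, hp, hpd⟩ := G.nearest h
      exact ⟨p, hp, by rw [mem_ball_iff_norm, ← hpd]; linarith⟩
    · exact ⟨z, by rw [G.op.frontier_eq]; exact ⟨hz, h⟩, mem_ball_self hδ⟩
  refine ⟨u0, ⟨?_, ?_, ?_⟩, A * C + (L * R ^ 2 + 1) / e1, by positivity, ?_⟩
  · intro z hz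
    refine ContinuousAt.continuousWithinAt ?_
    by_cases h : infDist z Ωᶜ < e1
    · refine ContinuousAt.congr ?_ (hu1 z h).symm
      obtain ⟨p, hp, hzp⟩ := near z hz h
      have := (G.d1 p hp z hzp).continuousAt
      exact (continuousAt_const.mul this).max hqc.continuousAt
    · refine hqc.continuousAt.congr (hu2 z (by linarith)).symm
  · intro z hz
    by_cases h : infDist z Ωᶜ < e1
    · obtain ⟨p, hp, hzp⟩ := near z (subset_closure hz) h
      have h1 : IsSubAt (fun z => A * r z) z L := by
        refine ⟨_, _, (G.ex2 hp hzp).ls.const_mul hA0.le, ?_⟩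
        refine (subM_of_lv G.hn (c := A * c) (by positivity) fun w => ?_).mono hA2 fun _ => le_rfl
        rw [lv_smul, mul_assoc]
        exact mul_le_mul_of_nonneg_left (G.levi p hp z hzp w) hA0.le
      exact (h1.max (hqs z)).mono (hu1 z h).eq_of_nhds.symm ((hu1 z h).symm.le) (hg z hz)
    · have := hu2 z (by linarith)
      exact (hqs z).mono this.eq_of_nhds.symm this.symm.le (hg z hz)
  · intro z hz
    have hz2 := (G.op.frontier_eq ▸ hz : z ∈ closure Ω \ Ω)
    have h0 : infDist z Ωᶜ < e1 := by rw [G.infDist_zero hz2.2]; exact he0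
    have := hq1 z hz2.1
    simp only [hu0]
    rw [if_pos h0, G.zero z hz, mul_zero]
    exact max_le le_rfl (by linarith)
  · intro z hz
    have hd0 := G.pos_of_mem hz
    simp only [hu0]
    have hb : 0 ≤ (L * R ^ 2 + 1) / e1 * infDist z Ωᶜ := by positivity
    have hb2 : 0 ≤ A * C * infDist z Ωᶜ := by positivity
    split_ifs with h
    · refine le_trans ?_ (le_max_left _ _)
      have h1 := (abs_le.1 (G.r_upper hz (by linarith))).1
      have := mul_le_mul_of_nonneg_left h1 hA0.le
      nlinarith
    · push Not at h
      refine le_trans ?_ (hq2 z)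
      have : (L * R ^ 2 + 1) ≤ (L * R ^ 2 + 1) / e1 * infDist z Ωᶜ := by
        rw [div_mul_eq_mul_div, le_div_iff₀ he0]; gcongr
      linarith
end Geo

/-- standing data : geometry, right-hand side -/
structure Std (Ω : Set (EE n)) (g : EE n → ℝ) (r : EE n → ℝ) (dr : EE n → EE n →L[ℝ] ℝ) (ddr : EE n → BF n)
    (δ c C : ℝ) (L A0 R : ℝ) : Prop where
  G : Geo Ω r dr ddr δ c C
  hL : 1 ≤ L
  g0 : ∀ z ∈ Ω, 0 ≤ g z
  gB : ∀ z ∈ Ω, g z ≤ L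
  gL : ∀ x ∈ Ω, ∀ y ∈ Ω, |g x - g y| ≤ L * ‖x - y‖
  gS : ∀ z τ, ‖τ‖ < infDist z Ωᶜ → 2 * g z - L * ‖τ‖ ^ 2 ≤ g (z + τ) + g (z - τ)
  hA0 : 1 ≤ A0
  u0 : ∃ u0 ∈ SS Ω g, ∀ z ∈ Ω, -A0 * infDist z Ωᶜ ≤ u0 z
  hR : 1 ≤ R
  bR : ∀ z ∈ closure Ω, ‖z‖ ≤ R

lemma Geo.exists_std (G : Geo Ω r dr ddr δ c C) {g : EE n → ℝ} (hg0 : ∀ z ∈ closure Ω, 0 ≤ g z)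
    (hg : C11On n Ω g) : ∃ L A0 R, Std Ω g r dr ddr δ c C L A0 R := by
  obtain ⟨hg1, K, hK⟩ := hg
  have hdiff : ∀ z ∈ Ω, DifferentiableAt ℝ g z := fun z hz =>
    (hg1.differentiableOn (by norm_num)).differentiableAt (G.op.mem_nhds hz)
  have hKK : ∀ z ∈ Ω, ∀ w ∈ Ω, ‖fderiv ℝ g z - fderiv ℝ g w‖ ≤ max K 0 * ‖z - w‖ := fun z hz w hw =>
    (hK z hz w hw).trans (by gcongr; exact le_max_left _ _)
  obtain ⟨⟨M, hM0, hM⟩, -⟩ := G.quasi_lip (F := fderiv ℝ g) (M := max K 0) (le_max_right _ _) (by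
    intro z hz
    filter_upwards [G.op.mem_nhds hz] with w hw
    exact hKK w hw z hz)
  obtain ⟨⟨B, hB0, hB⟩, ⟨B', hB'0, hB'⟩⟩ := G.quasi_lip (F := g) (M := M) hM0 (by
    intro z hz
    obtain ⟨ε, hε, hball⟩ := Metric.isOpen_iff.1 G.op z hz
    filter_upwards [ball_mem_nhds z hε] with w hw
    exact (convex_ball z ε).norm_image_sub_le_of_norm_hasFDerivWithin_le
      (fun x hx => (hdiff x (hball hx)).hasFDerivAt.hasFDerivWithinAt)
      (fun x hx => hM x (hball hx)) (mem_ball_self hε) hw)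
  set L := 1 + B + B' + 4 * max K 0 with hLdef
  have hK0 : 0 ≤ max K 0 := le_max_right _ _
  have hgB : ∀ z ∈ Ω, g z ≤ L := fun z hz => by
    have := hB z hz
    have := (le_abs_self _).trans this
    rw [hLdef]; linarith
  obtain ⟨u0, hu0, A0, hA0, h0⟩ := G.exists_u0 (g := g) (L := L) (by rw [hLdef]; linarith) hgB
  obtain ⟨R, hR0, hR⟩ := G.bd.subset_ball_lt 0 0
  have hcl : ∀ y ∈ closure Ω, ‖y‖ ≤ R := by
    intro y hy
    have : y ∈ closedBall (0 : EE n) R := closure_minimal (hR.trans ball_subset_closedBall)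
      isClosed_closedBall hy
    rwa [mem_closedBall_zero_iff] at this
  refine ⟨L, max A0 1, max R 1, G, by rw [hLdef]; linarith, fun z hz => hg0 z (subset_closure hz), hgB, ?_, ?_,
    le_max_right _ _, ⟨u0, hu0, fun z hz => le_trans ?_ (h0 z hz)⟩, le_max_right _ _,
    fun z hz => (hcl z hz).trans (le_max_left _ _)⟩
  · intro x hx y hy
    refine (hB' x hx y hy).trans ?_
    gcongr; rw [hLdef]; linarith
  · intro z τ hτ
    have hball : ∀ t : ℝ, |t| ≤ 1 → z + t • τ ∈ Ω := fun t ht => G.mem_of_infDist (z := z) (by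
      rw [add_sub_cancel_left, norm_smul, Real.norm_eq_abs]
      refine lt_of_le_of_lt ?_ hτ
      nlinarith [norm_nonneg τ])
    have hz : z ∈ Ω := by simpa using hball 0 (by simp)
    -- function h t = g (z + t τ) + g (z - t τ)
    have key := (convex_Icc (0:ℝ) 1).norm_image_sub_le_of_norm_hasDerivWithin_le
      (f := fun t : ℝ => g (z + t • τ) + g (z + (-t) • τ))
      (f' := fun t : ℝ => fderiv ℝ g (z + t • τ) τ - fderiv ℝ g (z + (-t) • τ) τ)
      (C := max K 0 * (2 * ‖τ‖) * ‖τ‖) (fun t ht => by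
        have a1 : |t| ≤ 1 := by rw [abs_of_nonneg ht.1]; exact ht.2
        have a2 : |-t| ≤ 1 := by rw [abs_neg]; exact a1
        have d1 : HasDerivAt (fun t : ℝ => z + t • τ) τ t := by
          simpa using ((hasDerivAt_id t).smul_const τ).const_add z
        have d2 : HasDerivAt (fun t : ℝ => z + (-t) • τ) (-τ) t := by
          simpa using (((hasDerivAt_id t).neg).smul_const τ).const_add z
        have e1 := (hdiff _ (hball t a1)).hasFDerivAt.comp_hasDerivAt t d1
        have e2 := (hdiff _ (hball (-t) a2)).hasFDerivAt.comp_hasDerivAt t d2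
        have := e1.add e2
        rw [map_neg, ← sub_eq_add_neg] at this
        exact this.hasDerivWithinAt)
      (fun t ht => by
        have a1 : |t| ≤ 1 := by rw [abs_of_nonneg ht.1]; exact ht.2
        have a2 : |-t| ≤ 1 := by rw [abs_neg]; exact a1
        have h1 := (fderiv ℝ g (z + t • τ) - fderiv ℝ g (z + (-t) • τ)).le_opNorm τ
        have h2 := hKK _ (hball t a1) _ (hball (-t) a2)
        rw [sub_apply] at h1
        refine h1.trans ?_
        gcongr
        refine h2.trans ?_
        gcongr
        have : z + t • τ - (z + (-t) • τ) = (2 * t) • τ := by module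
        rw [this, norm_smul, Real.norm_eq_abs, abs_of_nonneg (by linarith [ht.1])]
        have := ht.2
        nlinarith [norm_nonneg τ])
      (Set.left_mem_Icc.2 zero_le_one) (Set.right_mem_Icc.2 zero_le_one)
    simp only [one_smul, zero_smul, add_zero, neg_zero, neg_smul, sub_zero, norm_one, mul_one] at key
    have := (abs_le.1 key).1
    have h5 : 2 * max K 0 * ‖τ‖ ^ 2 ≤ L * ‖τ‖ ^ 2 := by gcongr; rw [hLdef]; linarith
    rw [sub_eq_add_neg z τ]
    nlinarith
  · have := infDist_nonneg (x := z) (s := Ωᶜ)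
    have h2 := le_max_left A0 1
    nlinarith

end P5bsec

section P6asec
open Filter Topology

variable {n : ℕ} {Ω : Set (EE n)} {g r : EE n → ℝ} {dr : EE n → EE n →L[ℝ] ℝ} {ddr : EE n → BF n}
  {δ c C L A0 R : ℝ}

lemma mem_closure_or {Ω : Set (EE n)} (ho : IsOpen Ω) {z : EE n} (hz : z ∈ closure Ω) :
    z ∈ Ω ∨ z ∈ frontier Ω := by
  by_cases h : z ∈ Ω
  · exact Or.inl h
  · exact Or.inr (by rw [ho.frontier_eq]; exact ⟨hz, h⟩)

namespace Std

lemma perr (S : Std Ω g r dr ddr δ c C L A0 R) : Perr Ω g :=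
  ⟨S.G.hn, S.G.op, S.G.bd, S.g0, by obtain ⟨u, hu, -⟩ := S.u0; exact ⟨u, hu⟩⟩

lemma u0' (S : Std Ω g r dr ddr δ c C L A0 R) :
    ∃ u0 ∈ SS Ω g, ∀ z ∈ closure Ω, -A0 * infDist z Ωᶜ ≤ u0 z := by
  obtain ⟨u0, hu0, h⟩ := S.u0
  refine ⟨u0, hu0, fun z hz => ?_⟩
  have hc : ContinuousOn (fun z => u0 z - (-A0 * infDist z Ωᶜ)) (closure Ω) :=
    hu0.1.sub ((continuous_const.mul (continuous_infDist_pt _)).continuousOn)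
  have h2 := ContinuousWithinAt.closure_le (f := fun _ => (0:ℝ)) (s := Ω) hz
    continuousWithinAt_const ((hc z hz).mono subset_closure)
    (fun y hy => by have := h y hy; linarith)
  linarith

lemma pv_lower (S : Std Ω g r dr ddr δ c C L A0 R) {z : EE n} (hz : z ∈ closure Ω) :
    -A0 * infDist z Ωᶜ ≤ PV Ω g z := by
  obtain ⟨u0, hu0, h⟩ := S.u0'
  exact (h z hz).trans (S.perr.le hu0 hz)

lemma pv_zero (S : Std Ω g r dr ddr δ c C L A0 R) {z : EE n} (hz : z ∈ frontier Ω) :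
    PV Ω g z = 0 := by
  have hz2 := (S.G.op.frontier_eq ▸ hz : z ∈ closure Ω \ Ω)
  refine le_antisymm (S.perr.pv_nonpos hz2.1) ?_
  have := S.pv_lower hz2.1
  rw [S.G.infDist_zero hz2.2] at this
  simpa using this

lemma lip0 (S : Std Ω g r dr ddr δ c C L A0 R) {z τ : EE n} (hz : z ∈ Ω) (hzτ : z + τ ∈ Ω) :
    PV Ω g (z + τ) ≤ PV Ω g z + (L * R ^ 2 + A0) * ‖τ‖ := by
  have hL := S.hL; have hA0 := S.hA0
  obtain ⟨u0, hu0, h0⟩ := S.u0'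
  refine S.perr.le_of fun u1 hu1 => ?_
  set u : EE n → ℝ := fun z => max (u1 z) (u0 z) with hu
  have huS : u ∈ SS Ω g := SS.sup hu1 hu0
  have hul : ∀ z ∈ closure Ω, -A0 * infDist z Ωᶜ ≤ u z := fun z hz => (h0 z hz).trans (le_max_right _ _)
  set D : Set (EE n) := Ω ∩ (fun z => z + τ) ⁻¹' Ω with hD
  have hDo : IsOpen D := S.G.op.inter (S.G.op.preimage (by fun_prop))
  have hcl : ∀ y ∈ closure D, y ∈ closure Ω ∧ y + τ ∈ closure Ω := by
    intro y hy
    refine ⟨closure_mono Set.inter_subset_left hy, ?_⟩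
    have : Continuous fun z : EE n => z + τ := by fun_prop
    exact this.closure_preimage_subset Ω (closure_mono Set.inter_subset_right hy)
  have hnn : 0 ≤ L * ‖τ‖ := by positivity
  have key := S.perr.glue_le huS hDo Set.inter_subset_left
    (w := fun y => (u (y + τ) + (L * ‖τ‖) * ‖y - 0‖ ^ 2) + (-(L * ‖τ‖ * R ^ 2) - A0 * ‖τ‖))
    (by
      refine ContinuousOn.add (ContinuousOn.add ?_ (by fun_prop)) continuousOn_const
      exact huS.1.comp (by fun_prop) fun y hy => (hcl y hy).2)
    (fun y hy => by
      have h1 := ((IsSubAt.translate (huS.2.1 (y + τ) hy.2)).add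
        (isSubAt_normsq S.G.hn hnn 0 y)).add_const (-(L * ‖τ‖ * R ^ 2) - A0 * ‖τ‖)
      refine h1.mono' ?_
      have := (abs_le.1 (S.gL (y + τ) hy.2 y hy.1)).1
      rw [add_sub_cancel_left] at this
      linarith)
    (fun y hy => by
      have hy2 := (hDo.frontier_eq ▸ hy : y ∈ closure D \ D)
      obtain ⟨hy3, hy4⟩ := hcl y hy2.1
      have h1 : u (y + τ) ≤ 0 := S.perr.nonpos huS _ hy4
      have h2 : ‖y - 0‖ ^ 2 ≤ R ^ 2 := by rw [sub_zero]; have := S.bR y hy3; gcongr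
      have h3 := mul_le_mul_of_nonneg_left h2 hnn
      have h4 := hul y hy3
      have h5 : infDist y Ωᶜ ≤ ‖τ‖ := by
        by_cases h : y ∈ Ω
        · have : y + τ ∈ Ωᶜ := fun h' => hy2.2 ⟨h, h'⟩
          have := infDist_le_dist_of_mem (x := y) this
          rwa [dist_self_add_right] at this
        · rw [S.G.infDist_zero h]; exact norm_nonneg _
      have h6 : A0 * infDist y Ωᶜ ≤ A0 * ‖τ‖ := by gcongr
      linarith) z ⟨hz, hzτ⟩
  have h1 : u1 (z + τ) ≤ u (z + τ) := le_max_left _ _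
  have h2 : 0 ≤ L * ‖τ‖ * ‖z - 0‖ ^ 2 := by positivity
  linarith

lemma lip (S : Std Ω g r dr ddr δ c C L A0 R) {x y : EE n} (hx : x ∈ closure Ω) (hy : y ∈ closure Ω) :
    PV Ω g y ≤ PV Ω g x + (L * R ^ 2 + A0) * ‖y - x‖ := by
  have hL := S.hL; have hA0 := S.hA0
  rcases mem_closure_or S.G.op hx with hx | hx
  · rcases mem_closure_or S.G.op hy with hy | hy
    · have := S.lip0 (z := x) (τ := y - x) hx (by simpa using hy)
      simpa using this
    · rw [S.pv_zero hy]
      have h1 := S.pv_lower (subset_closure hx)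
      have h2 := S.G.infDist_le (z := x) hy
      rw [norm_sub_rev]
      have h3 : A0 * infDist x Ωᶜ ≤ A0 * ‖x - y‖ := by gcongr
      have h4 : 0 ≤ L * R ^ 2 * ‖x - y‖ := by positivity
      linarith
  · rw [S.pv_zero hx]
    have h1 := S.perr.pv_nonpos hy
    have : 0 ≤ (L * R ^ 2 + A0) * ‖y - x‖ := by positivity
    linarith

lemma cont (S : Std Ω g r dr ddr δ c C L A0 R) : ContinuousOn (PV Ω g) (closure Ω) := by
  have hL := S.hL; have hA0 := S.hA0
  refine LipschitzOnWith.continuousOn (K := (L * R ^ 2 + A0).toNNReal) ?_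
  refine LipschitzOnWith.of_dist_le_mul fun x hx y hy => ?_
  rw [Real.coe_toNNReal _ (by positivity), Real.dist_eq, dist_eq_norm, abs_le]
  have h1 := S.lip hx hy
  have h2 := S.lip hy hx
  rw [norm_sub_rev] at h1
  constructor <;> linarith

/-- lower bound through `r` -/
lemma pv_r (S : Std Ω g r dr ddr δ c C L A0 R) {p z : EE n} (hp : p ∈ frontier Ω)
    (hz : z ∈ closure Ω) (hzp : ‖z - p‖ < c * δ / (6 * C)) :
    r z ≤ 0 ∧ -(2 * A0 / c) * |r z| ≤ PV Ω g z := by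
  have hc := S.G.hc; have hA0 := S.hA0
  rcases mem_closure_or S.G.op hz with hz | hz
  · have h1 := S.G.infDist_le (z := z) hp
    have h2 := S.G.r_lower hz (by linarith)
    have h3 := S.pv_lower (subset_closure hz)
    have h0 := S.G.pos_of_mem hz
    have hr : r z ≤ 0 := by have : 0 ≤ c / 2 * infDist z Ωᶜ := by positivity
                            linarith
    refine ⟨hr, le_trans ?_ h3⟩
    rw [abs_of_nonpos hr]
    have : A0 * infDist z Ωᶜ ≤ 2 * A0 / c * (- r z) := by
      rw [div_mul_eq_mul_div, le_div_iff₀ hc]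
      nlinarith
    linarith
  · rw [S.G.zero z hz, S.pv_zero hz]; simp

end Std

/-- Taylor-type comparison for the affine map Φ -/
lemma Geo.phi_r (G : Geo Ω r dr ddr δ c C) {p x y h h' : EE n} (hp : p ∈ frontier Ω)
    (hx : x ∈ ball p δ) (hxh : x + h ∈ ball p δ) (hy : y ∈ ball p δ) (hyh : y + h' ∈ ball p δ)
    (hd : dr y h' = dr x h) {t E : ℝ} (hE : 1 ≤ E) (ht : 0 ≤ t) (ht1 : t ≤ 1) (hxy : ‖y - x‖ ≤ t)
    (hhh : ‖h' - h‖ ≤ E * t * ‖h‖) (hh : ‖h‖ ≤ 1) :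
    |r (y + h') - r (x + h)| ≤ |r y - r x| + 20 * C * E ^ 3 * t * ‖h‖ ^ 2 := by
  have hC := G.hC
  have seg : ∀ {a b : EE n}, a ∈ ball p δ → a + b ∈ ball p δ → ∀ s ∈ Set.Icc (0:ℝ) 1,
      a + s • b ∈ ball p δ := by
    intro a b ha hb s hs
    have := (convex_ball p δ).add_smul_sub_mem ha hb hs
    rwa [add_sub_cancel_left] at this
  have hh' : ‖h'‖ ≤ 2 * E * ‖h‖ := by
    have : h' = h + (h' - h) := by abel
    rw [this]
    refine (norm_add_le _ _).trans ?_
    have : E * t * ‖h‖ ≤ E * 1 * ‖h‖ := by gcongr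
    nlinarith [norm_nonneg h]
  have dcurve : ∀ (a b : EE n) (s : ℝ), HasDerivAt (fun s : ℝ => a + s • b) b s := by
    intro a b s
    simpa using ((hasDerivAt_id s).smul_const b).const_add a
  set φ' : ℝ → ℝ := fun s => dr (y + s • h') h' - dr (x + s • h) h with hφ'
  have b1 := fun (s : ℝ) (hs : s ∈ Set.Icc (0:ℝ) 1) =>
    (convex_Icc (0:ℝ) 1).norm_image_sub_le_of_norm_hasDerivWithin_le (f := φ')
      (f' := fun s => ddr (y + s • h') h' h' - ddr (x + s • h) h h)
      (C := 20 * C * E ^ 3 * t * ‖h‖ ^ 2) (fun s hs => by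
        have e1 := (G.d2 p hp _ (seg hy hyh s hs)).comp_hasDerivAt s (dcurve y h' s)
        have e2 := (G.d2 p hp _ (seg hx hxh s hs)).comp_hasDerivAt s (dcurve x h s)
        have e3 := (e1.clm_apply (hasDerivAt_const s h')).sub (e2.clm_apply (hasDerivAt_const s h))
        simp only [map_zero, add_zero, Function.comp] at e3
        exact e3.hasDerivWithinAt) (fun s hs => by
        set Q1 := ddr (y + s • h')
        set Q2 := ddr (x + s • h)
        have q2 : ‖Q2‖ ≤ C := G.ddrC p hp _ (seg hx hxh s hs)
        have q12 : ‖Q1 - Q2‖ ≤ C * ((1 + E) * t) := by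
          refine (G.ddrL p hp _ (seg hy hyh s hs) _ (seg hx hxh s hs)).trans ?_
          gcongr
          have : y + s • h' - (x + s • h) = (y - x) + s • (h' - h) := by module
          rw [this]
          refine (norm_add_le _ _).trans ?_
          rw [norm_smul, Real.norm_of_nonneg hs.1]
          have a1 : s * ‖h' - h‖ ≤ 1 * (E * t * 1) := by
            refine mul_le_mul hs.2 (hhh.trans ?_) (norm_nonneg _) zero_le_one
            gcongr
          linarith
        have e : Q1 h' h' - Q2 h h = (Q1 - Q2) h' h' + Q2 (h' - h) h' + Q2 h (h' - h) := by
          simp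
        rw [e]
        have n1 : ‖(Q1 - Q2) h' h'‖ ≤ C * ((1 + E) * t) * (2 * E * ‖h‖) * (2 * E * ‖h‖) :=
          ((Q1 - Q2).le_opNorm₂ h' h').trans (by gcongr)
        have n2 : ‖Q2 (h' - h) h'‖ ≤ C * (E * t * ‖h‖) * (2 * E * ‖h‖) :=
          (Q2.le_opNorm₂ _ _).trans (by gcongr)
        have n3 : ‖Q2 h (h' - h)‖ ≤ C * ‖h‖ * (E * t * ‖h‖) :=
          (Q2.le_opNorm₂ _ _).trans (by gcongr)
        refine (norm_add₃_le).trans ?_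
        have f1 : E ^ 2 ≤ E ^ 3 := pow_le_pow_right₀ hE (by norm_num)
        have f2 : E ≤ E ^ 3 := by
          have := pow_le_pow_right₀ hE (show 1 ≤ 3 by norm_num); simpa using this
        have f3 : 0 ≤ C * t * ‖h‖ ^ 2 := by positivity
        have g1 := mul_le_mul_of_nonneg_left f1 f3
        have g2 := mul_le_mul_of_nonneg_left f2 f3
        have g3 : 0 ≤ C * t * ‖h‖ ^ 2 * E ^ 3 := by positivity
        nlinarith) (Set.left_mem_Icc.2 zero_le_one) hs
  have φ0 : φ' 0 = 0 := by simp [hφ', hd]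
  set φ : ℝ → ℝ := fun s => r (y + s • h') - r (x + s • h) with hφ
  have b2 := (convex_Icc (0:ℝ) 1).norm_image_sub_le_of_norm_hasDerivWithin_le (f := φ)
      (f' := φ') (C := 20 * C * E ^ 3 * t * ‖h‖ ^ 2) (fun s hs => by
        have e1 := (G.d1 p hp _ (seg hy hyh s hs)).comp_hasDerivAt s (dcurve y h' s)
        have e2 := (G.d1 p hp _ (seg hx hxh s hs)).comp_hasDerivAt s (dcurve x h s)
        exact (e1.sub e2).hasDerivWithinAt) (fun s hs => by
        have := b1 s hs
        rw [φ0, sub_zero, sub_zero] at this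
        refine this.trans ?_
        rw [Real.norm_of_nonneg hs.1]
        have : 0 ≤ 20 * C * E ^ 3 * t * ‖h‖ ^ 2 := by positivity
        nlinarith [hs.2]) (Set.left_mem_Icc.2 zero_le_one) (Set.right_mem_Icc.2 zero_le_one)
  simp only [hφ, one_smul, zero_smul, add_zero, sub_zero, norm_one, mul_one, Real.norm_eq_abs] at b2
  have := abs_sub_abs_le_abs_sub (r (y + h') - r (x + h)) (r y - r x)
  linarith

end P6asec

section P6bsec
open Filter Topology

variable {n : ℕ} {Ω : Set (EE n)} {g r : EE n → ℝ} {dr : EE n → EE n →L[ℝ] ℝ} {ddr : EE n → BF n}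
  {δ c C L A0 R : ℝ}

/-- the linear map straightening the normals -/
lemma exists_rk1 {lx ly : EE n →L[ℝ] ℝ} {c η : ℝ} (hc : 0 < c) (hly : c ≤ ‖ly‖) (hd : ‖lx - ly‖ ≤ η) :
    ∃ b N' : EE n, (∀ h, ‖rk1 b N' h - h‖ ≤ η / c * ‖h‖) ∧ (∀ h, ly (rk1 b N' h) = lx h) ∧
      1 - η / c ≤ ‖1 + inner ℂ b N'‖ := by
  have hη : 0 ≤ η := (norm_nonneg _).trans hd
  set N := gradV ly with hN
  have hNn : ‖N‖ = ‖ly‖ := gradV_norm ly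
  have hN0 : 0 < ‖N‖ := by rw [hNn]; linarith
  set N' : EE n := ((((‖N‖ ^ 2)⁻¹ : ℝ)) : ℂ) • N with hN'
  have hN'n : ‖N'‖ ≤ 1 / c := by
    rw [hN', norm_smul, Complex.norm_real, Real.norm_of_nonneg (by positivity)]
    rw [le_div_iff₀ hc]
    have : (‖N‖ ^ 2)⁻¹ * ‖N‖ * c = c / ‖N‖ := by field_simp
    rw [this, div_le_one hN0, hNn]; exact hly
  have hNN : inner ℂ N N' = 1 := by
    rw [hN', inner_smul_right, inner_self_eq_norm_sq_to_K]
    have : (‖N‖ : ℂ) ≠ 0 := by exact_mod_cast hN0.ne'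
    push_cast
    simp only [Complex.coe_algebraMap]
    field_simp
  set b := gradV (lx - ly) with hb
  have hbn : ‖b‖ ≤ η := by rw [hb, gradV_norm]; exact hd
  refine ⟨b, N', fun h => ?_, fun h => ?_, ?_⟩
  · rw [rk1_apply, add_sub_cancel_left, norm_smul]
    have h1 := norm_inner_le_norm (𝕜 := ℂ) b h
    calc ‖inner ℂ b h‖ * ‖N'‖ ≤ (η * ‖h‖) * (1 / c) :=
          mul_le_mul (h1.trans (by gcongr)) hN'n (norm_nonneg _) (by positivity)
      _ = _ := by ring
  · rw [rk1_apply, map_add, ← gradV_re ly (inner ℂ b h • N'), inner_smul_right, ← hN, hNN, mul_one,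
      hb, gradV_re]
    simp
  · have h1 : ‖inner ℂ b N'‖ ≤ η / c := by
      refine (norm_inner_le_norm (𝕜 := ℂ) b N').trans ?_
      calc ‖b‖ * ‖N'‖ ≤ η * (1 / c) := by gcongr
        _ = _ := by ring
    have h2 := norm_sub_norm_le (1 : ℂ) (-(inner ℂ b N'))
    rw [sub_neg_eq_add, norm_neg, norm_one] at h2
    linarith

set_option maxHeartbeats 1600000 in
lemma Std.estA (S : Std Ω g r dr ddr δ c C L A0 R) :
    ∃ ρ K : ℝ, 0 < ρ ∧ 1 ≤ K ∧ ρ ≤ c * δ / (24 * C) ∧ ∀ p ∈ frontier Ω, ∀ x ∈ Ω, ∀ y ∈ Ω,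
      ‖x - p‖ < ρ → ‖y - p‖ < ρ →
        PV Ω g y ≤ PV Ω g x + K * (‖x - y‖ * |r x| + |r x - r y|) := by
  have hc := S.G.hc; have hC := S.G.hC; have hδ := S.G.hδ; have hc1 := S.G.hc1; have hδ1 := S.G.hδ1
  have hL := S.hL; have hA0 := S.hA0; have hR := S.hR
  set E := C / c with hEdef
  have hE1 : 1 ≤ E := by rw [hEdef, one_le_div hc]; linarith
  set ρ := c * δ / (24 * C) with hρdef
  have hρ0 : 0 < ρ := by positivity
  have hEρ : E * ρ = δ / 24 := by rw [hEdef, hρdef]; field_simp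
  have hρ6 : 4 * ρ = c * δ / (6 * C) := by rw [hρdef]; field_simp; norm_num
  have hρ24 : ρ ≤ δ / 24 := by nlinarith
  set CF := 20 * C * E ^ 3 with hCF
  have hCF1 : 1 ≤ CF := by
    have : 1 ≤ E ^ 3 := one_le_pow₀ hE1
    rw [hCF]; nlinarith
  set K1 := L * R ^ 2 + A0 with hK1
  have hK10 : 0 < K1 := by positivity
  set B := 2 * A0 / c * CF + 2 * E * K1 / ρ ^ 2 with hB
  have hB0 : 0 < B := by positivity
  set K := (B + 4 * E * L) / c with hK
  have hK0 : 0 < K := by positivity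
  have hKc : K * c = B + 4 * E * L := by rw [hK]; field_simp
  refine ⟨ρ, K + B + 1, hρ0, by linarith, le_rfl, fun p hp x hx y hy hxp hyp => ?_⟩
  set t := ‖x - y‖ with ht
  have ht0 : 0 ≤ t := norm_nonneg _
  have ht2 : t < 2 * ρ := by
    have : x - y = (x - p) - (y - p) := by abel
    rw [ht, this]
    exact lt_of_le_of_lt (norm_sub_le _ _) (by linarith)
  have hEt : E * t ≤ 1 / 12 := by nlinarith
  have hxb : x ∈ ball p δ := by rw [mem_ball_iff_norm]; linarith
  have hyb : y ∈ ball p δ := by rw [mem_ball_iff_norm]; linarith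
  obtain ⟨b, N', hA1, hA2, hA3⟩ := exists_rk1 hc (S.G.drc p hp y hyb) (S.G.drL hp hxb hyb)
  rw [← ht] at hA1 hA3
  have hEt' : C * t / c = E * t := by rw [hEdef]; ring
  rw [hEt'] at hA1 hA3
  set Φ : EE n → EE n := fun z => y + rk1 b N' (z - x) with hΦ
  have hΦc : Continuous Φ := by
    have := (rk1 b N').continuous
    fun_prop
  set s := |r x - r y| with hs
  have hs0 : 0 ≤ s := abs_nonneg _
  -- distances
  have hΦz : ∀ z, ‖z - x‖ ≤ ρ → ‖Φ z - z‖ ≤ 2 * E * t := by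
    intro z hz
    have : Φ z - z = (rk1 b N' (z - x) - (z - x)) + (y - x) := by simp only [hΦ]; abel
    rw [this]
    refine (norm_add_le _ _).trans ?_
    have h1 := hA1 (z - x)
    have h2 : E * t * ‖z - x‖ ≤ E * t * 1 := by gcongr; linarith
    rw [norm_sub_rev y x]
    nlinarith
  have hzp : ∀ z, ‖z - x‖ ≤ ρ → ‖z - p‖ < 2 * ρ := by
    intro z hz
    have : z - p = (z - x) + (x - p) := by abel
    rw [this]; exact lt_of_le_of_lt (norm_add_le _ _) (by linarith)
  have hzb : ∀ z, ‖z - x‖ ≤ ρ → z ∈ ball p δ := by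
    intro z hz
    have := hzp z hz
    rw [mem_ball_iff_norm]; linarith
  have hΦb : ∀ z, ‖z - x‖ ≤ ρ → Φ z ∈ ball p δ := by
    intro z hz
    have h1 := hΦz z hz
    have h2 := hzp z hz
    rw [mem_ball_iff_norm]
    have : Φ z - p = (Φ z - z) + (z - p) := by abel
    rw [this]
    refine lt_of_le_of_lt (norm_add_le _ _) ?_
    nlinarith
  have hrr : ∀ z, ‖z - x‖ ≤ ρ → |r (Φ z) - r z| ≤ s + CF * t * ‖z - x‖ ^ 2 := by
    intro z hz
    have e : x + (z - x) = z := by abel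
    have := S.G.phi_r hp (x := x) (y := y) (h := z - x) (h' := rk1 b N' (z - x)) hxb
      (by rw [e]; exact hzb z hz) hyb (hΦb z hz) (hA2 _) hE1 ht0 (by linarith)
      (by rw [norm_sub_rev]) (hA1 _) (by linarith)
    rw [e] at this
    rw [hs, abs_sub_comm (r x)]
    exact this
  suffices hmain : ∀ u ∈ SS Ω g, u y ≤ PV Ω g x + (K * (t * |r x|) + B * s) by
    have := S.perr.le_of hmain
    refine this.trans ?_
    have : 0 ≤ t * |r x| := by positivity
    nlinarith
  intro u hu
  set D : Set (EE n) := (Ω ∩ ball x ρ) ∩ Φ ⁻¹' Ω with hD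
  have hDo : IsOpen D := (S.G.op.inter isOpen_ball).inter (S.G.op.preimage hΦc)
  have hcl : ∀ z ∈ closure D, z ∈ closure Ω ∧ ‖z - x‖ ≤ ρ ∧ Φ z ∈ closure Ω := by
    intro z hz
    refine ⟨closure_mono (Set.inter_subset_left.trans Set.inter_subset_left) hz, ?_,
      hΦc.closure_preimage_subset Ω (closure_mono Set.inter_subset_right hz)⟩
    have : z ∈ closedBall x ρ := closure_ball_subset_closedBall
      (closure_mono (Set.inter_subset_left.trans Set.inter_subset_right) hz)
    rwa [mem_closedBall_iff_norm] at this
  have key := S.perr.comparison S.cont hDo (Set.inter_subset_left.trans Set.inter_subset_left)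
    (w := fun z => (u (Φ z) + ((K * t) * r z + (-(B * t)) * ‖z - x‖ ^ 2)) + (-(B * s)))
    (by
      refine ContinuousOn.add (ContinuousOn.add ?_ (ContinuousOn.add (continuousOn_const.mul ?_)
        (by fun_prop))) continuousOn_const
      · exact hu.1.comp hΦc.continuousOn fun z hz => (hcl z hz).2.2
      · intro z hz
        exact (S.G.d1 p hp z (hzb z (hcl z hz).2.1)).continuousAt.continuousWithinAt)
    (fun z hz => by
      have hzx : ‖z - x‖ ≤ ρ := (mem_ball_iff_norm.1 hz.1.2).le
      have hzΩ : z ∈ Ω := hz.1.1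
      have hΦΩ : Φ z ∈ Ω := hz.2
      set κ := 1 - E * t with hκ
      have hκ0 : 0 < κ := by linarith
      have hκ1 : κ ≤ 1 := by have : 0 ≤ E * t := by positivity
                             linarith
      have h1 := (hu.2.1 (Φ z) hΦΩ).comp_rk1 S.G.hn (S.g0 _ hΦΩ) hκ0 b N' z
        ((pow_le_of_le_one hκ0.le hκ1 S.G.hn.ne').trans hA3)
      have e1 : (fun z' => u (Φ z + rk1 b N' (z' - z))) = fun z' => u (Φ z') := by
        funext z'
        congr 1
        simp only [hΦ]
        rw [add_assoc, ← map_add]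
        congr 2; abel
      rw [e1] at h1
      have h2 : IsSubAt (fun z => (K * t) * r z + (-(B * t)) * ‖z - x‖ ^ 2) z (4 * E * L * t) := by
        refine ⟨_, _, (((S.G.ex2 hp (hzb z hzx)).const_mul (K * t)).add
          ((Ex2.normsq x z).const_mul (-(B * t)))).ls, subM_of_lv S.G.hn (by positivity) fun w => ?_⟩
        rw [lv_add, lv_smul, lv_smul, lv_smul, lv_ip]
        have h3 := mul_le_mul_of_nonneg_left (S.G.levi p hp z (hzb z hzx) w)
          (show 0 ≤ K * t by positivity)
        have h4 : K * t * (c * ‖w‖ ^ 2) = (B + 4 * E * L) * t * ‖w‖ ^ 2 := by rw [← hKc]; ring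
        nlinarith
      refine ((h1.add h2).add_const _).mono' ?_
      have h3 := (abs_le.1 (S.gL _ hΦΩ z hzΩ)).1
      have h4 := hΦz z hzx
      have h5 : L * ‖Φ z - z‖ ≤ L * (2 * E * t) := by gcongr
      have h6 := S.gB _ hΦΩ
      have h7 := S.g0 _ hΦΩ
      have h8 : κ ^ 2 * g (Φ z) ≥ g (Φ z) - 2 * (E * t) * L := by
        have : κ ^ 2 ≥ 1 - 2 * (E * t) := by rw [hκ]; nlinarith [sq_nonneg (E * t)]
        have h9 := mul_le_mul_of_nonneg_right this h7
        have h10 : 2 * (E * t) * g (Φ z) ≤ 2 * (E * t) * L := by gcongr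
        linarith
      linarith)
    (fun z hz => by
      have hz2 := (hDo.frontier_eq ▸ hz : z ∈ closure D \ D)
      obtain ⟨hz3, hz4, hz5⟩ := hcl z hz2.1
      have hu1 : u (Φ z) ≤ 0 := S.perr.nonpos hu _ hz5
      have hBt : 0 ≤ B * t * ‖z - x‖ ^ 2 := by positivity
      have hBs : 0 ≤ B * s := by positivity
      obtain ⟨hr0, hr1⟩ := S.pv_r hp hz3 (by rw [← hρ6]; linarith [hzp z hz4])
      have hr2 : K * t * r z ≤ 0 := mul_nonpos_of_nonneg_of_nonpos (by positivity) hr0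
      rcases mem_closure_or S.G.op hz3 with h | h
      swap
      · rw [S.pv_zero h]; linarith
      rcases mem_closure_or S.G.op hz5 with h' | h'
      swap
      · have h1 := hrr z hz4
        rw [S.G.zero _ h', zero_sub, abs_neg] at h1
        have h2 : 2 * A0 / c * |r z| ≤ 2 * A0 / c * (s + CF * t * ‖z - x‖ ^ 2) := by gcongr
        have h3 : 2 * A0 / c * CF ≤ B := by
          have : 0 ≤ 2 * E * K1 / ρ ^ 2 := by positivity
          rw [hB]; linarith
        have h4 : 2 * A0 / c * CF * (t * ‖z - x‖ ^ 2) ≤ B * (t * ‖z - x‖ ^ 2) := by gcongr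
        have h5 : 2 * A0 / c * s ≤ B * s := by
          gcongr
          refine le_trans ?_ h3
          have : 0 ≤ 2 * A0 / c := by positivity
          nlinarith
        linarith
      have hzx : ‖z - x‖ = ρ := by
        refine le_antisymm hz4 (not_lt.1 fun hlt => hz2.2 ⟨⟨h, ?_⟩, h'⟩)
        rwa [mem_ball_iff_norm]
      have h1 := S.lip hz3 hz5
      have h2 := S.perr.le hu hz5
      have h3 := hΦz z hz4
      have h4 : K1 * ‖Φ z - z‖ ≤ K1 * (2 * E * t) := by gcongr
      have h5 : K1 * (2 * E * t) ≤ B * t * ‖z - x‖ ^ 2 := by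
        rw [hzx]
        have : 2 * E * K1 / ρ ^ 2 ≤ B := by
          have : 0 ≤ 2 * A0 / c * CF := by positivity
          rw [hB]; linarith
        rw [div_le_iff₀ (by positivity)] at this
        nlinarith
      linarith) x (by
        refine ⟨⟨hx, mem_ball_self hρ0⟩, ?_⟩
        simp only [hΦ, Set.mem_preimage, sub_self, map_zero, add_zero]; exact hy)
  simp only [hΦ, sub_self, map_zero, add_zero, norm_zero] at key
  have h1 := neg_abs_le (r x)
  have h2 : K * t * (-|r x|) ≤ K * t * r x := by gcongr
  nlinarith

end P6bsec

section P6csec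
open Filter Topology

variable {n : ℕ} {Ω : Set (EE n)} {g r : EE n → ℝ} {dr : EE n → EE n →L[ℝ] ℝ} {ddr : EE n → BF n}
  {δ c C L A0 R : ℝ}

lemma ip_apply (x y : EE n) : ip n x y = inner ℝ x y := rfl

/-- Interior Hopf lemma -/
lemma Std.hopf_int (S : Std Ω g r dr ddr δ c C L A0 R) {x p : EE n} {ϱ : ℝ} (hϱ : 0 < ϱ)
    (hball : closedBall p ϱ ⊆ Ω) (hxp : ‖p - x‖ = ϱ) (hp : PV Ω g p = 0)
    (hneg : ∀ z ∈ closedBall x ϱ, z ∈ Ω → z ≠ p → PV Ω g z < 0) : False := by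
  set s := ϱ / 32 with hs
  have hs0 : 0 < s := by positivity
  set q : EE n → ℝ := fun z => (-1) * ‖z - x‖ ^ 2 + ϱ ^ 2 with hq
  set A := 1 / ϱ ^ 2 with hA
  have hA0 : 0 < A := by positivity
  have hAϱ : A * ϱ ^ 2 = 1 := by rw [hA]; field_simp
  set h : EE n → ℝ := fun z => q z + A * q z ^ 2 with hh
  have hqc : Continuous q := by fun_prop
  have hhc : Continuous h := by fun_prop
  have hcb : closedBall p s ⊆ Ω := (closedBall_subset_closedBall (by rw [hs]; linarith)).trans hball
  have hqs : ∀ z ∈ closedBall p s, |q z| ≤ ϱ ^ 2 / 8 := by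
    intro z hz
    rw [mem_closedBall_iff_norm] at hz
    have h1 : ‖z - x‖ ≤ ϱ + s := by
      have : z - x = (p - x) + (z - p) := by abel
      rw [this]; exact (norm_add_le _ _).trans (by linarith)
    have h2 : ϱ - s ≤ ‖z - x‖ := by
      have : p - x = (z - x) - (z - p) := by abel
      have h3 := norm_sub_le (z - x) (z - p)
      rw [← this] at h3; linarith
    simp only [hq]
    rw [abs_le]
    constructor <;> nlinarith
  have hAq : ∀ z ∈ closedBall p s, |A * q z| ≤ 1 / 8 := by
    intro z hz
    rw [abs_mul, abs_of_pos hA0]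
    have := mul_le_mul_of_nonneg_left (hqs z hz) hA0.le
    linarith
  -- compact sphere part
  have hvc : ContinuousOn (PV Ω g) (sphere p s) :=
    S.cont.mono ((sphere_subset_closedBall.trans hcb).trans subset_closure)
  have hspc : IsCompact (sphere p s) := isCompact_sphere p s
  obtain ⟨m, hm0, hm⟩ : ∃ m : ℝ, 0 < m ∧ ∀ z ∈ sphere p s, 0 ≤ q z → PV Ω g z ≤ -m := by
    set T := sphere p s ∩ {z | 0 ≤ q z} with hT
    have hTc : IsCompact T := hspc.inter_right (isClosed_le continuous_const hqc)
    rcases T.eq_empty_or_nonempty with he | hne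
    · exact ⟨1, one_pos, fun z hz hz2 => absurd (show z ∈ T from ⟨hz, hz2⟩) (by rw [he]; simp)⟩
    · obtain ⟨z1, hz1, hmx⟩ := hTc.exists_isMaxOn hne (hvc.mono Set.inter_subset_left)
      refine ⟨-PV Ω g z1, ?_, fun z hz hz2 => ?_⟩
      · have hz1s := hz1.1
        have : PV Ω g z1 < 0 := hneg z1 (by
          have := hz1.2
          simp only [hq, Set.mem_setOf_eq] at this
          rw [mem_closedBall_iff_norm]
          exact le_of_sq_le_sq (by linarith) hϱ.le |> fun h => h) (hcb (sphere_subset_closedBall hz1s)) (by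
            rintro rfl
            rw [mem_sphere_iff_norm, sub_self, norm_zero] at hz1s; linarith)
        linarith
      · rw [neg_neg]; exact hmx (show z ∈ T from ⟨hz, hz2⟩)
  set η := m / (2 * ϱ ^ 2) with hη
  have hη0 : 0 < η := by positivity
  have hηm : η * ϱ ^ 2 = m / 2 := by rw [hη]; field_simp
  have hfneg : ∀ z ∈ sphere p s, PV Ω g z + η * h z < 0 := by
    intro z hz
    have hz' := sphere_subset_closedBall hz
    have a1 := hAq z hz'
    have a2 := hqs z hz'
    have hhz : h z = q z * (1 + A * q z) := by simp only [hh]; ring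
    rw [abs_le] at a1 a2
    by_cases hqz : 0 ≤ q z
    · have := hm z hz hqz
      have : h z ≤ ϱ ^ 2 := by rw [hhz]; nlinarith
      have := mul_le_mul_of_nonneg_left this hη0.le
      linarith
    · push Not at hqz
      have : h z < 0 := by rw [hhz]; exact mul_neg_of_neg_of_pos hqz (by linarith)
      have h3 := mul_pos_of_neg_of_neg this (neg_neg_of_pos hη0)
      have := S.perr.pv_nonpos (subset_closure (hcb hz'))
      linarith
  obtain ⟨m', hm'0, hm'⟩ : ∃ m' : ℝ, m' < 0 ∧ ∀ z ∈ sphere p s, PV Ω g z + η * h z ≤ m' := by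
    rcases (sphere p s).eq_empty_or_nonempty with he | hne
    · exact ⟨-1, by norm_num, by rw [he]; simp⟩
    · obtain ⟨z1, hz1, hmx⟩ := hspc.exists_isMaxOn hne
        (hvc.add (continuous_const.mul hhc).continuousOn)
      exact ⟨_, hfneg z1 hz1, fun z hz => hmx hz⟩
  have hqp : q p = 0 := by simp only [hq, hxp]; ring
  obtain ⟨z1, hz1, hS⟩ := S.perr.touch_v S.cont (D := ball p s) (ψ := fun z => (-η) * h z) isOpen_ball
    (ball_subset_closedBall.trans hcb) (by fun_prop) (mem_ball_self hs0) (m := m')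
    (by simp only [hh, hqp, hp]; simpa using hm'0)
    (fun z hz => by
      rw [frontier_ball _ hs0.ne'] at hz
      have := hm' z hz
      linarith)
  have hE := ((Ex2.normsq x z1).const_mul (-1)).add_const (ϱ ^ 2)
  have hE2 := (hE.add (hE.sq.const_mul A)).const_mul (-η)
  have hSub := hS _ _ hE2
  have hz1' := ball_subset_closedBall hz1
  have hpos := hSub.lv_nonneg S.G.hn (S.g0 z1 (hcb hz1')) (z1 - x)
  have a2 := hqs z1 hz1'
  simp only [lv_smul, lv_add, lv_sqf, lv_ip, smul_apply, ip_apply, real_inner_self_eq_norm_sq,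
    smul_eq_mul] at hpos
  change |-1 * ‖z1 - x‖ ^ 2 + ϱ ^ 2| ≤ _ at a2
  rw [abs_le] at a2
  set X := ‖z1 - x‖ ^ 2 with hX
  set Y := (inner ℝ (z1 - x) (I • (z1 - x)) : ℝ) with hY
  have hX0 : 0 < X := by nlinarith
  have key : 0 < X * (-1) + A * (2 * (-1 * X + ϱ ^ 2) * (-X) + 2 * X ^ 2) := by
    have e : X * (-1) + A * (2 * (-1 * X + ϱ ^ 2) * (-X) + 2 * X ^ 2)
       = X * (A * (4 * X - 3 * ϱ ^ 2)) + X * (A * ϱ ^ 2 - 1) := by ring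
    rw [e, hAϱ]
    have : 0 < A * (4 * X - 3 * ϱ ^ 2) := mul_pos hA0 (by nlinarith)
    nlinarith
  have hAY : 0 ≤ A * Y ^ 2 := by positivity
  nlinarith [mul_pos hη0 key, mul_nonneg hη0.le hAY]

/-- zero set is open -/
lemma Std.zero_open (S : Std Ω g r dr ddr δ c C L A0 R) {z0 : EE n} (hz0 : z0 ∈ Ω)
    (h0 : PV Ω g z0 = 0) : ∀ᶠ y in 𝓝 z0, PV Ω g y = 0 := by
  obtain ⟨ε, hε, hball⟩ := Metric.isOpen_iff.1 S.G.op z0 hz0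
  filter_upwards [ball_mem_nhds z0 (show 0 < ε / 8 by positivity)] with y hy
  by_contra hy0
  rw [mem_ball_iff_norm] at hy
  set T := closedBall z0 (ε / 2) ∩ {z | PV Ω g z = 0} with hT
  have hcb : closedBall z0 (ε/2) ⊆ Ω := (closedBall_subset_ball (by linarith)).trans hball
  have hTc : IsCompact T := by
    refine (isCompact_closedBall z0 (ε/2)).of_isClosed_subset ?_ Set.inter_subset_left
    exact (S.cont.mono (hcb.trans subset_closure)).preimage_isClosed_of_isClosed isClosed_closedBall
      (isClosed_singleton (x := (0:ℝ)))
  have hz0T : z0 ∈ T := ⟨mem_closedBall_self (by positivity), h0⟩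
  obtain ⟨p, hpT, hpd⟩ := hTc.exists_infDist_eq_dist ⟨z0, hz0T⟩ y
  have hd1 : dist y p ≤ ε / 8 := by
    rw [← hpd]
    refine (infDist_le_dist_of_mem hz0T).trans ?_
    rw [dist_eq_norm]; exact hy.le
  have hyp : y ≠ p := by rintro rfl; exact hy0 hpT.2
  have hd0 : 0 < dist y p := dist_pos.2 hyp
  set d := dist y p with hd
  have hdn : ‖y - p‖ = d := (dist_eq_norm y p).symm
  set x : EE n := (1/2 : ℝ) • (y + p) with hx
  have hpx : ‖p - x‖ = d / 2 := by
    have : p - x = (-(1/2 : ℝ)) • (y - p) := by rw [hx]; module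
    rw [this, norm_smul, hdn, norm_neg, Real.norm_of_nonneg (by norm_num)]; ring
  have hyx : ‖x - y‖ = d / 2 := by
    have : x - y = (-(1/2 : ℝ)) • (y - p) := by rw [hx]; module
    rw [this, norm_smul, hdn, norm_neg, Real.norm_of_nonneg (by norm_num)]; ring
  refine S.hopf_int (x := x) (p := p) (ϱ := d / 2) (by positivity) (fun z hz => hcb ?_) hpx hpT.2 ?_
  · rw [mem_closedBall_iff_norm] at hz ⊢
    have : z - z0 = (z - p) - (y - p) + (y - z0) := by abel
    rw [this]
    refine (norm_add_le _ _).trans ?_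
    have := norm_sub_le (z - p) (y - p)
    linarith
  · intro z hz hzΩ hzp
    rw [mem_closedBall_iff_norm] at hz
    refine lt_of_le_of_ne (S.perr.pv_nonpos (subset_closure hzΩ)) fun hz0 => ?_
    have hzy : ‖z - y‖ ≤ d := by
      have : z - y = (z - x) + (x - y) := by abel
      rw [this]; exact (norm_add_le _ _).trans (by linarith)
    have hzT : z ∈ T := by
      refine ⟨?_, hz0⟩
      rw [mem_closedBall_iff_norm]
      have : z - z0 = (z - y) + (y - z0) := by abel
      rw [this]; exact (norm_add_le _ _).trans (by linarith)
    have hge : d ≤ ‖z - y‖ := by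
      have := infDist_le_dist_of_mem (x := y) hzT
      rw [hpd, dist_comm, dist_eq_norm] at this
      exact this
    -- equality in the triangle inequality
    have h1 : ‖z - y‖ ^ 2 = d ^ 2 := by rw [le_antisymm hzy hge]
    have pl : ‖z - p‖ ^ 2 + ‖z - y‖ ^ 2 = 2 * (‖z - x‖ ^ 2 + ‖x - y‖ ^ 2) := by
      have := parallelogram_law_with_norm ℝ (z - x) (x - y)
      have e1 : z - x + (x - y) = z - y := by abel
      have e2 : z - x - (x - y) = z - p := by rw [hx]; module
      rw [e1, e2] at this
      nlinarith
    have h3 : ‖z - x‖ ^ 2 ≤ (d/2) ^ 2 := by gcongr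
    rw [h1, hyx] at pl
    have h4 : ‖z - p‖ ^ 2 ≤ 0 := by nlinarith
    have : ‖z - p‖ = 0 := by nlinarith [norm_nonneg (z - p)]
    rw [norm_eq_zero, sub_eq_zero] at this
    exact hzp this

open Classical in
lemma Std.zero_unif (S : Std Ω g r dr ddr δ c C L A0 R) :
    ∃ d0 : ℝ, 0 < d0 ∧ ∀ x ∈ Ω, ∀ y ∈ Ω, ‖x - y‖ < d0 → PV Ω g x = 0 → PV Ω g y = 0 := by
  have hc := S.G.hc; have hC := S.G.hC; have hδ := S.G.hδ
  refine ⟨δ * c ^ 2 / (12 * C ^ 2), by positivity, fun x hx y hy hxy h0 => ?_⟩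
  have := S.G.quasi (F := fun z => if PV Ω g z = 0 then (0:ℝ) else 1) (M := 0) le_rfl (by
    intro z hz
    by_cases h : PV Ω g z = 0
    · filter_upwards [S.zero_open hz h] with w hw
      simp [hw, h]
    · have : ContinuousAt (PV Ω g) z := S.cont.continuousAt
        (mem_of_superset (S.G.op.mem_nhds hz) subset_closure)
      filter_upwards [this.eventually_ne h] with w hw
      simp [hw, h]) hx hy hxy
  by_contra hne
  simp [h0, hne] at this
  linarith

lemma lv_le_norm (Q : BF n) (w : EE n) : lv Q w ≤ ‖Q‖ * ‖w‖ ^ 2 / 2 := by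
  have h1 := (le_abs_self _).trans (Q.le_opNorm₂ w w)
  have h2 := (le_abs_self _).trans (Q.le_opNorm₂ (I • w) (I • w))
  rw [norm_smul, Complex.norm_I, one_mul] at h2
  unfold lv
  nlinarith

/-- boundary Hopf lemma -/
lemma Std.hopf_bd (S : Std Ω g r dr ddr δ c C L A0 R) :
    ∃ c0 s0 : ℝ, 0 < c0 ∧ c0 ≤ 1 ∧ 0 < s0 ∧ ∀ z ∈ Ω, infDist z Ωᶜ < s0 → PV Ω g z = 0 ∨ PV Ω g z ≤ c0 * r z := by
  have hc := S.G.hc; have hC := S.G.hC; have hδ := S.G.hδ; have hc1 := S.G.hc1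
  have hd1 := S.G.d1pos; have hd6 := S.G.d1lt
  set A := 4 * C / c ^ 2 with hA
  have hA0 : 0 < A := by positivity
  set s0 := min (c * δ / (6 * C) / 2) (1 / (A * C)) with hs0
  have hs00 : 0 < s0 := by positivity
  have hs01 : s0 < c * δ / (6 * C) := (min_le_left).trans_lt (by linarith)
  have hs02 : A * (C * s0) ≤ 1 := by
    have : s0 ≤ 1 / (A * C) := min_le_right
    rw [le_div_iff₀ (by positivity)] at this
    linarith
  have hcd : Continuous fun z : EE n => infDist z Ωᶜ := continuous_infDist_pt _
  obtain ⟨m, hm0, hm⟩ : ∃ m : ℝ, 0 < m ∧ ∀ z ∈ Ω, s0 ≤ infDist z Ωᶜ → PV Ω g z ≠ 0 → PV Ω g z ≤ -m := by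
    have hsub : {z : EE n | s0 ≤ infDist z Ωᶜ} ⊆ Ω := fun z hz => S.G.mem_of_pos (lt_of_lt_of_le hs00 hz)
    have hKc : IsCompact {z : EE n | s0 ≤ infDist z Ωᶜ} :=
      (isCompact_closure_of_bd S.G.bd).of_isClosed_subset (isClosed_le continuous_const hcd)
        (hsub.trans subset_closure)
    have hTc : IsCompact ({z : EE n | s0 ≤ infDist z Ωᶜ} \ {z | z ∈ Ω ∧ PV Ω g z = 0}) := by
      refine hKc.diff ?_
      rw [isOpen_iff_mem_nhds]
      rintro z ⟨hz, hz0⟩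
      filter_upwards [S.zero_open hz hz0, S.G.op.mem_nhds hz] with y h1 h2
      exact ⟨h2, h1⟩
    set T := {z : EE n | s0 ≤ infDist z Ωᶜ} \ {z | z ∈ Ω ∧ PV Ω g z = 0} with hT
    have hmemT : ∀ z ∈ Ω, s0 ≤ infDist z Ωᶜ → PV Ω g z ≠ 0 → z ∈ T := fun z hz h1 h2 => ⟨h1, fun h => h2 h.2⟩
    rcases T.eq_empty_or_nonempty with he | hne
    · exact ⟨1, one_pos, fun z hz h1 h2 => absurd (hmemT z hz h1 h2) (by rw [he]; simp)⟩
    · obtain ⟨z1, hz1, hmx⟩ := hTc.exists_isMaxOn hne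
        (S.cont.mono ((Set.diff_subset.trans hsub).trans subset_closure))
      refine ⟨-PV Ω g z1, ?_, fun z hz h1 h2 => ?_⟩
      · have h2 := S.perr.pv_nonpos (subset_closure (hsub hz1.1))
        have h3 : PV Ω g z1 ≠ 0 := fun h => hz1.2 ⟨hsub hz1.1, h⟩
        have := lt_of_le_of_ne h2 h3
        linarith
      · rw [neg_neg]; exact hmx (hmemT z hz h1 h2)
  set c0 := min (m / (2 * C * s0)) 1 with hc0
  have hc00 : 0 < c0 := by positivity
  have hc0m : c0 * (2 * C * s0) ≤ m := by
    have : c0 ≤ m / (2 * C * s0) := min_le_left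
    rwa [le_div_iff₀ (by positivity)] at this
  have hAr : ∀ z ∈ Ω, infDist z Ωᶜ ≤ s0 → r z ≤ 0 ∧ |r z| ≤ C * s0 ∧ A * |r z| ≤ 1 := by
    intro z hz hd
    have h1 := S.G.r_upper hz (by linarith)
    have h2 := S.G.r_lower hz (by linarith)
    have h3 : C * infDist z Ωᶜ ≤ C * s0 := by gcongr
    have h4 : A * |r z| ≤ A * (C * s0) := by gcongr; linarith
    have := S.G.pos_of_mem hz
    refine ⟨?_, by linarith, by linarith⟩
    have : 0 ≤ c / 2 * infDist z Ωᶜ := by positivity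
    linarith
  refine ⟨c0, s0, hc00, min_le_right, hs00, fun z0 hz0 hdz0 => or_iff_not_imp_left.2 fun hne => ?_⟩
  set ψ : EE n → ℝ := fun z => c0 * (r z + (-A) * r z ^ 2) with hψ
  suffices h : PV Ω g z0 ≤ ψ z0 by
    refine h.trans ?_
    simp only [hψ]
    have : 0 ≤ A * r z0 ^ 2 := by positivity
    gcongr; linarith
  by_contra hcon
  push Not at hcon
  set D : Set (EE n) := {z | z ∈ Ω ∧ PV Ω g z ≠ 0} ∩ {z | infDist z Ωᶜ < s0} with hD
  have hDo : IsOpen D := by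
    refine IsOpen.inter ?_ (isOpen_lt hcd continuous_const)
    rw [isOpen_iff_mem_nhds]
    rintro z ⟨hz, hz0⟩
    have : ContinuousAt (PV Ω g) z := S.cont.continuousAt
        (mem_of_superset (S.G.op.mem_nhds hz) subset_closure)
    filter_upwards [this.eventually_ne hz0, S.G.op.mem_nhds hz] with y h1 h2
    exact ⟨h2, h1⟩
  have hDΩ : D ⊆ Ω := fun z hz => hz.1.1
  have hcl : ∀ z ∈ closure D, z ∈ closure Ω ∧ infDist z Ωᶜ ≤ s0 := by
    intro z hz
    refine ⟨closure_mono hDΩ hz, ?_⟩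
    exact closure_lt_subset_le hcd continuous_const (closure_mono Set.inter_subset_right hz)
  have hball : ∀ z ∈ closure D, ∃ p ∈ frontier Ω, z ∈ ball p δ := by
    intro z hz
    rcases mem_closure_or S.G.op (hcl z hz).1 with h | h
    · obtain ⟨p, hp, hpd⟩ := S.G.nearest h
      refine ⟨p, hp, ?_⟩
      rw [mem_ball_iff_norm, ← hpd]
      linarith [(hcl z hz).2]
    · exact ⟨z, h, mem_ball_self hδ⟩
  have hψc : ContinuousOn ψ (closure D) := by
    have : ContinuousOn r (closure D) := by
      intro z hz
      obtain ⟨p, hp, hzp⟩ := hball z hz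
      exact (S.G.d1 p hp z hzp).continuousAt.continuousWithinAt
    fun_prop
  obtain ⟨z1, hz1, hS⟩ := S.perr.touch_v S.cont hDo hDΩ hψc (z0 := z0) ⟨⟨hz0, hne⟩, hdz0⟩ (m := 0)
    (by linarith) (fun z hz => by
      have hz2 := (hDo.frontier_eq ▸ hz : z ∈ closure D \ D)
      obtain ⟨h1, h2⟩ := hcl z hz2.1
      rcases mem_closure_or S.G.op h1 with h | h
      swap
      · rw [S.pv_zero h]
        simp [hψ, S.G.zero z h]
      have hv0 : PV Ω g z ≠ 0 := by
        intro h0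
        obtain ⟨y, hy1, hy2⟩ := mem_closure_iff_nhds.1 hz2.1 _ (S.zero_open h h0)
        exact hy2.1.2 hy1
      have hd : s0 ≤ infDist z Ωᶜ := not_lt.1 fun h' => hz2.2 ⟨⟨h, hv0⟩, h'⟩
      have h3 := hm z h hd hv0
      obtain ⟨b1, b2, b3⟩ := hAr z h h2
      simp only [hψ]
      have : -(2 * C * s0) ≤ r z + -A * r z ^ 2 := by
        rw [abs_of_nonpos b1] at b2 b3
        nlinarith
      have := mul_le_mul_of_nonneg_left this hc00.le
      linarith)
  obtain ⟨p, hp, hzp⟩ := hball z1 (subset_closure hz1)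
  have hE := S.G.ex2 hp hzp
  have hSub := hS _ _ ((hE.add (hE.sq.const_mul (-A))).const_mul c0)
  have hpos := hSub.lv_nonneg S.G.hn (S.g0 z1 (hDΩ hz1)) (gradV (dr z1))
  obtain ⟨b1, b2, b3⟩ := hAr z1 (hDΩ hz1) hz1.2.le
  simp only [lv_smul, lv_add, lv_sqf, gradV_self] at hpos
  have hlvC : lv (ddr z1) (gradV (dr z1)) ≤ C * ‖gradV (dr z1)‖ ^ 2 / 2 :=
    (lv_le_norm _ _).trans (by have := S.G.ddrC p hp z1 hzp; gcongr)
  have hlv0 : 0 ≤ lv (ddr z1) (gradV (dr z1)) :=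
    le_trans (by positivity) (S.G.levi p hp z1 hzp (gradV (dr z1)))
  have hN : c ^ 2 ≤ ‖gradV (dr z1)‖ ^ 2 := by
    rw [gradV_norm]; have := S.G.drc p hp z1 hzp; gcongr
  set X := ‖gradV (dr z1)‖ ^ 2 with hX
  set Λ := lv (ddr z1) (gradV (dr z1)) with hΛ
  have hX0 : 0 < X := lt_of_lt_of_le (by positivity) hN
  have hAX : 4 * C ≤ A * X := by
    have : A * c ^ 2 = 4 * C := by rw [hA]; field_simp
    rw [← this]; gcongr
  have h5 : Λ + -A * (2 * r z1 * Λ) ≤ 3 * Λ := by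
    rw [abs_of_nonpos b1] at b3
    nlinarith
  have h6 : Λ + -A * (2 * r z1 * Λ) - A * X ^ 2 / 2 < 0 := by
    have : A * X ^ 2 / 2 ≥ 2 * C * X := by nlinarith
    nlinarith
  have h7 : 0 ≤ A * (dr z1 (I • gradV (dr z1))) ^ 2 := by positivity
  have h8 := mul_pos_of_neg_of_neg h6 (neg_neg_of_pos hc00)
  nlinarith [mul_nonneg hc00.le h7]

end P6csec

section P6dsec
open Filter Topology

variable {n : ℕ} {Ω : Set (EE n)} {g r : EE n → ℝ} {dr : EE n → EE n →L[ℝ] ℝ} {ddr : EE n → BF n}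
  {δ c C L A0 R : ℝ}

set_option maxHeartbeats 1600000 in
/-- barrier between two level sets -/
lemma Std.BL (S : Std Ω g r dr ddr δ c C L A0 R) {c0 ρ K : ℝ} (hc0 : 0 < c0)
    (hK : 0 ≤ K) (hρ : 0 < ρ) (hρ' : ρ ≤ c * δ / (24 * C)) :
    ∃ b0 CC : ℝ, 0 < b0 ∧ b0 ≤ 1 ∧ 0 ≤ CC ∧ ∀ p ∈ frontier Ω, ∀ z0 ∈ Ω, ‖z0 - p‖ < ρ / 2 →
      ∀ a b Va Vb : ℝ, 0 ≤ a → a < - r z0 → - r z0 < b → b ≤ b0 → Va ≤ 0 → Vb ≤ 0 →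
      c0 / 2 * (b - a) ≤ Va - Vb →
      (∀ z ∈ closure Ω, ‖z - p‖ < ρ → - r z = a → Va ≤ PV Ω g z + K * (b * ‖z - z0‖ + b ^ 2)) →
      (∀ z ∈ closure Ω, ‖z - p‖ < ρ → - r z = b → Vb ≤ PV Ω g z + K * (b * ‖z - z0‖ + b ^ 2)) →
      Vb + (Va - Vb) / (b - a) * (b + r z0) - CC * b ^ 2 ≤ PV Ω g z0 := by
  have hc := S.G.hc; have hC := S.G.hC; have hδ := S.G.hδ; have hc1 := S.G.hc1
  have hL := S.hL; have hA0 := S.hA0; have hd6 := S.G.d1lt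
  have h24 : c * δ / (24 * C) = c * δ / (6 * C) / 4 := by field_simp; norm_num
  have hρδ : ρ < δ := by linarith
  have hρ6 : ρ < c * δ / (6 * C) := by linarith [S.G.d1pos]
  obtain ⟨M, hM0, hM⟩ := barrier_lin S.G.hn (c1 := c * c0 / 8) (c := c) (C := C) (G := L)
    (by positivity) hc (by linarith)
  set lam := c * c0 / 8 with hlam
  have hlam0 : 0 < lam := by positivity
  set N := 2 * M with hN
  set q := 2 * A0 / (c * lam) with hq
  have hq0 : 0 < q := by positivity
  set C' := K + K ^ 2 / (4 * lam) with hC'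
  have hC'0 : 0 ≤ C' := by positivity
  set b0 := min (min 1 (c0 / (4 * (N + 1)))) (ρ ^ 2 / (16 * q)) with hb0
  have hN0 : 0 ≤ N := by positivity
  refine ⟨b0, N + C', by positivity, (min_le_left).trans (min_le_left), by positivity, ?_⟩
  intro p hp z0 hz0 hz0p a b Va Vb ha has hsb hbb0 hVa hVb hsl Ha Hb
  have hb : 0 < b := by linarith
  have hab : a < b := by linarith
  have hNb : N * b ≤ c0 / 4 := by
    have : b ≤ c0 / (4 * (N + 1)) := hbb0.trans ((min_le_left).trans (min_le_right))
    rw [le_div_iff₀ (by positivity)] at this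
    linarith
  set θ := Real.sqrt (q * b) with hθ
  have hθ2 : θ ^ 2 = q * b := Real.sq_sqrt (by positivity)
  have hθ0 : 0 < θ := Real.sqrt_pos.2 (by positivity)
  have hθρ : θ ≤ ρ / 4 := by
    have : b ≤ ρ ^ 2 / (16 * q) := hbb0.trans (min_le_right)
    rw [le_div_iff₀ (by positivity)] at this
    rw [hθ]
    apply Real.sqrt_le_iff.2
    constructor
    · positivity
    · linarith
  have hlθ : lam * θ ^ 2 = 2 * A0 / c * b := by rw [hθ2, hq]; field_simp
  set β := (Va - Vb) / (b - a) with hβ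
  have hβ0 : c0 / 2 ≤ β := by rw [hβ, le_div_iff₀ (by linarith)]; exact hsl
  have hβab : β * (b - a) = Va - Vb := by rw [hβ]; field_simp [show b - a ≠ 0 by linarith]
  have hzp : ∀ z, ‖z - z0‖ ≤ θ → ‖z - p‖ < ρ := by
    intro z hz
    have : z - p = (z - z0) + (z0 - p) := by abel
    rw [this]; exact lt_of_le_of_lt (norm_add_le _ _) (by linarith)
  have hzb : ∀ z, ‖z - z0‖ ≤ θ → z ∈ ball p δ := fun z hz => by
    rw [mem_ball_iff_norm]; linarith [hzp z hz]
  have hrc : ∀ z, ‖z - z0‖ ≤ θ → ContinuousAt r z := fun z hz =>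
    (S.G.d1 p hp z (hzb z hz)).continuousAt
  set D : Set (EE n) := {z | (z ∈ Ω ∧ z ∈ ball z0 θ) ∧ a < - r z ∧ - r z < b} with hD
  have hDo : IsOpen D := by
    rw [isOpen_iff_mem_nhds]
    rintro z ⟨⟨h1, h2⟩, h3, h4⟩
    have hcz := (hrc z (mem_ball_iff_norm.1 h2).le).neg
    filter_upwards [S.G.op.mem_nhds h1, isOpen_ball.mem_nhds h2, hcz.eventually (eventually_gt_nhds h3),
      hcz.eventually (eventually_lt_nhds h4)] with y h5 h6 h7 h8
    exact ⟨⟨h5, h6⟩, h7, h8⟩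
  have hDΩ : D ⊆ Ω := fun z hz => hz.1.1
  have hcl : ∀ z ∈ closure D, z ∈ closure Ω ∧ ‖z - z0‖ ≤ θ ∧ a ≤ - r z ∧ - r z ≤ b := by
    intro z hz
    have h1 : ‖z - z0‖ ≤ θ := by
      have : z ∈ closedBall z0 θ := closure_ball_subset_closedBall
        (closure_mono (fun y (hy : y ∈ D) => hy.1.2) hz)
      rwa [mem_closedBall_iff_norm] at this
    have hcz := (hrc z h1).neg
    refine ⟨closure_mono hDΩ hz, h1, ?_, ?_⟩
    · by_contra h
      push Not at h
      obtain ⟨y, hy1, hy2⟩ := mem_closure_iff_nhds.1 hz _ (hcz.eventually (eventually_lt_nhds h))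
      have h1 : - r y < a := hy1
      have h2 := hy2.2.1
      linarith
    · by_contra h
      push Not at h
      obtain ⟨y, hy1, hy2⟩ := mem_closure_iff_nhds.1 hz _ (hcz.eventually (eventually_gt_nhds h))
      have h1 : b < - r y := hy1
      have h2 := hy2.2.2
      linarith
  have hamgm : ∀ t : ℝ, K * (b * t + b ^ 2) ≤ lam * t ^ 2 + C' * b ^ 2 := by
    intro t
    have h1 : 0 ≤ lam * (t - K * b / (2 * lam)) ^ 2 := by positivity
    have h2 : lam * (t - K * b / (2 * lam)) ^ 2 = lam * t ^ 2 - K * b * t + K ^ 2 / (4 * lam) * b ^ 2 := by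
      field_simp; ring
    rw [hC']; linarith
  have key := S.perr.comparison S.cont hDo hDΩ
    (w := fun z => (((β + N * (a + b)) * r z + N * r z ^ 2) + (-lam) * ‖z - z0‖ ^ 2)
      + (Vb + β * b + N * (a * b) - C' * b ^ 2))
    (by
      have : ContinuousOn r (closure D) := fun z hz => (hrc z (hcl z hz).2.1).continuousWithinAt
      fun_prop)
    (fun z hz => by
      obtain ⟨⟨h1, h2⟩, h3, h4⟩ := hz
      have h2' := (mem_ball_iff_norm.1 h2).le
      have hE := S.G.ex2 hp (hzb z h2')
      refine IsSubAt.mono' (γ := L) ⟨_, _, ((((hE.const_mul (β + N * (a + b))).add (hE.sq.const_mul N)).add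
        ((Ex2.normsq z0 z).const_mul (-lam))).add_const _).ls, ?_⟩ (S.gB z h1)
      refine hM M le_rfl _ (dr z) (S.G.drc p hp z (hzb z h2')) (S.G.drC p hp z (hzb z h2')) fun w => ?_
      simp only [lv_add, lv_smul, lv_ip, lv_sqf]
      have h5 := S.G.levi p hp z (hzb z h2') w
      have h6 : c0 / 4 ≤ β + N * (a + b) + N * (2 * r z) := by
        have := mul_nonneg hN0 (show 0 ≤ 2 * r z + a + b + b by linarith)
        linarith
      have h7 : c0 / 4 * (c * ‖w‖ ^ 2) ≤ (β + N * (a + b) + N * (2 * r z)) * lv (ddr z) w :=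
        mul_le_mul h6 h5 (by positivity) (by linarith)
      rw [hN] at h7 ⊢
      rw [hlam]
      linarith)
    (fun z hz => by
      have hz2 := (hDo.frontier_eq ▸ hz : z ∈ closure D \ D)
      obtain ⟨h1, h2, h3, h4⟩ := hcl z hz2.1
      have ht := hamgm ‖z - z0‖
      have hr := S.pv_r hp h1 ((hzp z h2).trans hρ6)
      show (((β + N * (a + b)) * r z + N * r z ^ 2) + (-lam) * ‖z - z0‖ ^ 2)
        + (Vb + β * b + N * (a * b) - C' * b ^ 2) ≤ PV Ω g z
      have e : (((β + N * (a + b)) * r z + N * r z ^ 2) + (-lam) * ‖z - z0‖ ^ 2)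
        + (Vb + β * b + N * (a * b) - C' * b ^ 2) =
        Vb + β * (b + r z) + N * ((r z + a) * (r z + b)) - lam * ‖z - z0‖ ^ 2 - C' * b ^ 2 := by ring
      rw [e]
      by_cases ha' : - r z = a
      · have := Ha z h1 (hzp z h2) ha'
        have e1 : r z = -a := by linarith
        rw [e1]
        have : β * (b + -a) = Va - Vb := by rw [← hβab]; ring
        linarith
      by_cases hb' : - r z = b
      · have := Hb z h1 (hzp z h2) hb'
        have e1 : r z = -b := by linarith
        rw [e1]
        linarith
      have h3' : a < - r z := lt_of_le_of_ne h3 (Ne.symm ha')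
      have h4' : - r z < b := lt_of_le_of_ne h4 hb'
      have hzΩ : z ∈ Ω := by
        rcases mem_closure_or S.G.op h1 with h | h
        · exact h
        · rw [S.G.zero z h] at h3'; linarith
      have hzθ : ‖z - z0‖ = θ := by
        refine le_antisymm h2 (not_lt.1 fun hlt => hz2.2 ⟨⟨hzΩ, ?_⟩, h3', h4'⟩)
        rwa [mem_ball_iff_norm]
      rw [hzθ, hlθ]
      have h5 : β * (b + r z) ≤ β * (b - a) := by
        apply mul_le_mul_of_nonneg_left _ (by linarith); linarith
      have h6 : N * ((r z + a) * (r z + b)) ≤ 0 :=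
        mul_nonpos_of_nonneg_of_nonpos hN0 (mul_nonpos_of_nonpos_of_nonneg (by linarith) (by linarith))
      have h7 : 2 * A0 / c * |r z| ≤ 2 * A0 / c * b := by
        rw [abs_of_nonpos hr.1]; gcongr
      have h8 : 0 ≤ C' * b ^ 2 := by positivity
      linarith [hr.2]) z0 ⟨⟨hz0, mem_ball_self hθ0⟩, has, hsb⟩
  simp only [sub_self, norm_zero] at key
  have h9 : -(b ^ 2) ≤ (r z0 + a) * (r z0 + b) := by
    have := mul_le_mul (show -(r z0 + a) ≤ b by linarith) (show r z0 + b ≤ b by linarith)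
      (by linarith) hb.le
    linarith
  have h10 := mul_le_mul_of_nonneg_left h9 hN0
  linarith

end P6dsec

section P6esec
open Filter Topology

variable {n : ℕ} {Ω : Set (EE n)} {g r : EE n → ℝ} {dr : EE n → EE n →L[ℝ] ℝ} {ddr : EE n → BF n}
  {δ c C L A0 R : ℝ}

set_option maxHeartbeats 1600000 in
lemma Std.B2 (S : Std Ω g r dr ddr δ c C L A0 R) {C1 : ℝ} (hC1 : 1 ≤ C1) :
    ∃ ρ b1 CC : ℝ, 0 < ρ ∧ 0 < b1 ∧ 0 ≤ CC ∧ ∀ p ∈ frontier Ω, ∀ z0 ∈ Ω, ∀ xa ∈ Ω, ∀ xb ∈ Ω,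
      ‖z0 - p‖ < ρ → ‖xa - p‖ < ρ → ‖xb - p‖ < ρ → ∀ a b h : ℝ, 0 ≤ a → 0 ≤ h → a = - r z0 - h →
      b = - r z0 + h → b ≤ b1 → ‖xa - z0‖ ≤ C1 * b → ‖xb - z0‖ ≤ C1 * b →
      |- r xa - a| ≤ C1 * b ^ 2 → |- r xb - b| ≤ C1 * b ^ 2 →
      PV Ω g xa + PV Ω g xb ≤ 2 * PV Ω g z0 + CC * b ^ 2 := by
  have hc := S.G.hc; have hC := S.G.hC; have hδ := S.G.hδ; have hc1 := S.G.hc1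
  have hd6 := S.G.d1lt
  have h24 : c * δ / (24 * C) = c * δ / (6 * C) / 4 := by field_simp; norm_num
  obtain ⟨ρA, KA, hρA, hKA, hρA', hA⟩ := S.estA
  obtain ⟨d0, hd0, hZ⟩ := S.zero_unif
  obtain ⟨c0, s0, hc0, hc01, hs0, hH⟩ := S.hopf_bd
  have hρδ : ρA < δ := by linarith
  have hρ6 : ρA < c * δ / (6 * C) := by linarith [S.G.d1pos]
  set K := KA * (1 + 4 * C1) with hK
  have hK0 : 0 ≤ K := by positivity
  obtain ⟨b0, CB, hb0, hb01, hCB, hBL⟩ := S.BL (c0 := c0) hc0 hK0 hρA hρA'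
  set ρ := min (ρA / 2) s0 with hρ
  have hρ1 : ρ ≤ ρA / 2 := min_le_left
  have hρ2 : ρ ≤ s0 := min_le_right
  -- B0
  have hB0 : ∀ p ∈ frontier Ω, ∀ z0 ∈ Ω, ∀ xb ∈ Ω, ‖z0 - p‖ < ρ → ‖xb - p‖ < ρ → ∀ b : ℝ, b = - r xb →
      - r z0 < b → b ≤ b0 → ‖xb - z0‖ ≤ 4 * C1 * b → PV Ω g xb ≠ 0 →
      (- r z0 / b) * PV Ω g xb - CB * b ^ 2 ≤ PV Ω g z0 := by
    intro p hp z0 hz0 xb hxb hz0p hxbp b hb hzb hbb hxz hne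
    have hz0b : z0 ∈ ball p δ := by rw [mem_ball_iff_norm]; linarith
    have hrz0 := (S.G.mem p hp z0 hz0b).1 hz0
    have hbpos : 0 < b := by linarith
    have h1 := (hH xb hxb ((S.G.infDist_le hp).trans_lt (by linarith))).resolve_left hne
    have h2 := hBL p hp z0 hz0 (by linarith) 0 b 0 (PV Ω g xb) le_rfl (by linarith) hzb hbb le_rfl
      (S.perr.pv_nonpos (subset_closure hxb)) (by
        have : r xb = - b := by linarith
        rw [this] at h1
        have := mul_pos hc0 hbpos
        linarith)
      (fun z hz hzp hrz => by
        have h3 := (S.pv_r hp hz (hzp.trans hρ6)).2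
        have h4 : r z = 0 := by linarith
        rw [h4, abs_zero, mul_zero] at h3
        have : 0 ≤ K * (b * ‖z - z0‖ + b ^ 2) := by positivity
        linarith)
      (fun z hz hzp hrz => by
        have hzΩ : z ∈ Ω := (S.G.mem p hp z (by rw [mem_ball_iff_norm]; linarith)).2 (by linarith)
        have h3 := hA p hp z hzΩ xb hxb hzp (by linarith)
        have h4 : r z - r xb = 0 := by linarith
        have h5 : |r z| = b := by rw [← hrz, abs_of_nonpos (by linarith)]
        rw [h4, h5, abs_zero, add_zero] at h3
        have h6 : ‖z - xb‖ ≤ ‖z - z0‖ + 4 * C1 * b := by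
          have : z - xb = (z - z0) - (xb - z0) := by abel
          rw [this]; exact (norm_sub_le _ _).trans (by linarith)
        have h7 : ‖z - xb‖ * b ≤ (1 + 4 * C1) * (b * ‖z - z0‖ + b ^ 2) := by
          have h8 := mul_le_mul_of_nonneg_right h6 hbpos.le
          have h9 : 0 ≤ C1 * (b * ‖z - z0‖) := by positivity
          have h9' : 0 ≤ C1 * b ^ 2 := by positivity
          have h9'' : 0 ≤ b ^ 2 := by positivity
          linarith
        have := mul_le_mul_of_nonneg_left h7 (show 0 ≤ KA by linarith)
        rw [hK]; linarith)
    refine le_trans (le_of_eq ?_) h2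
    rw [sub_zero, zero_sub]
    field_simp
    ring
  set b1 := min (b0 / 2) (min (d0 / (4 * C1)) (1 / (2 * C1))) with hb1
  set C2 := 2 * C1 + 4 * CB / c0 with hC2
  have hC20 : 0 ≤ C2 := by positivity
  refine ⟨ρ, b1, 2 * CB + 2 * KA * (2 * C1 + C2), by positivity, by positivity, by positivity, ?_⟩
  intro p hp z0 hz0 xa hxa xb hxb hz0p hxap hxbp a b h ha hh hea heb hbb hxaz hxbz hra hrb
  have hbb0 : b ≤ b0 / 2 := hbb.trans min_le_left
  have hbd0 : 4 * C1 * b ≤ d0 := by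
    have : b ≤ d0 / (4 * C1) := hbb.trans ((min_le_right).trans min_le_left)
    rw [le_div_iff₀ (by positivity)] at this; linarith
  have hbC1 : C1 * b ≤ 1 / 2 := by
    have : b ≤ 1 / (2 * C1) := hbb.trans ((min_le_right).trans min_le_right)
    rw [le_div_iff₀ (by positivity)] at this; linarith
  have hball : ∀ z, ‖z - p‖ < ρ → z ∈ ball p δ := fun z hz => by rw [mem_ball_iff_norm]; linarith
  have hrz0 := (S.G.mem p hp z0 (hball _ hz0p)).1 hz0
  have hrxa := (S.G.mem p hp xa (hball _ hxap)).1 hxa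
  have hbpos : 0 < b := by linarith
  have hb2 : 0 ≤ b ^ 2 := by positivity
  by_cases hhs : h ≤ C2 * b ^ 2
  · have ha1 := hA p hp z0 hz0 xa hxa (by linarith) (by linarith)
    have hb1' := hA p hp z0 hz0 xb hxb (by linarith) (by linarith)
    rw [norm_sub_rev, abs_of_neg hrz0] at ha1 hb1'
    have e1 : |r z0 - r xa| ≤ h + C1 * b ^ 2 := by
      rw [abs_le] at hra ⊢; constructor <;> linarith [hra.1, hra.2]
    have e2 : |r z0 - r xb| ≤ h + C1 * b ^ 2 := by
      rw [abs_le] at hrb ⊢; constructor <;> linarith [hrb.1, hrb.2]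
    have e3 : ‖xa - z0‖ * -r z0 ≤ C1 * b * b := mul_le_mul hxaz (by linarith) (by linarith) (by positivity)
    have e4 : ‖xb - z0‖ * -r z0 ≤ C1 * b * b := mul_le_mul hxbz (by linarith) (by linarith) (by positivity)
    have e5 : ‖xa - z0‖ * -r z0 + |r z0 - r xa| ≤ (2 * C1 + C2) * b ^ 2 := by linarith
    have e6 : ‖xb - z0‖ * -r z0 + |r z0 - r xb| ≤ (2 * C1 + C2) * b ^ 2 := by linarith
    have e7 := mul_le_mul_of_nonneg_left e5 (show 0 ≤ KA by linarith)
    have e8 := mul_le_mul_of_nonneg_left e6 (show 0 ≤ KA by linarith)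
    have e9 : 0 ≤ CB * b ^ 2 := by positivity
    linarith
  push Not at hhs
  have hpva := S.perr.pv_nonpos (subset_closure hxa)
  have hpvb := S.perr.pv_nonpos (subset_closure hxb)
  have hCpos : 0 ≤ (2 * CB + 2 * KA * (2 * C1 + C2)) * b ^ 2 := by positivity
  have hh0 : 0 < h := lt_of_le_of_lt (by positivity) hhs
  by_cases hvb : PV Ω g xb = 0
  · have := hZ xb hxb z0 hz0 (by linarith) hvb
    linarith
  set b' := - r xb with hb'
  have hC1b2 : C1 * b ^ 2 ≤ b / 2 := by
    have := mul_le_mul_of_nonneg_right hbC1 hbpos.le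
    linarith
  have hb'l : b / 2 ≤ b' := by have := (abs_le.1 hrb).1; linarith
  have hb'u : b' ≤ 2 * b := by have := (abs_le.1 hrb).2; linarith
  have hC2b : C2 * b ^ 2 = 2 * C1 * b ^ 2 + 4 * CB * b ^ 2 / c0 := by rw [hC2]; ring
  have hCc : 0 ≤ 4 * CB * b ^ 2 / c0 := by positivity
  have hab' : 2 * h - 2 * C1 * b ^ 2 ≤ b' - (- r xa) := by
    have := (abs_le.1 hrb).1; have := (abs_le.1 hra).2; linarith
  have h1 := hB0 p hp xa hxa xb hxb hxap hxbp b' rfl (by linarith) (by linarith) (by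
    have : xb - xa = (xb - z0) - (xa - z0) := by abel
    rw [this]; refine (norm_sub_le _ _).trans ?_
    have := mul_le_mul_of_nonneg_left hb'l (show 0 ≤ C1 by linarith)
    linarith) hvb
  have hvb' := (hH xb hxb ((S.G.infDist_le hp).trans_lt (by linarith))).resolve_left hvb
  have hsl : c0 / 2 * (b - a) ≤ PV Ω g xa - PV Ω g xb := by
    have hb'0 : 0 < b' := by linarith
    have e1 : (- r xa / b') * PV Ω g xb = PV Ω g xb - (b' - (- r xa)) * (PV Ω g xb / b') := by
      field_simp; ring
    have e2 : PV Ω g xb / b' ≤ - c0 := by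
      rw [div_le_iff₀ hb'0]; rw [hb']; linarith
    have e3 : 0 ≤ b' - (- r xa) := by linarith
    have e4 : (b' - (- r xa)) * c0 ≤ (b' - (- r xa)) * (-(PV Ω g xb / b')) := by gcongr; linarith
    have e5 : CB * b' ^ 2 ≤ 4 * CB * b ^ 2 := by
      have : b' ^ 2 ≤ (2 * b) ^ 2 := by gcongr
      have := mul_le_mul_of_nonneg_left this hCB
      linarith
    have e6 : (2 * h - 2 * C1 * b ^ 2) * c0 ≤ (b' - (- r xa)) * c0 := by gcongr
    have e7 : c0 * (2 * C1 * b ^ 2 + 4 * CB * b ^ 2 / c0) ≤ c0 * h := by gcongr; linarith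
    have e8 : c0 * (2 * C1 * b ^ 2 + 4 * CB * b ^ 2 / c0) = c0 * (2 * C1 * b ^ 2) + 4 * CB * b ^ 2 := by
      field_simp
    have e9 : b - a = 2 * h := by linarith
    rw [e9]
    linarith
  -- common estimate
  have hest : ∀ x ∈ Ω, ‖x - p‖ < ρ → ‖x - z0‖ ≤ C1 * b → ∀ s : ℝ, 0 ≤ s → s ≤ b → |- r x - s| ≤ C1 * b ^ 2 →
      ∀ z ∈ closure Ω, ‖z - p‖ < ρA → - r z = s → PV Ω g x ≤ PV Ω g z + K * (b * ‖z - z0‖ + b ^ 2) := by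
    intro x hx hxp hxz s hs0' hsb hxs z hz hzp hzs
    rcases mem_closure_or S.G.op hz with hz' | hz'
    swap
    · rw [S.pv_zero hz']
      have := S.perr.pv_nonpos (subset_closure hx)
      have : 0 ≤ K * (b * ‖z - z0‖ + b ^ 2) := by positivity
      linarith
    have h3 := hA p hp z hz' x hx hzp (by linarith)
    have h4 : |r z| = s := by rw [← hzs, abs_of_nonpos (by linarith)]
    have h5 : |r z - r x| ≤ C1 * b ^ 2 := by
      rw [abs_le] at hxs ⊢; constructor <;> linarith [hxs.1, hxs.2]
    have h6 : ‖z - x‖ ≤ ‖z - z0‖ + C1 * b := by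
      have : z - x = (z - z0) - (x - z0) := by abel
      rw [this]; exact (norm_sub_le _ _).trans (by linarith)
    have h7 : ‖z - x‖ * |r z| ≤ (‖z - z0‖ + C1 * b) * b := by
      rw [h4]; exact mul_le_mul h6 hsb hs0' (by positivity)
    have h8 : ‖z - x‖ * |r z| + |r z - r x| ≤ (1 + 4 * C1) * (b * ‖z - z0‖ + b ^ 2) := by
      have h9 : 0 ≤ C1 * (b * ‖z - z0‖) := by positivity
      have h9' : 0 ≤ C1 * b ^ 2 := by positivity
      have h9'' : 0 ≤ b ^ 2 := by positivity
      linarith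
    have := mul_le_mul_of_nonneg_left h8 (show 0 ≤ KA by linarith)
    rw [hK]; linarith
  have h2 := hBL p hp z0 hz0 (by linarith) a b (PV Ω g xa) (PV Ω g xb) ha (by linarith) (by linarith)
    (by linarith) hpva hpvb hsl (hest xa hxa hxap hxaz a ha (by linarith) hra)
    (hest xb hxb hxbp hxbz b hbpos.le le_rfl hrb)
  have e1 : (PV Ω g xa - PV Ω g xb) / (b - a) * (b + r z0) = (PV Ω g xa - PV Ω g xb) / 2 := by
    have e9 : b - a = 2 * h := by linarith
    have e10 : b + r z0 = h := by linarith
    rw [e9, e10]; field_simp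
  rw [e1] at h2
  have e3 : 0 ≤ 2 * KA * (2 * C1 + C2) * b ^ 2 := by positivity
  linarith

end P6esec

section P6fsec
open Filter Topology

variable {n : ℕ} {Ω : Set (EE n)} {g r : EE n → ℝ} {dr : EE n → EE n →L[ℝ] ℝ} {ddr : EE n → BF n}
  {δ c C L A0 R : ℝ}

lemma infDist_sub_le (s : Set (EE n)) (x y : EE n) : infDist x s ≤ infDist y s + ‖x - y‖ := by
  rw [← dist_eq_norm]; exact infDist_le_infDist_add_dist

set_option maxHeartbeats 1600000 in
/-- second differences comparable to the distance to the boundary -/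
lemma Std.sd_bd (S : Std Ω g r dr ddr δ c C L A0 R) :
    ∃ d2 CC : ℝ, 0 < d2 ∧ 0 ≤ CC ∧ ∀ z0 ∈ Ω, infDist z0 Ωᶜ < d2 → ∀ τ : EE n,
      2 * ‖τ‖ ≤ infDist z0 Ωᶜ → PV Ω g (z0 + τ) + PV Ω g (z0 - τ) ≤ 2 * PV Ω g z0 + CC * infDist z0 Ωᶜ ^ 2 := by
  have hc := S.G.hc; have hC := S.G.hC; have hδ := S.G.hδ; have hc1 := S.G.hc1
  have hd6 := S.G.d1lt; have hd1 := S.G.d1pos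
  set C1 := 4 * C / c ^ 2 with hC1
  have hc2 : c ^ 2 ≤ 1 := pow_le_one₀ hc.le hc1
  have hC11 : 1 ≤ C1 := by rw [hC1, le_div_iff₀ (by positivity)]; linarith
  obtain ⟨ρ, b1, CC, hρ, hb1, hCC, hB⟩ := S.B2 hC11
  set d2 := min (min (c * δ / (6 * C) / 2) (ρ / 2)) (min (b1 / (2 * C)) (c / C)) with hd2
  refine ⟨d2, CC * (2 * C) ^ 2, by positivity, by positivity, ?_⟩
  intro z0 hz0 hd
  have hda : infDist z0 Ωᶜ < c * δ / (6 * C) / 2 := hd.trans_le ((min_le_left).trans min_le_left)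
  have hdb : infDist z0 Ωᶜ < ρ / 2 := hd.trans_le ((min_le_left).trans min_le_right)
  have hdc : infDist z0 Ωᶜ * (2 * C) < b1 := by
    have : infDist z0 Ωᶜ < b1 / (2 * C) := hd.trans_le ((min_le_right).trans min_le_left)
    rwa [lt_div_iff₀ (by positivity)] at this
  have hdd : infDist z0 Ωᶜ * C < c := by
    have : infDist z0 Ωᶜ < c / C := hd.trans_le ((min_le_right).trans min_le_right)
    rwa [lt_div_iff₀ (by positivity)] at this
  obtain ⟨p, hp, hpd⟩ := S.G.nearest hz0
  have hs1 := S.G.r_lower hz0 (by linarith)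
  have hs2 := S.G.r_upper hz0 (by linarith)
  have hdpos := S.G.pos_of_mem hz0
  set d := infDist z0 Ωᶜ with hddef
  have hcd := mul_pos hc hdpos
  rw [abs_of_nonpos (by linarith)] at hs2
  have main : ∀ τ : EE n, 2 * ‖τ‖ ≤ d → 0 ≤ dr z0 τ →
      PV Ω g (z0 + τ) + PV Ω g (z0 - τ) ≤ 2 * PV Ω g z0 + CC * (2 * C) ^ 2 * d ^ 2 := by
    intro τ hτ hτ0
    have hz0b : z0 ∈ ball p δ := by rw [mem_ball_iff_norm]; linarith
    have hgen : ∀ σ : EE n, ‖σ‖ = ‖τ‖ → z0 + σ ∈ Ω ∧ ‖z0 + σ - p‖ < ρ ∧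
        |r (z0 + σ) - r z0 - dr z0 σ| ≤ C * ‖τ‖ ^ 2 ∧ c / 4 * d ≤ - r (z0 + σ) := by
      intro σ hσ
      have h1 := infDist_sub_le Ωᶜ (z0 + σ) z0
      have h2 := infDist_sub_le Ωᶜ z0 (z0 + σ)
      rw [add_sub_cancel_left, hσ] at h1
      rw [sub_add_cancel_left, norm_neg, hσ] at h2
      have h3 : z0 + σ ∈ Ω := S.G.mem_of_pos (by linarith)
      have h4 : ‖z0 + σ - p‖ ≤ d + ‖τ‖ := by
        have : z0 + σ - p = (z0 - p) + σ := by abel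
        rw [this, hpd, ← hσ]; exact norm_add_le _ _
      refine ⟨h3, by linarith, ?_, ?_⟩
      · have := S.G.taylor1 hp hz0b (y := z0 + σ) (by rw [mem_ball_iff_norm]; linarith)
        rwa [add_sub_cancel_left, hσ] at this
      · have h5 := S.G.r_lower h3 (by linarith)
        have h6 : c / 2 * (d / 2) ≤ c / 2 * infDist (z0 + σ) Ωᶜ := by gcongr; linarith
        linarith
    obtain ⟨ha1, ha2, ha3, ha4⟩ := hgen τ rfl
    obtain ⟨hb1', hb2, hb3, hb4⟩ := hgen (-τ) (norm_neg _)
    rw [← sub_eq_add_neg] at hb1' hb2 hb3 hb4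
    rw [map_neg] at hb3
    have hdrτ : dr z0 τ ≤ C * ‖τ‖ := by
      refine (le_abs_self _).trans (((dr z0).le_opNorm τ).trans ?_)
      gcongr; exact S.G.drC p hp z0 hz0b
    have hτ2 : ‖τ‖ ^ 2 ≤ (d / 2) ^ 2 := by gcongr; linarith
    have hCτ2 : C * ‖τ‖ ^ 2 ≤ C * (d / 2) ^ 2 := by gcongr
    have hCd : C * (d / 2) ^ 2 ≤ c / 4 * d := by
      have := mul_le_mul_of_nonneg_right hdd.le hdpos.le
      linarith
    set b := - r z0 + dr z0 τ with hbdef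
    have hbd : c / 2 * d ≤ b := by linarith
    have hCτ : C * ‖τ‖ ≤ C * (d / 2) := by gcongr; linarith
    have hbu : b ≤ 2 * C * d := by
      have : 0 ≤ C * d := by positivity
      linarith
    have hb0 : 0 < b := by linarith
    have hC1b : d / 2 ≤ C1 * b := by
      have h1 : C1 * (c / 2 * d) ≤ C1 * b := by gcongr
      have h2 : C1 * (c / 2 * d) = 2 * C / c * d := by rw [hC1]; field_simp; norm_num
      have h3 : 1 ≤ 2 * C / c := by rw [le_div_iff₀ hc]; linarith
      have := mul_le_mul_of_nonneg_right h3 hdpos.le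
      linarith
    have hC1b2 : C * (d / 2) ^ 2 ≤ C1 * b ^ 2 := by
      have h1 : C1 * (c / 2 * d) ^ 2 ≤ C1 * b ^ 2 := by gcongr
      have h2 : C1 * (c / 2 * d) ^ 2 = C * d ^ 2 := by rw [hC1]; field_simp; norm_num
      have h3 : 0 ≤ C * d ^ 2 := by positivity
      linarith
    rw [abs_le] at ha3 hb3
    have key := hB p hp z0 hz0 (z0 + τ) ha1 (z0 - τ) hb1' (by rw [← hpd]; linarith) ha2 hb2
      (- r z0 - dr z0 τ) b (dr z0 τ) (by linarith [ha3.1]) hτ0 rfl rfl (by linarith)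
      (by rw [add_sub_cancel_left]; linarith) (by rw [sub_sub_cancel_left, norm_neg]; linarith)
      (by rw [abs_le]; constructor <;> linarith [ha3.1, ha3.2])
      (by rw [abs_le]; constructor <;> linarith [hb3.1, hb3.2])
    refine key.trans ?_
    have h1 : b ^ 2 ≤ (2 * C * d) ^ 2 := by gcongr
    have h2 := mul_le_mul_of_nonneg_left h1 hCC
    linarith
  intro τ hτ
  rcases (le_total : (0:ℝ) ≤ dr z0 τ ∨ dr z0 τ ≤ 0) with h | h
  · exact main τ hτ h
  · have := main (-τ) (by rwa [norm_neg]) (by rw [map_neg]; linarith)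
    rw [sub_neg_eq_add, ← sub_eq_add_neg] at this
    linarith

set_option maxHeartbeats 1600000 in
/-- upper second difference bound -/
lemma Std.sd_upper (S : Std Ω g r dr ddr δ c C L A0 R) :
    ∃ CC : ℝ, 0 ≤ CC ∧ ∀ z τ : EE n, 2 * ‖τ‖ < infDist z Ωᶜ →
      PV Ω g (z + τ) + PV Ω g (z - τ) ≤ 2 * PV Ω g z + CC * ‖τ‖ ^ 2 := by
  obtain ⟨d2, CB, hd2, hCB, hB⟩ := S.sd_bd
  have hL := S.hL; have hA0 := S.hA0; have hR := S.hR
  set K1 := L * R ^ 2 + A0 with hK1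
  refine ⟨L * R ^ 2 + 4 * CB + 4 * K1 / d2, by positivity, fun z τ hzτ => ?_⟩
  set t := ‖τ‖ with ht
  have ht0 : 0 ≤ t := norm_nonneg _
  have hmem : ∀ y σ : EE n, 2 * t ≤ infDist y Ωᶜ → 0 < t → ‖σ‖ = t → y + σ ∈ Ω := by
    intro y σ h1 h0 h2
    have := infDist_sub_le Ωᶜ y (y + σ)
    rw [sub_add_cancel_left, norm_neg, h2] at this
    exact S.G.mem_of_pos (by linarith)
  have hzΩ : z ∈ Ω := S.G.mem_of_pos (by linarith)
  rcases ht0.eq_or_lt with h0 | htpos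
  · have : τ = 0 := by rw [ht] at h0; exact norm_eq_zero.1 h0.symm
    rw [this, ← h0, add_zero, sub_zero]; linarith
  have hK2 : 0 ≤ 4 * K1 / d2 * t ^ 2 := by positivity
  have hLR : 0 ≤ L * R ^ 2 * t ^ 2 := by positivity
  have hCBt : 0 ≤ CB * t ^ 2 := by positivity
  rcases le_or_gt d2 (2 * t) with hbig | hsmall
  · have h1 := S.lip (subset_closure hzΩ) (subset_closure (hmem z τ hzτ.le htpos rfl))
    have h2 := S.lip (subset_closure hzΩ) (subset_closure (hmem z (-τ) hzτ.le htpos (norm_neg _)))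
    rw [← sub_eq_add_neg] at h2
    rw [add_sub_cancel_left] at h1
    rw [sub_sub_cancel_left, norm_neg] at h2
    have h3 : 2 * (K1 * t) ≤ 4 * K1 / d2 * t ^ 2 := by
      have h4 : 1 ≤ 2 * t / d2 := by rw [le_div_iff₀ hd2]; linarith
      have h5 := mul_le_mul_of_nonneg_left h4 (show 0 ≤ 2 * (K1 * t) by positivity)
      have h6 : 2 * (K1 * t) * (2 * t / d2) = 4 * K1 / d2 * t ^ 2 := by ring
      linarith
    linarith
  have hcd : Continuous fun z : EE n => infDist z Ωᶜ := continuous_infDist_pt _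
  set D : Set (EE n) := {y | 2 * t < infDist y Ωᶜ} with hD
  have hDo : IsOpen D := isOpen_lt continuous_const hcd
  have hDΩ : D ⊆ Ω := fun y (hy : 2 * t < infDist y Ωᶜ) => S.G.mem_of_pos (by linarith)
  have hcl : ∀ y ∈ closure D, 2 * t ≤ infDist y Ωᶜ := fun y hy =>
    closure_lt_subset_le continuous_const hcd hy
  have main : ∀ u ∈ SS Ω g, 1 / 2 * (u (z + τ) + u (z - τ)) ≤ PV Ω g z + L / 2 * t ^ 2 * R ^ 2 + 2 * CB * t ^ 2 := by
    intro u hu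
    have hnn : 0 ≤ L / 2 * t ^ 2 := by positivity
    have key := S.perr.comparison S.cont hDo hDΩ
      (w := fun y => ((1 / 2 * u (y + τ) + 1 / 2 * u (y + -τ)) + (L / 2 * t ^ 2) * ‖y - 0‖ ^ 2)
        + (-(L / 2 * t ^ 2 * R ^ 2) - 2 * CB * t ^ 2))
      (by
        refine ContinuousOn.add (ContinuousOn.add (ContinuousOn.add (continuousOn_const.mul ?_)
          (continuousOn_const.mul ?_)) (by fun_prop)) continuousOn_const
        · exact hu.1.comp (by fun_prop) fun y hy => subset_closure (hmem y τ (hcl y hy) htpos rfl)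
        · exact hu.1.comp (by fun_prop) fun y hy => subset_closure (hmem y (-τ) (hcl y hy) htpos (norm_neg _)))
      (fun y hy => by
        have hy' : 2 * t < infDist y Ωᶜ := hy
        have h1 := (((IsSubAt.translate (hu.2.1 (y + τ) (hmem y τ hy'.le htpos rfl))).const_mul
          (t := 1 / 2) (by norm_num)).add ((IsSubAt.translate (hu.2.1 (y + -τ) (hmem y (-τ) hy'.le htpos
          (norm_neg _)))).const_mul (t := 1 / 2) (by norm_num))).add (isSubAt_normsq S.G.hn hnn 0 y)
        refine (h1.add_const _).mono' ?_
        have := S.gS y τ (by linarith)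
        rw [sub_eq_add_neg y τ] at this
        linarith)
      (fun y hy => by
        have hy2 := (hDo.frontier_eq ▸ hy : y ∈ closure D \ D)
        have hy3 := hcl y hy2.1
        have hy4 : infDist y Ωᶜ = 2 * t := le_antisymm (not_lt.1 hy2.2) hy3
        have hyΩ : y ∈ Ω := S.G.mem_of_pos (by linarith)
        have h1 := hB y hyΩ (by linarith) τ hy3
        rw [hy4] at h1
        have h2 := S.perr.le hu (subset_closure (hmem y τ hy3 htpos rfl))
        have h3 := S.perr.le hu (subset_closure (hmem y (-τ) hy3 htpos (norm_neg _)))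
        rw [sub_eq_add_neg y τ] at h1
        have h4 : ‖y - 0‖ ^ 2 ≤ R ^ 2 := by
          rw [sub_zero]; have := S.bR y (subset_closure hyΩ); gcongr
        have h5 := mul_le_mul_of_nonneg_left h4 hnn
        linarith) z hzτ
    simp only [← sub_eq_add_neg] at key
    have h2 : 0 ≤ L / 2 * t ^ 2 * ‖z - 0‖ ^ 2 := by positivity
    linarith
  refine le_of_forall_pos_le_add fun ε hε => ?_
  obtain ⟨u, hu, h⟩ := S.perr.approx S.cont (half_pos hε)
  have h1 := h _ (subset_closure (hmem z τ hzτ.le htpos rfl))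
  have h2 := h _ (subset_closure (hmem z (-τ) hzτ.le htpos (norm_neg _)))
  rw [← sub_eq_add_neg] at h2
  have := main u hu
  linarith

end P6fsec

section P7asec
open Filter Topology

variable {n : ℕ} {Ω : Set (EE n)} {g r : EE n → ℝ} {dr : EE n → EE n →L[ℝ] ℝ} {ddr : EE n → BF n}
  {δ c C L A0 R : ℝ}

def MV4 (Ψ : ℂ → ℝ) (ζ : ℂ) : Prop := ∀ ε > 0, ∀ᶠ t : ℝ in 𝓝 0,
  4 * Ψ ζ - ε * t ^ 2 ≤ Ψ (ζ + t) + Ψ (ζ - t) + Ψ (ζ + I * t) + Ψ (ζ - I * t)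

lemma MV4.add {Ψ Φ : ℂ → ℝ} {ζ : ℂ} (h1 : MV4 Ψ ζ) (h2 : MV4 Φ ζ) : MV4 (fun z => Ψ z + Φ z) ζ := by
  intro ε hε
  filter_upwards [h1 (ε / 2) (by positivity), h2 (ε / 2) (by positivity)] with t h3 h4
  linarith

def rectK : Set ℂ := {ζ | |ζ.re| ≤ 1 ∧ |ζ.im| ≤ 2}

lemma rectK_compact : IsCompact rectK := by
  have : IsCompact (Set.Icc (-1:ℝ) 1 ×ℂ Set.Icc (-2:ℝ) 2) := isCompact_Icc.reProdIm isCompact_Icc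
  convert this using 1
  ext ζ
  simp only [rectK, Complex.mem_reProdIm, Set.mem_Icc, abs_le]
  rfl

lemma rect_max {Ψ : ℂ → ℝ} (hc : ContinuousOn Ψ rectK)
    (hmv : ∀ ζ : ℂ, |ζ.re| < 1 → |ζ.im| < 2 → MV4 Ψ ζ) {M : ℝ}
    (hM : ∀ ζ ∈ rectK, |ζ.re| = 1 ∨ |ζ.im| = 2 → Ψ ζ ≤ M) : Ψ 0 ≤ M := by
  by_contra hcon
  push Not at hcon
  set ε := (Ψ 0 - M) / 6 with hε
  have hε0 : 0 < ε := by rw [hε]; linarith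
  have hcΦ : ContinuousOn (fun ζ : ℂ => Ψ ζ + ε * (ζ.re ^ 2 + ζ.im ^ 2)) rectK := by fun_prop
  have h0K : (0:ℂ) ∈ rectK := by simp [rectK]
  obtain ⟨ζ, hζ, hmax⟩ := rectK_compact.exists_isMaxOn ⟨0, h0K⟩ hcΦ
  have h0 : Ψ 0 + ε * ((0:ℂ).re ^ 2 + (0:ℂ).im ^ 2) ≤ Ψ ζ + ε * (ζ.re ^ 2 + ζ.im ^ 2) := hmax h0K
  simp only [Complex.zero_re, Complex.zero_im] at h0
  have hre2 : ζ.re ^ 2 ≤ 1 := by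
    have : |ζ.re| ^ 2 ≤ 1 ^ 2 := by gcongr; exact hζ.1
    rwa [sq_abs, one_pow] at this
  have him2 : ζ.im ^ 2 ≤ 4 := by
    have : |ζ.im| ^ 2 ≤ 2 ^ 2 := by gcongr; exact hζ.2
    rw [sq_abs] at this; linarith
  have h5 : ε * (ζ.re ^ 2 + ζ.im ^ 2) ≤ ε * 5 := by gcongr; linarith
  have hinR : |ζ.re| < 1 ∧ |ζ.im| < 2 := by
    by_contra h
    have : |ζ.re| = 1 ∨ |ζ.im| = 2 := by
      by_cases h1 : |ζ.re| < 1
      · right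
        exact le_antisymm hζ.2 (not_lt.1 fun h2 => h ⟨h1, h2⟩)
      · left; exact le_antisymm hζ.1 (not_lt.1 h1)
    have := hM ζ hζ this
    have : Ψ 0 - M = 6 * ε := by rw [hε]; ring
    linarith
  have hnb : rectK ∈ 𝓝 ζ := by
    have ho : IsOpen {ζ : ℂ | |ζ.re| < 1 ∧ |ζ.im| < 2} :=
      (isOpen_lt (f := fun ζ : ℂ => |ζ.re|) (g := fun _ => (1:ℝ)) Complex.continuous_re.abs continuous_const).inter
        (isOpen_lt (f := fun ζ : ℂ => |ζ.im|) (g := fun _ => (2:ℝ)) Complex.continuous_im.abs continuous_const)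
    exact mem_of_superset (ho.mem_nhds hinR) fun z hz => ⟨hz.1.le, hz.2.le⟩
  have hev : ∀ f : ℝ → ℂ, Continuous f → f 0 = ζ → ∀ᶠ t in 𝓝 (0:ℝ), f t ∈ rectK := by
    intro f hf h0
    exact hf.continuousAt.eventually_mem (by rw [h0]; exact hnb)
  have hall := ((hmv ζ hinR.1 hinR.2 ε hε0).and ((hev (fun t => ζ + t) (by fun_prop) (by simp)).and
    ((hev (fun t => ζ - t) (by fun_prop) (by simp)).and ((hev (fun t => ζ + I * t) (by fun_prop) (by simp)).and
    (hev (fun t => ζ - I * t) (by fun_prop) (by simp))))))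
  have hall' := (hall.filter_mono nhdsWithin_le_nhds : ∀ᶠ t in 𝓝[≠] (0:ℝ), _).and self_mem_nhdsWithin
  obtain ⟨t, ⟨h1, h2, h3, h4, h6⟩, ht⟩ := hall'.exists
  have e1 : _ ≤ Ψ ζ + ε * (ζ.re ^ 2 + ζ.im ^ 2) := hmax h2
  have e2 : _ ≤ Ψ ζ + ε * (ζ.re ^ 2 + ζ.im ^ 2) := hmax h3
  have e3 : _ ≤ Ψ ζ + ε * (ζ.re ^ 2 + ζ.im ^ 2) := hmax h4
  have e4 : _ ≤ Ψ ζ + ε * (ζ.re ^ 2 + ζ.im ^ 2) := hmax h6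
  simp only [Complex.add_re, Complex.sub_re, Complex.add_im, Complex.sub_im, Complex.ofReal_re,
    Complex.ofReal_im, Complex.mul_re, Complex.mul_im, Complex.I_re, Complex.I_im] at e1 e2 e3 e4
  have ht2 : 0 < t ^ 2 := by have : t ≠ 0 := ht
                             positivity
  have : 0 < ε * t ^ 2 := by positivity
  linarith

/-- subharmonicity along complex lines -/
lemma mv4_line {u : EE n → ℝ} {z τ : EE n} {ζ : ℂ}
    (h : ∀ ε > 0, ∀ᶠ t : ℝ in 𝓝 0, 4 * u (z + ζ • τ) - ε * t ^ 2 ≤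
      u (z + ζ • τ + t • τ) + u (z + ζ • τ - t • τ) + u (z + ζ • τ + t • (I • τ)) + u (z + ζ • τ - t • (I • τ))) :
    MV4 (fun ζ => u (z + ζ • τ)) ζ := by
  intro ε hε
  filter_upwards [h ε hε] with t ht
  have hr : ∀ x : EE n, t • x = (t : ℂ) • x := fun x => (Complex.coe_smul t x).symm
  have e1 : z + (ζ + (t:ℂ)) • τ = z + ζ • τ + t • τ := by rw [hr, add_smul]; abel
  have e2 : z + (ζ - (t:ℂ)) • τ = z + ζ • τ - t • τ := by rw [hr, sub_smul]; abel
  have e3 : z + (ζ + I * (t:ℂ)) • τ = z + ζ • τ + t • (I • τ) := by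
    rw [hr, smul_smul, mul_comm (t:ℂ), add_smul]; abel
  have e4 : z + (ζ - I * (t:ℂ)) • τ = z + ζ • τ - t • (I • τ) := by
    rw [hr, smul_smul, mul_comm (t:ℂ), sub_smul]; abel
  rw [e1, e2, e3, e4]; exact ht

lemma MV4.conj {Ψ : ℂ → ℝ} {ζ : ℂ} (h : MV4 Ψ ((starRingEnd ℂ) ζ)) :
    MV4 (fun ζ => Ψ ((starRingEnd ℂ) ζ)) ζ := by
  intro ε hε
  filter_upwards [h ε hε] with t ht
  simp only [map_add, map_sub, map_mul, Complex.conj_ofReal, Complex.conj_I, neg_mul, sub_neg_eq_add]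
  rw [← sub_eq_add_neg]
  linarith

lemma mv4_q (m : ℝ) (ζ : ℂ) : MV4 (fun ζ => m * ((ζ.re ^ 2 - ζ.im ^ 2 + 3) / 4)) ζ := by
  intro ε hε
  refine Eventually.of_forall fun t => ?_
  simp only [Complex.add_re, Complex.sub_re, Complex.add_im, Complex.sub_im, Complex.ofReal_re,
    Complex.ofReal_im, Complex.mul_re, Complex.mul_im, Complex.I_re, Complex.I_im]
  have : 0 ≤ ε * t ^ 2 := by positivity
  linarith

set_option maxHeartbeats 1600000 in
lemma Std.sd_lower (S : Std Ω g r dr ddr δ c C L A0 R) :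
    ∃ CC : ℝ, 0 ≤ CC ∧ ∀ z τ : EE n, 6 * ‖τ‖ < infDist z Ωᶜ →
      |PV Ω g (z + τ) + PV Ω g (z - τ) - 2 * PV Ω g z| ≤ CC * ‖τ‖ ^ 2 := by
  obtain ⟨CC, hCC, hU⟩ := S.sd_upper
  refine ⟨7 * CC, by positivity, fun z τ hzτ => ?_⟩
  have ht0 : 0 ≤ ‖τ‖ := norm_nonneg _
  have hct : 0 ≤ CC * ‖τ‖ ^ 2 := by positivity
  rw [abs_le]
  refine ⟨?_, by linarith [hU z τ (by linarith)]⟩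
  set m := -2 * (PV Ω g (z + τ) + PV Ω g (z - τ) - 2 * PV Ω g z) with hm
  rcases (le_total : m ≤ 0 ∨ 0 ≤ m) with hm0 | hm0
  · linarith
  suffices h : 3 / 4 * m ≤ 10 * (CC * ‖τ‖ ^ 2) by linarith
  have hnζ : ∀ ζ ∈ rectK, ‖ζ‖ ^ 2 ≤ 5 := by
    intro ζ hζ
    rw [Complex.sq_norm, Complex.normSq_apply]
    have h1 : |ζ.re| ^ 2 ≤ 1 ^ 2 := by gcongr; exact hζ.1
    have h2 : |ζ.im| ^ 2 ≤ 2 ^ 2 := by gcongr; exact hζ.2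
    rw [sq_abs] at h1 h2; linarith
  have hnζ' : ∀ ζ ∈ rectK, ‖ζ‖ < 3 := by
    intro ζ hζ
    have := hnζ ζ hζ
    by_contra h
    push Not at h
    have : (3:ℝ) ^ 2 ≤ ‖ζ‖ ^ 2 := by gcongr
    linarith
  have hconj : ∀ ζ ∈ rectK, (starRingEnd ℂ) ζ ∈ rectK := by
    intro ζ hζ; exact ⟨by simpa using hζ.1, by simpa using hζ.2⟩
  have hneg : ∀ ζ ∈ rectK, -ζ ∈ rectK := by
    intro ζ hζ; exact ⟨by simpa using hζ.1, by simpa using hζ.2⟩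
  have hmem : ∀ ζ ∈ rectK, z + ζ • τ ∈ Ω := by
    intro ζ hζ
    have h1 := infDist_sub_le Ωᶜ z (z + ζ • τ)
    rw [sub_add_cancel_left, norm_neg, norm_smul] at h1
    have h2 : ‖ζ‖ * ‖τ‖ ≤ 3 * ‖τ‖ := by gcongr; exact (hnζ' ζ hζ).le
    exact S.G.mem_of_pos (by linarith)
  refine le_of_forall_pos_le_add fun ε hε => ?_
  obtain ⟨u, hu, hua⟩ := S.perr.approx S.cont (show 0 < ε / 4 by positivity)
  have hule : ∀ ζ ∈ rectK, u (z + ζ • τ) ≤ PV Ω g (z + ζ • τ) := fun ζ hζ =>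
    S.perr.le hu (subset_closure (hmem ζ hζ))
  have hmv : ∀ ζ ∈ rectK, MV4 (fun ζ => u (z + ζ • τ)) ζ := by
    intro ζ hζ
    refine mv4_line fun ε hε => ?_
    exact (hu.2.1 _ (hmem ζ hζ)).mv S.G.hn (S.g0 _ (hmem ζ hζ)) τ hε
  have hmvn : ∀ ζ ∈ rectK, MV4 (fun ζ => u (z + (-ζ) • τ)) ζ := by
    intro ζ hζ
    have e : (fun ζ : ℂ => u (z + (-ζ) • τ)) = fun ζ => u (z + ζ • (-τ)) := by
      funext ζ; rw [neg_smul, smul_neg]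
    rw [e]
    refine mv4_line fun ε hε => ?_
    have e2 : z + ζ • -τ = z + (-ζ) • τ := by rw [neg_smul, smul_neg]
    have h3 := hmem _ (hneg ζ hζ)
    rw [← e2] at h3
    exact (hu.2.1 _ h3).mv S.G.hn (S.g0 _ h3) (-τ) hε
  have hcu : ContinuousOn (fun ζ : ℂ => u (z + ζ • τ)) rectK :=
    hu.1.comp (by fun_prop) fun ζ hζ => subset_closure (hmem ζ hζ)
  have hcn : ContinuousOn (fun ζ : ℂ => u (z + (-ζ) • τ)) rectK :=
    hcu.comp (f := fun ζ => -ζ) (by fun_prop) hneg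
  have hcc : ContinuousOn (fun ζ : ℂ => u (z + ((starRingEnd ℂ) ζ) • τ)) rectK :=
    hcu.comp (f := fun ζ => (starRingEnd ℂ) ζ) Complex.continuous_conj.continuousOn hconj
  have hcnc : ContinuousOn (fun ζ : ℂ => u (z + (-((starRingEnd ℂ) ζ)) • τ)) rectK :=
    hcn.comp (f := fun ζ => (starRingEnd ℂ) ζ) Complex.continuous_conj.continuousOn hconj
  have key := rect_max (Ψ := fun ζ => (((u (z + ζ • τ) + u (z + (-ζ) • τ)) +
      (u (z + ((starRingEnd ℂ) ζ) • τ) + u (z + (-((starRingEnd ℂ) ζ)) • τ))) +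
      m * ((ζ.re ^ 2 - ζ.im ^ 2 + 3) / 4)))
    (M := 4 * PV Ω g z + 10 * (CC * ‖τ‖ ^ 2))
    (by
      refine ContinuousOn.add ((hcu.add hcn).add (hcc.add hcnc)) (by fun_prop))
    (fun ζ h1 h2 => by
      have hζ : ζ ∈ rectK := ⟨h1.le, h2.le⟩
      exact (((hmv ζ hζ).add (hmvn ζ hζ)).add ((MV4.conj (Ψ := fun ζ => u (z + ζ • τ)) (hmv _ (hconj ζ hζ))).add
        (MV4.conj (Ψ := fun ζ => u (z + (-ζ) • τ)) (hmvn _ (hconj ζ hζ))))).add (mv4_q m ζ))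
    (fun ζ hζ hbd => by
      have a1 := hule ζ hζ
      have a2 := hule _ (hneg ζ hζ)
      have a3 := hule _ (hconj ζ hζ)
      have a4 := hule _ (hneg _ (hconj ζ hζ))
      have hre2 : ζ.re ^ 2 ≤ 1 := by
        have : |ζ.re| ^ 2 ≤ 1 ^ 2 := by gcongr; exact hζ.1
        rwa [sq_abs, one_pow] at this
      have him2 : ζ.im ^ 2 ≤ 4 := by
        have : |ζ.im| ^ 2 ≤ 2 ^ 2 := by gcongr; exact hζ.2
        rw [sq_abs] at this; linarith
      by_cases htop : |ζ.im| = 2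
      · have hop : ∀ ζ ∈ rectK, PV Ω g (z + ζ • τ) + PV Ω g (z + (-ζ) • τ) ≤ 2 * PV Ω g z + 5 * (CC * ‖τ‖ ^ 2) := by
          intro ζ hζ
          have hns : ‖ζ • τ‖ = ‖ζ‖ * ‖τ‖ := norm_smul _ _
          have h3 : ‖ζ‖ * ‖τ‖ ≤ 3 * ‖τ‖ := by gcongr; exact (hnζ' ζ hζ).le
          have h4 := hU z (ζ • τ) (by linarith)
          rw [hns, mul_pow, sub_eq_add_neg, ← neg_smul] at h4
          have h5 : ‖ζ‖ ^ 2 * ‖τ‖ ^ 2 ≤ 5 * ‖τ‖ ^ 2 := by gcongr; exact hnζ ζ hζ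
          have h6 := mul_le_mul_of_nonneg_left h5 hCC
          linarith
        have h1 := hop ζ hζ
        have h2 := hop _ (hconj ζ hζ)
        have h3 : ζ.im ^ 2 = 4 := by rw [← sq_abs, htop]; norm_num
        have h4 : m * ((ζ.re ^ 2 - ζ.im ^ 2 + 3) / 4) ≤ 0 :=
          mul_nonpos_of_nonneg_of_nonpos hm0 (by linarith)
        linarith
      · have hside : |ζ.re| = 1 := hbd.resolve_right htop
        have hre : ζ.re ^ 2 = 1 := by rw [← sq_abs, hside]; norm_num
        have h4 : m * ((ζ.re ^ 2 - ζ.im ^ 2 + 3) / 4) ≤ m * 1 := by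
          have : 0 ≤ ζ.im ^ 2 := sq_nonneg _
          gcongr; linarith
        set y : ℂ := (ζ.im : ℂ) * I with hy
        have hny : ‖y‖ = |ζ.im| := by rw [hy]; simp
        have hsd : ∀ σ : EE n, ‖σ‖ = ‖τ‖ → PV Ω g (z + σ + y • τ) + PV Ω g (z + σ - y • τ) ≤
            2 * PV Ω g (z + σ) + 4 * (CC * ‖τ‖ ^ 2) := by
          intro σ hσ
          have h1 := infDist_sub_le Ωᶜ z (z + σ)
          rw [sub_add_cancel_left, norm_neg, hσ] at h1
          have hns : ‖y • τ‖ = |ζ.im| * ‖τ‖ := by rw [norm_smul, hny]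
          have h3 : |ζ.im| * ‖τ‖ ≤ 2 * ‖τ‖ := by gcongr; exact hζ.2
          have h4 := hU (z + σ) (y • τ) (by linarith)
          rw [hns, mul_pow, sq_abs] at h4
          have h5 : ζ.im ^ 2 * ‖τ‖ ^ 2 ≤ 4 * ‖τ‖ ^ 2 := by gcongr
          have h6 := mul_le_mul_of_nonneg_left h5 hCC
          linarith
        have b1 := hsd τ rfl
        have b2 := hsd (-τ) (norm_neg _)
        have hζe : ζ = (ζ.re : ℂ) + y := (Complex.re_add_im ζ).symm
        have hζc : (starRingEnd ℂ) ζ = (ζ.re : ℂ) - y := by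
          apply Complex.ext <;> simp [hy]
        have hsum : PV Ω g (z + ζ • τ) + PV Ω g (z + (-ζ) • τ) +
            (PV Ω g (z + ((starRingEnd ℂ) ζ) • τ) + PV Ω g (z + (-((starRingEnd ℂ) ζ)) • τ)) =
            (PV Ω g (z + τ + y • τ) + PV Ω g (z + τ - y • τ)) +
            (PV Ω g (z + -τ + y • τ) + PV Ω g (z + -τ - y • τ)) := by
          rw [hζc]
          rcases (abs_eq (by norm_num : (0:ℝ) ≤ 1)).1 hside with h | h
          · have e1 : z + ζ • τ = z + τ + y • τ := by
              nth_rewrite 1 [hζe]; rw [h, add_smul]; push_cast; rw [one_smul]; abel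
            have e2 : z + (-ζ) • τ = z + -τ - y • τ := by
              nth_rewrite 1 [hζe]; rw [h, neg_smul, add_smul]; push_cast; rw [one_smul]; abel
            have e3 : z + ((ζ.re : ℂ) - y) • τ = z + τ - y • τ := by
              rw [h, sub_smul]; push_cast; rw [one_smul]; abel
            have e4 : z + (-((ζ.re : ℂ) - y)) • τ = z + -τ + y • τ := by
              rw [h, neg_smul, sub_smul]; push_cast; rw [one_smul]; abel
            rw [e1, e2, e3, e4]; ring
          · have e1 : z + ζ • τ = z + -τ + y • τ := by
              nth_rewrite 1 [hζe]; rw [h, add_smul]; push_cast; rw [neg_smul, one_smul]; abel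
            have e2 : z + (-ζ) • τ = z + τ - y • τ := by
              nth_rewrite 1 [hζe]; rw [h, neg_smul, add_smul]; push_cast; rw [neg_smul, one_smul]; abel
            have e3 : z + ((ζ.re : ℂ) - y) • τ = z + -τ - y • τ := by
              rw [h, sub_smul]; push_cast; rw [neg_smul, one_smul]; abel
            have e4 : z + (-((ζ.re : ℂ) - y)) • τ = z + τ + y • τ := by
              rw [h, neg_smul, sub_smul]; push_cast; rw [neg_smul, one_smul]; abel
            rw [e1, e2, e3, e4]; ring
        rw [← sub_eq_add_neg z τ] at b2 hsum
        linarith)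
  simp only [map_zero, neg_zero, zero_smul, add_zero, Complex.zero_re, Complex.zero_im] at key
  have := hua z (subset_closure (S.G.mem_of_pos (by linarith)))
  linarith

end P7asec

section P7bsec
open Filter Topology

variable {n : ℕ} {Ω : Set (EE n)} {g r : EE n → ℝ} {dr : EE n → EE n →L[ℝ] ℝ} {ddr : EE n → BF n}
  {δ c C L A0 R : ℝ}

lemma one_dim_sd {φ : ℝ → ℝ} {m A : ℝ} (hA : 0 ≤ A) (hd : HasDerivAt φ m 0)
    (h : ∀ s, 0 ≤ s → s ≤ 1 → |φ s + φ 0 - 2 * φ (s / 2)| ≤ A * s ^ 2) :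
    |φ 1 - φ 0 - m| ≤ 2 * A := by
  set e : ℝ → ℝ := fun s => φ s - φ 0 - m * s with he
  have hstep : ∀ s, 0 ≤ s → s ≤ 1 → |e s| - 2 * A * s ^ 2 ≤ 2 * (|e (s / 2)| - 2 * A * (s / 2) ^ 2) := by
    intro s h0 h1
    have h2 := h s h0 h1
    have h3 : e s = 2 * e (s / 2) + (φ s + φ 0 - 2 * φ (s / 2)) := by simp only [he]; ring
    have h4 : |e s| ≤ 2 * |e (s / 2)| + |φ s + φ 0 - 2 * φ (s / 2)| := by
      rw [h3]; refine (abs_add_le _ _).trans ?_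
      rw [abs_mul]; norm_num
    have h5 : (s / 2) ^ 2 = s ^ 2 / 4 := by ring
    rw [h5]; linarith
  have hN : ∀ N : ℕ, |e 1| - 2 * A ≤ 2 ^ N * (|e ((1/2) ^ N)| - 2 * A * ((1/2) ^ N) ^ 2) := by
    intro N
    induction N with
    | zero => simp
    | succ k ih =>
      have h1 := hstep ((1/2) ^ k) (by positivity) (pow_le_one₀ (by norm_num) (by norm_num))
      have h2 : ((1:ℝ)/2) ^ (k+1) = (1/2) ^ k / 2 := by ring
      rw [h2, pow_succ (2:ℝ)]
      have h3 : (0:ℝ) < 2 ^ k := by positivity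
      have := mul_le_mul_of_nonneg_left h1 h3.le
      linarith
  have hgoal : |e 1| ≤ 2 * A := by
    refine le_of_forall_pos_le_add fun ε hε => ?_
    have ho := hd.isLittleO.def hε
    have ht : Tendsto (fun N : ℕ => ((1:ℝ)/2) ^ N) atTop (𝓝 0) :=
      tendsto_pow_atTop_nhds_zero_of_lt_one (by norm_num) (by norm_num)
    obtain ⟨N, hN'⟩ := (ht.eventually ho).exists
    have h1 := hN N
    have h2 : |e ((1/2) ^ N)| ≤ ε * (1/2) ^ N := by
      have hp : (0:ℝ) < (1/2) ^ N := by positivity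
      simp only [sub_zero, smul_eq_mul, Real.norm_eq_abs, abs_of_pos hp] at hN'
      simpa [he, mul_comm] using hN'
    have h3 : (2:ℝ) ^ N * (1/2) ^ N = 1 := by rw [← mul_pow]; norm_num
    have h4 := mul_le_mul_of_nonneg_left h2 (by positivity : (0:ℝ) ≤ 2 ^ N)
    have h5 : 0 ≤ (2:ℝ) ^ N * (2 * A * ((1/2) ^ N) ^ 2) := by positivity
    have h6 : (2:ℝ) ^ N * (ε * (1/2) ^ N) = ε := by linear_combination ε * h3
    linarith
  simpa [he] using hgoal

lemma vol_haar : (MeasureTheory.volume : MeasureTheory.Measure (EE n)).IsAddHaarMeasure := by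
  show (MeasureTheory.Measure.addHaar).IsAddHaarMeasure
  infer_instance

set_option maxHeartbeats 1600000 in
lemma Std.taylor (S : Std Ω g r dr ddr δ c C L A0 R) :
    ∃ K, 0 ≤ K ∧ ∃ D : EE n → EE n →L[ℝ] ℝ, ∀ z ∈ Ω, ∀ x, 6 * ‖x‖ < infDist z Ωᶜ →
      |PV Ω g (z + x) - PV Ω g z - D z x| ≤ K * ‖x‖ ^ 2 := by
  obtain ⟨CC, hCC, hsd⟩ := S.sd_lower
  have hL := S.hL; have hA0 := S.hA0
  set M := L * R ^ 2 + A0 with hM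
  have hM0 : 0 ≤ M := by positivity
  set v := PV Ω g with hv
  have hvc := S.cont
  have hlip : ∀ x ∈ Ω, ∀ y ∈ Ω, |v y - v x| ≤ M * ‖y - x‖ := by
    intro x hx y hy
    have h1 := S.lip (subset_closure hx) (subset_closure hy)
    have h2 := S.lip (subset_closure hy) (subset_closure hx)
    rw [norm_sub_rev] at h2
    rw [abs_le]; constructor <;> linarith
  have hLW : LipschitzOnWith M.toNNReal v Ω := by
    refine LipschitzOnWith.of_dist_le_mul fun x hx y hy => ?_
    rw [Real.coe_toNNReal _ hM0, Real.dist_eq, dist_eq_norm]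
    exact hlip y hy x hx
  have hinf : ∀ z x : EE n, infDist z Ωᶜ - ‖x‖ ≤ infDist (z + x) Ωᶜ := by
    intro z x
    have := infDist_sub_le Ωᶜ z (z + x)
    rw [show z - (z + x) = -x by abel, norm_neg] at this
    linarith
  -- at differentiability points
  have hdp : ∀ z ∈ Ω, ∀ l : EE n →L[ℝ] ℝ, HasFDerivAt v l z → ∀ x, 6 * ‖x‖ < infDist z Ωᶜ →
      |v (z + x) - v z - l x| ≤ CC / 2 * ‖x‖ ^ 2 := by
    intro z hz l hl x hx
    have hd : HasDerivAt (fun s : ℝ => v (z + s • x)) (l x) 0 := by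
      have h1 : HasDerivAt (fun s : ℝ => z + s • x) x 0 := by
        simpa using ((hasDerivAt_id (0:ℝ)).smul_const x).const_add z
      have h2 : HasFDerivAt v l (z + (0:ℝ) • x) := by simpa using hl
      exact h2.comp_hasDerivAt (0:ℝ) h1
    have := one_dim_sd (A := CC / 4 * ‖x‖ ^ 2) (by positivity) hd (by
      intro s h0 h1
      have hn1 : ‖(s / 2) • x‖ = s / 2 * ‖x‖ := by
        rw [norm_smul, Real.norm_eq_abs, abs_of_nonneg (by linarith)]
      have h2 := hinf z ((s/2) • x)
      have h3 : s / 2 * ‖x‖ ≤ 1 / 2 * ‖x‖ := by gcongr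
      have h5 := norm_nonneg x
      have h4 := hsd (z + (s/2) • x) ((s/2) • x) (by rw [hn1] at h2 ⊢; linarith)
      rw [show z + (s/2) • x + (s/2) • x = z + s • x by module,
        show z + (s/2) • x - (s/2) • x = z + (0:ℝ) • x by module, hn1] at h4
      refine h4.trans (le_of_eq (by ring)))
    simp only [one_smul, zero_smul, add_zero] at this
    linarith
  have hdense : ∀ z ∈ Ω, ∃ y : ℕ → EE n, Tendsto y atTop (𝓝 z) ∧ ∀ j, y j ∈ Ω ∧ DifferentiableAt ℝ v (y j) := by
    intro z hz
    have hh : (MeasureTheory.volume : MeasureTheory.Measure (EE n)).IsAddHaarMeasure := vol_haar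
    have hae := hLW.ae_differentiableWithinAt_of_mem (μ := (MeasureTheory.volume : MeasureTheory.Measure (EE n)))
    have hD := MeasureTheory.Measure.dense_of_ae hae
    have : z ∈ closure ({y | y ∈ Ω → DifferentiableWithinAt ℝ v Ω y} ∩ Ω) := by
      have := hD.inter_open_nonempty
      rw [_root_.mem_closure_iff]
      intro o ho hzo
      obtain ⟨y, ⟨h1, h2⟩, h3⟩ := hD.inter_open_nonempty (o ∩ Ω) (ho.inter S.G.op) ⟨z, hzo, hz⟩
      exact ⟨y, h1, h3, h2⟩
    obtain ⟨y, hy, hyz⟩ := mem_closure_iff_seq_limit.1 this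
    exact ⟨y, hyz, fun j => ⟨(hy j).2, ((hy j).1 (hy j).2).differentiableAt (S.G.op.mem_nhds (hy j).2)⟩⟩
  have hex : ∀ z ∈ Ω, ∃ l : EE n →L[ℝ] ℝ, ∀ x, 6 * ‖x‖ < infDist z Ωᶜ →
      |v (z + x) - v z - l x| ≤ CC / 2 * ‖x‖ ^ 2 := by
    intro z hz
    obtain ⟨y, hyz, hy⟩ := hdense z hz
    have hb : ∀ j, fderiv ℝ v (y j) ∈ closedBall (0 : EE n →L[ℝ] ℝ) M := by
      intro j
      rw [mem_closedBall_zero_iff]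
      refine (hy j).2.hasFDerivAt.le_of_lip' hM0 ?_
      filter_upwards [S.G.op.mem_nhds (hy j).1] with w hw
      exact hlip _ (hy j).1 _ hw
    obtain ⟨l, -, φ, hφ, hl⟩ := (isCompact_closedBall (0 : EE n →L[ℝ] ℝ) M).tendsto_subseq hb
    refine ⟨l, fun x hx => ?_⟩
    have hyφ := hyz.comp hφ.tendsto_atTop
    have hx0 := norm_nonneg x
    have hzx : z + x ∈ Ω := S.G.mem_of_pos (by have := hinf z x; linarith)
    have hca : ∀ p ∈ Ω, ContinuousAt v p := fun p hp =>
      (hvc.mono subset_closure).continuousAt (S.G.op.mem_nhds hp)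
    have t1 : Tendsto (fun j => v (y (φ j) + x)) atTop (𝓝 (v (z + x))) :=
      (hca _ hzx).tendsto.comp (hyφ.add_const x)
    have t2 : Tendsto (fun j => v (y (φ j))) atTop (𝓝 (v z)) := (hca _ hz).tendsto.comp hyφ
    have t3 : Tendsto (fun j => fderiv ℝ v (y (φ j)) x) atTop (𝓝 (l x)) :=
      ((ContinuousLinearMap.apply ℝ ℝ x).continuous.tendsto l).comp hl
    refine le_of_tendsto ((t1.sub t2).sub t3).abs ?_
    have t4 : Tendsto (fun j => infDist (y (φ j)) Ωᶜ) atTop (𝓝 (infDist z Ωᶜ)) :=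
      ((continuous_infDist_pt _).tendsto z).comp hyφ
    filter_upwards [t4.eventually (lt_mem_nhds hx)] with j hj
    exact hdp _ (hy _).1 _ (hy _).2.hasFDerivAt x hj
  classical
  refine ⟨CC / 2, by positivity, fun z => if h : z ∈ Ω then (hex z h).choose else 0, fun z hz x hx => ?_⟩
  simp only [hz, dite_true]
  exact (hex z hz).choose_spec x hx

set_option maxHeartbeats 1600000 in
lemma Std.c11 (S : Std Ω g r dr ddr δ c C L A0 R) : C11On n Ω (PV Ω g) := by
  obtain ⟨K, hK, D, hD⟩ := S.taylor
  set v := PV Ω g with hv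
  have hfd : ∀ z ∈ Ω, HasFDerivAt v (D z) z := by
    intro z hz
    have hpos := S.G.pos_of_mem hz
    rw [hasFDerivAt_iff_isLittleO_nhds_zero]
    refine Asymptotics.IsBigO.trans_isLittleO (g := fun x : EE n => ‖x‖ ^ 2) ?_ ?_
    · refine Asymptotics.IsBigO.of_bound K ?_
      have : ∀ᶠ x : EE n in 𝓝 0, 6 * ‖x‖ < infDist z Ωᶜ := by
        have hc : Continuous fun x : EE n => 6 * ‖x‖ := by fun_prop
        exact hc.continuousAt.eventually_lt_const (by simpa using hpos)
      filter_upwards [this] with x hx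
      have := hD z hz x hx
      simpa using this
    · simpa using (Asymptotics.isLittleO_norm_pow_id (E' := EE n) (one_lt_two))
  have hloc : ∀ z ∈ Ω, ∀ᶠ w in 𝓝 z, ‖D w - D z‖ ≤ 6 * K * ‖w - z‖ := by
    intro z hz
    have hpos := S.G.pos_of_mem hz
    have : ∀ᶠ w : EE n in 𝓝 z, 20 * ‖w - z‖ < infDist z Ωᶜ := by
      have hc : Continuous fun w : EE n => 20 * ‖w - z‖ := by fun_prop
      exact hc.continuousAt.eventually_lt_const (by simpa using hpos)
    filter_upwards [this, S.G.op.mem_nhds hz] with w hw hwΩ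
    rcases eq_or_ne w z with rfl | hne
    · simp
    set h := w - z with hh
    have hh0 : 0 < ‖h‖ := norm_pos_iff.2 (sub_ne_zero.2 hne)
    have hwz : w = z + h := by simp [hh]
    have hi := infDist_sub_le Ωᶜ z w
    rw [norm_sub_rev, ← hh] at hi
    refine ContinuousLinearMap.opNorm_le_of_unit_norm (by positivity) fun u hu => ?_
    set x := ‖h‖ • u with hx
    have hxn : ‖x‖ = ‖h‖ := by rw [hx, norm_smul, hu]; simp
    have hhx : ‖h + x‖ ≤ 2 * ‖h‖ := by have := norm_add_le h x; linarith
    have e1 := hD z hz (h + x) (by linarith)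
    have e2 := hD z hz h (by linarith)
    have e3 := hD w hwΩ x (by linarith)
    have e4 : ‖h + x‖ ^ 2 ≤ 4 * ‖h‖ ^ 2 := by
      have := pow_le_pow_left₀ (norm_nonneg _) hhx 2
      linarith
    have e5 := mul_le_mul_of_nonneg_left e4 hK
    rw [hxn] at e3
    rw [show w + x = z + (h + x) by rw [hwz]; abel] at e3
    rw [← hwz] at e2
    have hadd : D z (h + x) = D z h + D z x := map_add _ _ _
    rw [abs_le] at e1 e2 e3
    have key : |D w x - D z x| ≤ 6 * K * ‖h‖ ^ 2 := by
      rw [abs_le]; constructor <;> linarith [e1.1, e1.2, e2.1, e2.2, e3.1, e3.2]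
    have hsc : D w x - D z x = ‖h‖ * ((D w - D z) u) := by
      rw [hx, map_smul, map_smul, sub_apply]; simp; ring
    rw [hsc, abs_mul, abs_of_pos hh0] at key
    rw [Real.norm_eq_abs]
    have : ‖h‖ * |(D w - D z) u| ≤ ‖h‖ * (6 * K * ‖h‖) := key.trans (le_of_eq (by ring))
    exact le_of_mul_le_mul_left this hh0
  obtain ⟨-, A, hA, hAl⟩ := S.G.quasi_lip (by positivity : 0 ≤ 6 * K) hloc
  have hfe : ∀ z ∈ Ω, fderiv ℝ v z = D z := fun z hz => (hfd z hz).fderiv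
  refine ⟨?_, A, fun z hz w hw => by rw [hfe z hz, hfe w hw]; exact hAl z hz w hw⟩
  rw [show (1 : WithTop ℕ∞) = 0 + 1 by simp, contDiffOn_succ_iff_fderiv_of_isOpen S.G.op]
  refine ⟨fun z hz => (hfd z hz).differentiableAt.differentiableWithinAt, by simp, ?_⟩
  rw [contDiffOn_zero]
  refine ContinuousOn.congr (f := D) ?_ hfe
  have : LipschitzOnWith A.toNNReal D Ω := by
    refine LipschitzOnWith.of_dist_le_mul fun x hx y hy => ?_
    rw [Real.coe_toNNReal _ hA, dist_eq_norm, dist_eq_norm]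
    exact hAl x hx y hy
  exact this.continuousOn

end P7bsec

section P8sec
open Filter Topology
open scoped ComplexOrder

variable {n : ℕ} {Ω : Set (EE n)} {g r : EE n → ℝ} {dr : EE n → EE n →L[ℝ] ℝ} {ddr : EE n → BF n}
  {δ c C L A0 R : ℝ}

lemma Ex2.quad' {B : BF n} (hB : ∀ x y, B x y = B y x) (z0 z1 : EE n) :
    Ex2 (fun z => B (z - z0) (z - z0) / 2) z1 (B (z1 - z0)) B := by
  have : (fun z => B (z - z0) (z - z0) / 2 - B (z1 - z0) (z1 - z0) / 2 - B (z1 - z0) (z - z1)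
      - B (z - z1) (z - z1) / 2) = fun _ => (0:ℝ) := by
    funext z
    have h1 : z - z0 = (z1 - z0) + (z - z1) := by abel
    rw [h1]
    generalize z1 - z0 = a
    generalize z - z1 = b
    simp only [map_add, add_apply]
    rw [hB b a]; ring
  unfold Ex2
  rw [this]
  exact Asymptotics.isLittleO_zero _ _

lemma lv_zero' (w : EE n) : lv (0 : BF n) w = 0 := by simp [lv]

lemma coercive_of_subM (hn : 0 < n) {B : BF n}
    (hN : (hm B).PosSemidef) (hd : 0 < (hm B).det.re) :
    ∃ c, 0 < c ∧ ∀ w, c * ‖w‖ ^ 2 ≤ lv B w := by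
  have hdef : (hm B).PosDef := hN.posDef_iff_det_ne_zero.2 (fun h => by rw [h] at hd; simp at hd)
  have hpos : ∀ w : EE n, w ≠ 0 → 0 < lv B w := by
    intro w hw
    have hw' : w.ofLp ≠ 0 := by
      intro h; apply hw; ext i; simpa using congrFun h i
    have h1 := hdef.dotProduct_mulVec_pos hw'
    have h2 := (Complex.pos_iff.1 h1).1
    rw [← hm_form]
    refine h2.trans_le (le_of_eq ?_)
    congr 1
    simp only [dotProduct, Matrix.mulVec, Finset.mul_sum, Pi.star_apply]
    refine Finset.sum_congr rfl fun i _ => Finset.sum_congr rfl fun j _ => ?_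
    simp; ring
  have hcont : Continuous fun w : EE n => lv B w := by
    unfold lv
    fun_prop
  obtain ⟨w0, hw0⟩ := exists_ne_ee hn
  obtain ⟨w1, hw1, hmin⟩ := (isCompact_sphere (0 : EE n) 1).exists_isMinOn
    ⟨w0, by simpa using hw0⟩ hcont.continuousOn
  have hw1n : ‖w1‖ = 1 := by simpa using hw1
  refine ⟨lv B w1, hpos w1 (by intro h; rw [h] at hw1n; simp at hw1n), fun w => ?_⟩
  rcases eq_or_ne w 0 with rfl | hw
  · simp [lv]
  have hwn : ‖w‖ ≠ 0 := norm_ne_zero_iff.2 hw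
  have h1 : lv B w1 ≤ lv B (‖w‖⁻¹ • w) := hmin (by
    rw [mem_sphere_zero_iff_norm, norm_smul, norm_inv, norm_norm, inv_mul_cancel₀ hwn])
  have h2 : w = ‖w‖ • (‖w‖⁻¹ • w) := by rw [smul_smul, mul_inv_cancel₀ hwn, one_smul]
  have h3 : lv B w = ‖w‖ ^ 2 * lv B (‖w‖⁻¹ • w) := by
    conv_lhs => rw [h2]
    rw [lv_smul_right]
  rw [h3, mul_comm]
  exact mul_le_mul_of_nonneg_left h1 (by positivity)

/-- a.e. twice differentiability of `C^{1,1}` functions -/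
lemma C11On.ae {u : EE n → ℝ} (ho : IsOpen Ω) (hu : C11On n Ω u) :
    ∀ᵐ z ∂(MeasureTheory.volume), z ∈ Ω → (∀ᶠ y in 𝓝 z, DifferentiableAt ℝ u y) ∧
      DifferentiableAt ℝ (fderiv ℝ u) z := by
  obtain ⟨h1, K, hK⟩ := hu
  have hh : (MeasureTheory.volume : MeasureTheory.Measure (EE n)).IsAddHaarMeasure := vol_haar
  have hLW : LipschitzOnWith (max K 0).toNNReal (fderiv ℝ u) Ω := by
    refine LipschitzOnWith.of_dist_le_mul fun x hx y hy => ?_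
    rw [Real.coe_toNNReal _ (le_max_right _ _), dist_eq_norm, dist_eq_norm]
    exact (hK x hx y hy).trans (mul_le_mul_of_nonneg_right (le_max_left _ _) (norm_nonneg _))
  filter_upwards [hLW.ae_differentiableWithinAt_of_mem (μ := (MeasureTheory.volume : MeasureTheory.Measure (EE n)))] with z hz hzΩ
  refine ⟨?_, (hz hzΩ).differentiableAt (ho.mem_nhds hzΩ)⟩
  filter_upwards [ho.mem_nhds hzΩ] with y hy
  exact (h1.differentiableOn (by simp)).differentiableAt (ho.mem_nhds hy)

lemma twice_symm {u : EE n → ℝ} {z : EE n} (h : ∀ᶠ y in 𝓝 z, DifferentiableAt ℝ u y)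
    (h2 : DifferentiableAt ℝ (fderiv ℝ u) z) :
    Ex2 u z (fderiv ℝ u z) (fderiv ℝ (fderiv ℝ u) z) ∧
      ∀ x y, fderiv ℝ (fderiv ℝ u) z x y = fderiv ℝ (fderiv ℝ u) z y x := by
  have h' : ∀ᶠ y in 𝓝 z, HasFDerivAt u (fderiv ℝ u y) y := h.mono fun y hy => hy.hasFDerivAt
  exact ⟨Ex2.taylor h' h2.hasFDerivAt, fun x y => second_derivative_symmetric_of_eventually h' h2.hasFDerivAt x y⟩

set_option maxHeartbeats 1600000 in
lemma Std.sub_ae (S : Std Ω g r dr ddr δ c C L A0 R) {z0 : EE n} (hz0 : z0 ∈ Ω) {l : EE n →L[ℝ] ℝ} {B : BF n}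
    (hE : Ex2 (PV Ω g) z0 l B) (hB : ∀ x y, B x y = B y x) : SubM B (g z0) := by
  have hL := S.hL
  intro e he
  have hn0 : (0:ℝ) < n := by exact_mod_cast S.G.hn
  set Se := ∑ k, ‖e k‖ ^ 2 with hSe
  have hSe0 : 0 ≤ Se := Finset.sum_nonneg fun k _ => by positivity
  have key : ∀ ε : ℝ, 0 < ε → n * (g z0 - L * ε) ≤ ∑ k, lv B (e k) + ε * Se := by
    intro ε hε
    have h1 := hE.def (half_pos hε)
    obtain ⟨ρ0, hρ0, hρb⟩ := Metric.eventually_nhds_iff_ball.1 (h1.and (S.G.op.mem_nhds hz0))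
    set ρ := min (ρ0 / 2) ε with hρ
    have hρp : 0 < ρ := by positivity
    have hρ1 : ρ ≤ ρ0 / 2 := min_le_left
    have hρ2 : ρ ≤ ε := min_le_right
    set ψ : EE n → ℝ := fun z => l z + B (z - z0) (z - z0) / 2 + ε * ‖z - z0‖ ^ 2 with hψ
    have hcb : closedBall z0 ρ ⊆ ball z0 ρ0 := closedBall_subset_ball (by linarith)
    obtain ⟨z1, hz1, hS⟩ := S.perr.touch_v S.cont (D := ball z0 ρ) (ψ := ψ) isOpen_ball
      (fun z hz => (hρb z (hcb (ball_subset_closedBall hz))).2)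
      (by apply Continuous.continuousOn; simp only [hψ]; fun_prop) (mem_ball_self hρp)
      (m := PV Ω g z0 - l z0 - ε / 2 * ρ ^ 2)
      (by
        have : ψ z0 = l z0 := by simp [hψ]
        rw [this]
        have : 0 < ε / 2 * ρ ^ 2 := by positivity
        linarith)
      (fun z hz => by
        rw [frontier_ball _ hρp.ne'] at hz
        have h2 := (hρb z (hcb (sphere_subset_closedBall hz))).1
        have hzn : ‖z - z0‖ = ρ := by simpa [dist_eq_norm] using hz
        rw [Real.norm_eq_abs, Real.norm_eq_abs, abs_of_nonneg (sq_nonneg ‖z - z0‖), hzn, map_sub l] at h2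
        have h3 := (abs_le.1 h2).2
        simp only [hψ, hzn]
        linarith)
    have hE1 := ((Ex2.lin l z1).add (Ex2.quad' hB z0 z1)).add ((Ex2.normsq z0 z1).const_mul ε)
    have hS1 := hS _ _ hE1 e he
    have hlv : ∀ k, lv (0 + B + ε • (2:ℝ) • ip n) (e k) = lv B (e k) + ε * ‖e k‖ ^ 2 := by
      intro k
      rw [lv_add, lv_add, lv_zero', lv_smul, lv_smul, lv_ip]; ring
    simp only [hlv, Finset.sum_add_distrib, ← Finset.mul_sum] at hS1
    have hz1Ω := (hρb z1 (hcb (ball_subset_closedBall hz1))).2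
    have hg := (abs_le.1 (S.gL z1 hz1Ω z0 hz0)).1
    have hd : ‖z1 - z0‖ ≤ ε := by
      have := mem_ball_iff_norm.1 hz1; linarith
    have hd2 := mul_le_mul_of_nonneg_left hd (by linarith : (0:ℝ) ≤ L)
    have h5 : n * (g z0 - L * ε) ≤ n * g z1 := mul_le_mul_of_nonneg_left (by linarith) hn0.le
    linarith
  have t1 : Tendsto (fun ε : ℝ => n * (g z0 - L * ε)) (𝓝[>] 0) (𝓝 (n * (g z0 - L * 0))) :=
    (Continuous.tendsto (by fun_prop) 0).mono_left nhdsWithin_le_nhds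
  have t2 : Tendsto (fun ε : ℝ => ∑ k, lv B (e k) + ε * Se) (𝓝[>] 0) (𝓝 (∑ k, lv B (e k) + 0 * Se)) :=
    (Continuous.tendsto (by fun_prop) 0).mono_left nhdsWithin_le_nhds
  have := le_of_tendsto_of_tendsto t1 t2 (by
    filter_upwards [self_mem_nhdsWithin] with ε hε using key ε hε)
  simpa using this

set_option maxHeartbeats 1600000 in
lemma Std.det_le (S : Std Ω g r dr ddr δ c C L A0 R) {z0 : EE n} (hz0 : z0 ∈ Ω) {l : EE n →L[ℝ] ℝ} {B : BF n}
    (hE : Ex2 (PV Ω g) z0 l B) (hB : ∀ x y, B x y = B y x) (hN : (hm B).PosSemidef) :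
    (hm B).det.re ≤ g z0 ^ n := by
  have hL := S.hL
  have hg0 := S.g0 z0 hz0
  by_contra hlt
  push Not at hlt
  have hdpos : 0 < (hm B).det.re := (pow_nonneg hg0 n).trans_lt hlt
  obtain ⟨κ, hκ, hco⟩ := coercive_of_subM S.G.hn hN hdpos
  -- γ > g z0
  set γ := (hm B).det.re ^ ((n:ℝ)⁻¹) with hγ
  have hγn : γ ^ n = (hm B).det.re := Real.rpow_inv_natCast_pow hdpos.le S.G.hn.ne'
  have hγ0 : 0 ≤ γ := Real.rpow_nonneg hdpos.le _
  have hγg : g z0 < γ := by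
    by_contra h
    push Not at h
    have := pow_le_pow_left₀ hγ0 h n
    linarith
  have hγp : 0 < γ := hg0.trans_lt hγg
  have hSB : SubM B γ := subM_of_det S.G.hn hN hγn.le
  -- parameters
  set d := γ - g z0 with hd
  have hdp : 0 < d := by rw [hd]; linarith
  set θ := min (d / (2 * γ)) 1 with hθ
  have hθ0 : 0 < θ := by positivity
  have hθ1 : θ ≤ 1 := min_le_right
  have hθγ : θ * γ ≤ d / 2 := by
    have : θ ≤ d / (2 * γ) := min_le_left
    calc θ * γ ≤ d / (2 * γ) * γ := mul_le_mul_of_nonneg_right this hγ0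
      _ = d / 2 := by field_simp
  set ε := θ * κ with hε
  have hε0 : 0 < ε := by positivity
  have hSB2 : SubM (B + (-ε) • (2:ℝ) • ip n) (γ - d / 2) := by
    refine (hSB.smul (t := 1 - θ) (by linarith)).mono (by linarith) fun w => ?_
    have h1 := mul_le_mul_of_nonneg_left (hco w) hθ0.le
    have h2 : lv ((-ε) • (2:ℝ) • ip n) w = - (θ * (κ * ‖w‖ ^ 2)) := by
      rw [lv_smul, lv_smul, lv_ip, hε]; ring
    rw [lv_add, lv_smul, h2]
    linarith
  have h1 := hE.def (half_pos hε0)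
  obtain ⟨ρ0, hρ0, hρb⟩ := Metric.eventually_nhds_iff_ball.1 (h1.and (S.G.op.mem_nhds hz0))
  set ρ := min (ρ0 / 2) (d / (2 * L)) with hρ
  have hρp : 0 < ρ := by positivity
  have hρ1 : ρ ≤ ρ0 / 2 := min_le_left
  have hρ2 : L * ρ ≤ d / 2 := by
    have : ρ ≤ d / (2 * L) := min_le_right
    calc L * ρ ≤ L * (d / (2 * L)) := mul_le_mul_of_nonneg_left this (by linarith)
      _ = d / 2 := by field_simp
  have hcb : closedBall z0 ρ ⊆ ball z0 ρ0 := closedBall_subset_ball (by linarith)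
  set w : EE n → ℝ := fun z => l z + B (z - z0) (z - z0) / 2 + (-ε) * ‖z - z0‖ ^ 2
    + (PV Ω g z0 - l z0 + ε / 2 * ρ ^ 2) with hw
  have := S.perr.comparison S.cont (w := w) (D := ball z0 ρ) isOpen_ball
    (fun z hz => (hρb z (hcb (ball_subset_closedBall hz))).2)
    (by apply Continuous.continuousOn; simp only [hw]; fun_prop)
    (fun z hz => by
      have hE1 := (((Ex2.lin l z).add (Ex2.quad' hB z0 z)).add ((Ex2.normsq z0 z).const_mul (-ε))).add_const
        (PV Ω g z0 - l z0 + ε / 2 * ρ ^ 2)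
      refine ⟨_, _, hE1.ls, ?_⟩
      refine hSB2.mono ?_ fun w => le_of_eq (by rw [lv_add, lv_add, lv_add, lv_zero', zero_add])
      have hzΩ := (hρb z (hcb (ball_subset_closedBall hz))).2
      have hg := (abs_le.1 (S.gL z hzΩ z0 hz0)).2
      have hd1 : ‖z - z0‖ ≤ ρ := (mem_ball_iff_norm.1 hz).le
      have hd2 := mul_le_mul_of_nonneg_left hd1 (by linarith : (0:ℝ) ≤ L)
      linarith)
    (fun z hz => by
      rw [frontier_ball _ hρp.ne'] at hz
      have h2 := (hρb z (hcb (sphere_subset_closedBall hz))).1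
      have hzn : ‖z - z0‖ = ρ := by simpa [dist_eq_norm] using hz
      rw [Real.norm_eq_abs, Real.norm_eq_abs, abs_of_nonneg (sq_nonneg ‖z - z0‖), hzn, map_sub l] at h2
      have h3 := (abs_le.1 h2).1
      simp only [hw, hzn]
      linarith) z0 (mem_ball_self hρp)
  have hw0 : w z0 = PV Ω g z0 + ε / 2 * ρ ^ 2 := by simp [hw]; ring
  have : 0 < ε / 2 * ρ ^ 2 := by positivity
  linarith

lemma det_im_zero {B : BF n} (hB : ∀ x y, B x y = B y x) : (hm B).det.im = 0 := by
  have h := (hm_herm hB)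
  have h1 : (hm B).det = star (hm B).det := by
    rw [← Matrix.det_conjTranspose, h.eq]
  have h2 := congrArg Complex.im h1
  simp at h2
  linarith

lemma Std.eqn (S : Std Ω g r dr ddr δ c C L A0 R) :
    ∀ᵐ z ∂(MeasureTheory.volume), z ∈ Ω → (∀ w : Fin n → ℂ, 0 ≤ (cHessForm n (PV Ω g) z w).re) ∧
      (cHess n (PV Ω g) z).det = ((g z ^ n : ℝ) : ℂ) := by
  filter_upwards [S.c11.ae S.G.op] with z hz hzΩ
  obtain ⟨h1, h2⟩ := hz hzΩ
  obtain ⟨hE, hB⟩ := twice_symm h1 h2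
  have hS := S.sub_ae hzΩ hE hB
  obtain ⟨hN, hd⟩ := det_of_subM S.G.hn hB (S.g0 z hzΩ) hS
  have hd2 := S.det_le hzΩ hE hB hN
  refine ⟨fun w => ?_, ?_⟩
  · have := cHessForm_re h1 h2 (WithLp.toLp 2 w)
    rw [show (WithLp.toLp 2 w : EE n).ofLp = w from rfl] at this
    rw [this]
    exact hS.lv_nonneg S.G.hn (S.g0 z hzΩ) _
  · rw [cHess_eq h1 h2, Matrix.det_transpose]
    apply Complex.ext
    · rw [Complex.ofReal_re]; exact le_antisymm hd2 hd
    · rw [Complex.ofReal_im]; exact det_im_zero hB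

end P8sec

section P9sec
open Filter Topology
open scoped ComplexOrder

variable {n : ℕ} {Ω : Set (EE n)}

set_option maxSynthPendingDepth 3 in
lemma lip_image_ball {G : EE n → EE n →L[ℝ] ℝ} {K : NNReal} {E : Set (EE n)} (hG : LipschitzOnWith K G E)
    {η : ℝ} (hη : 0 < η) (hb : ball 0 η ⊆ G '' E) : MeasureTheory.volume E ≠ 0 := by
  intro h0
  have hh : (MeasureTheory.volume : MeasureTheory.Measure (EE n)).IsAddHaarMeasure := vol_haar
  have hfr : Module.finrank ℝ (EE n →L[ℝ] ℝ) = Module.finrank ℝ (EE n) := by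
    rw [← Subspace.dual_finrank_eq (K := ℝ) (V := EE n)]
    exact (LinearMap.toContinuousLinearMap (𝕜 := ℝ) (E := EE n) (F' := ℝ)).finrank_eq.symm
  have h1 : MeasureTheory.Measure.hausdorffMeasure (Module.finrank ℝ (EE n) : ℝ) E = 0 :=
    (MeasureTheory.Measure.absolutelyContinuous_isAddHaarMeasure
      (MeasureTheory.Measure.hausdorffMeasure (Module.finrank ℝ (EE n) : ℝ)) MeasureTheory.volume) h0
  have h2 := hG.hausdorffMeasure_image_le (d := (Module.finrank ℝ (EE n) : ℝ)) (Nat.cast_nonneg _)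
  rw [h1, mul_zero] at h2
  have h3 := (MeasureTheory.measure_mono hb).trans h2
  rw [← hfr] at h3
  exact (isOpen_ball.measure_pos (MeasureTheory.Measure.hausdorffMeasure
    (Module.finrank ℝ (EE n →L[ℝ] ℝ) : ℝ)) ⟨0, mem_ball_self hη⟩).ne' (le_antisymm h3 bot_le)

lemma C11On.lip {u : EE n → ℝ} (hu : C11On n Ω u) : ∃ K : NNReal, LipschitzOnWith K (fderiv ℝ u) Ω := by
  obtain ⟨h1, K, hK⟩ := hu
  refine ⟨(max K 0).toNNReal, LipschitzOnWith.of_dist_le_mul fun x hx y hy => ?_⟩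
  rw [Real.coe_toNNReal _ (le_max_right _ _), dist_eq_norm, dist_eq_norm]
  exact (hK x hx y hy).trans (mul_le_mul_of_nonneg_right (le_max_left _ _) (norm_nonneg _))

lemma C11On.diff {u : EE n → ℝ} (ho : IsOpen Ω) (hu : C11On n Ω u) {z : EE n} (hz : z ∈ Ω) :
    DifferentiableAt ℝ u z :=
  (hu.1.differentiableOn (by simp)).differentiableAt (ho.mem_nhds hz)

set_option maxHeartbeats 1600000 in
lemma uniq_le (hn : 0 < n) (ho : IsOpen Ω) (hbd : Bornology.IsBounded Ω) {g v1 v2 : EE n → ℝ}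
    (hg : ∀ z ∈ Ω, 0 ≤ g z)
    (c1 : C11On n Ω v1) (k1 : ContinuousOn v1 (closure Ω))
    (p1 : ∀ᵐ z ∂(MeasureTheory.volume), z ∈ Ω → ∀ w : Fin n → ℂ, 0 ≤ (cHessForm n v1 z w).re)
    (d1 : ∀ᵐ z ∂(MeasureTheory.volume), z ∈ Ω → (cHess n v1 z).det = ((g z ^ n : ℝ) : ℂ))
    (b1 : ∀ z ∈ frontier Ω, v1 z = 0)
    (c2 : C11On n Ω v2) (k2 : ContinuousOn v2 (closure Ω))
    (d2 : ∀ᵐ z ∂(MeasureTheory.volume), z ∈ Ω → (cHess n v2 z).det = ((g z ^ n : ℝ) : ℂ))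
    (b2 : ∀ z ∈ frontier Ω, v2 z = 0) : ∀ z ∈ Ω, v1 z ≤ v2 z := by
  intro z0 hz0
  by_contra hlt
  push Not at hlt
  obtain ⟨R, hR0, hR⟩ := hbd.subset_ball_lt 0 0
  have hcl : ∀ y ∈ closure Ω, ‖y‖ ≤ R := by
    intro y hy
    have := closure_mono hR hy
    have := closure_ball_subset_closedBall this
    simpa using this
  set d := v1 z0 - v2 z0 with hd
  have hdp : 0 < d := by linarith
  set ε := d / (2 * R ^ 2) with hε
  have hε0 : 0 < ε := by positivity
  have hεR : ε * R ^ 2 = d / 2 := by rw [hε]; field_simp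
  set G : EE n → EE n →L[ℝ] ℝ := fun z => fderiv ℝ v1 z - fderiv ℝ v2 z + (ε • (2:ℝ) • ip n) z with hG
  obtain ⟨K1, hK1⟩ := c1.lip
  obtain ⟨K2, hK2⟩ := c2.lip
  have hGL : LipschitzOnWith (K1 + K2 + ‖ε • (2:ℝ) • ip n‖₊) G Ω :=
    (hK1.sub hK2).add ((ε • (2:ℝ) • ip n).lipschitz.lipschitzOnWith)
  set w : EE n → ℝ := fun z => v1 z - v2 z + ε * ‖z - 0‖ ^ 2 with hw
  have hGd : ∀ z ∈ Ω, HasFDerivAt w (G z) z := by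
    intro z hz
    have h1 := (c1.diff ho hz).hasFDerivAt
    have h2 := (c2.diff ho hz).hasFDerivAt
    have h3 : HasFDerivAt (fun z : EE n => ε * ‖z - 0‖ ^ 2) ((ε • (2:ℝ) • ip n) z) z := by
      have := ((hasFDerivAt_id z).norm_sq).const_mul ε
      simpa [ip, two_smul] using! this
    exact (h1.sub h2).add h3
  set E : Set (EE n) := {z ∈ Ω | ∀ y ∈ Ω, w y ≤ w z + G z (y - z)} with hE
  have hball : ball (0 : EE n →L[ℝ] ℝ) (d / (8 * R)) ⊆ G '' E := by
    intro p hp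
    have hpn : ‖p‖ * R < d / 8 := by
      have := mem_ball_zero_iff.1 hp
      rw [lt_div_iff₀ (by positivity)] at this
      linarith
    have hpy : ∀ y ∈ closure Ω, |p y| ≤ d / 8 := fun y hy =>
      (p.le_opNorm y).trans ((mul_le_mul_of_nonneg_left (hcl y hy) (norm_nonneg p)).trans hpn.le)
    have hcont : ContinuousOn (fun z => w z - p z) (closure Ω) := by
      have hc : Continuous fun z : EE n => ε * ‖z - 0‖ ^ 2 := by fun_prop
      exact ((k1.sub k2).add hc.continuousOn).sub p.continuous.continuousOn
    obtain ⟨z1, hz1, hm⟩ := (isCompact_closure_of_bd hbd).exists_isMaxOn ⟨z0, subset_closure hz0⟩ hcont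
    have h01 : w z0 - p z0 ≤ w z1 - p z1 := hm (subset_closure hz0)
    have hz1Ω : z1 ∈ Ω := by
      rcases mem_closure_or ho hz1 with h | h
      · exact h
      exfalso
      have e1 : w z1 ≤ d / 2 := by
        simp only [hw, b1 z1 h, b2 z1 h, sub_zero]
        have := mul_le_mul_of_nonneg_left (pow_le_pow_left₀ (norm_nonneg _) (hcl z1 hz1) 2) hε0.le
        linarith
      have e2 : d ≤ w z0 := by
        have : 0 ≤ ε * ‖z0 - 0‖ ^ 2 := by positivity
        simp only [hw]; linarith
      have e3 := (abs_le.1 (hpy z0 (subset_closure hz0))).2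
      have e4 := (abs_le.1 (hpy z1 hz1)).1
      linarith
    have hloc : IsLocalMax (fun z => w z - p z) z1 := by
      filter_upwards [ho.mem_nhds hz1Ω] with y hy
      exact hm (subset_closure hy)
    have hz := hloc.hasFDerivAt_eq_zero ((hGd z1 hz1Ω).sub p.hasFDerivAt)
    have hGp : G z1 = p := sub_eq_zero.1 hz
    refine ⟨z1, ⟨hz1Ω, fun y hy => ?_⟩, hGp⟩
    have h2 : w y - p y ≤ w z1 - p z1 := hm (subset_closure hy)
    rw [hGp, map_sub]; linarith
  have hEn := lip_image_ball (hGL.mono fun z hz => hz.1) (by positivity) hball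
  have hae := (c1.ae ho).and ((c2.ae ho).and (p1.and (d1.and d2)))
  obtain ⟨z, hzE, hzP⟩ : ∃ z, z ∈ E ∧ _ := by
    by_contra hno
    push Not at hno
    exact hEn (MeasureTheory.measure_mono_null (fun z hz => hno z hz) (MeasureTheory.ae_iff.1 hae))
  have hzΩ := hzE.1
  obtain ⟨q1, q2, q3, q4, q5⟩ := hzP
  obtain ⟨s1, s2⟩ := q1 hzΩ
  obtain ⟨t1, t2⟩ := q2 hzΩ
  obtain ⟨E1, B1⟩ := twice_symm s1 s2
  obtain ⟨E2, B2⟩ := twice_symm t1 t2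
  have q3' := q3 hzΩ
  have q4' := q4 hzΩ
  have q5' := q5 hzΩ
  rw [cHess_eq s1 s2, Matrix.det_transpose] at q4'
  rw [cHess_eq t1 t2, Matrix.det_transpose] at q5'
  set H1 := fderiv ℝ (fderiv ℝ v1) z with hH1
  set H2 := fderiv ℝ (fderiv ℝ v2) z with hH2
  have hlv1 : ∀ x : EE n, 0 ≤ lv H1 x := fun x => by
    rw [hH1, ← cHessForm_re s1 s2]; exact q3' _
  have hpsd := (det_of_subM hn B1 le_rfl (subM_of_lv hn le_rfl (fun x => by simpa using hlv1 x))).1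
  have hS1 : SubM H1 (g z) := subM_of_det hn hpsd (by rw [q4', Complex.ofReal_re])
  have hip : SubM (ε • (2:ℝ) • ip n) ε := by
    refine subM_of_lv hn hε0.le fun x => ?_
    rw [lv_smul, lv_smul, lv_ip]; exact le_of_eq (by ring)
  have hS2 : SubM H2 (g z + ε) := by
    have hEu := (E1.add ((Ex2.normsq 0 z).const_mul ε)).add ((Ex2.lin (G z) z).const_mul (-1))
    refine touching (u := fun y => v1 y + ε * ‖y - 0‖ ^ 2 + (-1) * G z y)
      ⟨_, _, hEu.ls, (hS1.add hip).mono le_rfl fun x => le_of_eq ?_⟩ E2 ?_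
    · rw [lv_add, lv_add, lv_add, lv_smul (-1), lv_zero']; ring
    · filter_upwards [ho.mem_nhds hzΩ] with y hy
      have := hzE.2 y hy
      simp only [hw, map_sub] at this
      linarith
  have hfin := (det_of_subM hn B2 (by linarith [hg z hzΩ]) hS2).2
  rw [q5', Complex.ofReal_re] at hfin
  have : g z ^ n < (g z + ε) ^ n := pow_lt_pow_left₀ (by linarith) (hg z hzΩ) hn.ne'
  linarith

end P9sec

/-- Caffarelli–Kohn–Nirenberg–Spruck. On a bounded strictly
pseudoconvex domain with `C³` boundary, the Dirichlet problem `det H(v) = f`, `v = 0`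
on `∂Ω` has a unique `C^{1,1}(Ω̄)` plurisubharmonic solution, provided `f ≥ 0` and
`f^{1/n} ∈ C^{1,1}(Ω̄)`. -/
theorem monge_ampere_dirichlet_CKNS (n : ℕ) (hn : 0 < n)
    (Ω : Set (EuclideanSpace ℂ (Fin n)))
    (hΩ : IsStrictlyPseudoconvexDomain n 3 Ω)
    (f : EuclideanSpace ℂ (Fin n) → ℝ)
    (hf0 : ∀ z ∈ closure Ω, 0 ≤ f z)
    (hf : C11On n Ω (fun z => f z ^ ((1 : ℝ) / n))) :
    ∃ v : EuclideanSpace ℂ (Fin n) → ℝ,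
      (C11On n Ω v ∧ ContinuousOn v (closure Ω) ∧
        (∀ᵐ z ∂(MeasureTheory.volume), z ∈ Ω →
          ∀ w : Fin n → ℂ, 0 ≤ (cHessForm n v z w).re) ∧
        (∀ᵐ z ∂(MeasureTheory.volume), z ∈ Ω → (cHess n v z).det = (f z : ℂ)) ∧
        (∀ z ∈ frontier Ω, v z = 0)) ∧
      ∀ v' : EuclideanSpace ℂ (Fin n) → ℝ,
        (C11On n Ω v' ∧ ContinuousOn v' (closure Ω) ∧
          (∀ᵐ z ∂(MeasureTheory.volume), z ∈ Ω →
            ∀ w : Fin n → ℂ, 0 ≤ (cHessForm n v' z w).re) ∧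
          (∀ᵐ z ∂(MeasureTheory.volume), z ∈ Ω → (cHess n v' z).det = (f z : ℂ)) ∧
          (∀ z ∈ frontier Ω, v' z = 0)) →
        Set.EqOn v' v (closure Ω) := by

  obtain ⟨r, dr, ddr, δ, c, C, G⟩ := exists_geo hn hΩ
  set g : EuclideanSpace ℂ (Fin n) → ℝ := fun z => f z ^ ((1 : ℝ) / n) with hg
  have hg0 : ∀ z ∈ closure Ω, 0 ≤ g z := fun z hz => Real.rpow_nonneg (hf0 z hz) _
  have hgn : ∀ z ∈ Ω, g z ^ n = f z := fun z hz => by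
    simp only [hg, one_div]
    exact Real.rpow_inv_natCast_pow (hf0 z (subset_closure hz)) hn.ne'
  obtain ⟨L, A0, R, S⟩ := G.exists_std hg0 hf
  have hg0' : ∀ z ∈ Ω, 0 ≤ g z := fun z hz => hg0 z (subset_closure hz)
  have e1 : ∀ᵐ z ∂(MeasureTheory.volume), z ∈ Ω →
      ∀ w : Fin n → ℂ, 0 ≤ (cHessForm n (PV Ω g) z w).re := S.eqn.mono fun z hz h => (hz h).1
  have e2 : ∀ᵐ z ∂(MeasureTheory.volume), z ∈ Ω →
      (cHess n (PV Ω g) z).det = ((g z ^ n : ℝ) : ℂ) := S.eqn.mono fun z hz h => (hz h).2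
  have e0 : ∀ z ∈ frontier Ω, PV Ω g z = 0 := fun z hz => S.pv_zero hz
  refine ⟨PV Ω g, ⟨S.c11, S.cont, e1, ?_, e0⟩, ?_⟩
  · filter_upwards [e2] with z hz h
    rw [hz h, hgn z h]
  · rintro v' ⟨c1, k1, p1, d1, b1⟩ z hz
    have d1' : ∀ᵐ z ∂(MeasureTheory.volume), z ∈ Ω →
        (cHess n v' z).det = ((g z ^ n : ℝ) : ℂ) := by
      filter_upwards [d1] with z hz h
      rw [hz h, hgn z h]
    rcases mem_closure_or S.G.op hz with h | h
    · exact le_antisymm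
        (uniq_le hn S.G.op S.G.bd hg0' c1 k1 p1 d1' b1 S.c11 S.cont e2 e0 z h)
        (uniq_le hn S.G.op S.G.bd hg0' S.c11 S.cont e1 e2 e0 c1 k1 d1' b1 z h)
    · rw [b1 z h, e0 z h]
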